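/- There is a positive absolute constant C such that the following holds. If Assumption (A) holds, then the number of characters ψ ∈ Ψ for which the inequality |X₃(P²,ψ)| + ∫_{D⁴}^{P²} |X₃(x,ψ)|·x^{-1} dx < 𝓛^{-585} FAILS is at most C·𝒫·𝓛^{-739}. -/

import Mathlib

open scoped Classical

noncomputable section

/-- The Dirichlet L-function of `χ` (extended to modulus `0` by `0`, a case never used below). -/
def Lfun {N : ℕ} (χ : DirichletCharacter ℂ N) (s : ℂ) : ℂ :=
  if h : N = 0 then 0
  else
    haveI : NeZero N := ⟨h⟩
    DirichletCharacter.LFunction χ s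

/-- A Dirichlet character is *real* if all of its values are real numbers. -/
def IsRealChar {N : ℕ} (χ : DirichletCharacter ℂ N) : Prop :=
  ∀ a : ZMod N, (χ a).im = 0

/-- `𝓛 = log D`. -/
def bigL (D : ℕ) : ℝ := Real.log D

/-- `P = exp (𝓛 ^ 9)`. -/
def bigP (D : ℕ) : ℝ := Real.exp (bigL D ^ 9)

/-- Assumption (A): `L(1, χ) < 𝓛 ^ (-2022)`. -/
def AssumptionA (D : ℕ) (χ : DirichletCharacter ℂ D) : Prop :=
  (Lfun χ 1).re < bigL D ^ (-2022 : ℤ)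

/-- `p ~ P`, i.e. `p` is a prime with `P < p < P * (1 + 𝓛 ^ (-68))`. -/
def SimP (D p : ℕ) : Prop :=
  p.Prime ∧ bigP D < (p : ℝ) ∧ (p : ℝ) < bigP D * (1 + bigL D ^ (-68 : ℤ))

/-- The finite set of primes `p ~ P`. -/
def primesP (D : ℕ) : Finset ℕ :=
  (Finset.range ⌈2 * bigP D⌉₊).filter (SimP D)

/-- `𝒫 = ∑_{p ~ P} p`. -/
def calP (D : ℕ) : ℝ := ∑ p ∈ primesP D, (p : ℝ)

/-- `ν(n) = ∑_{d ∣ n} χ(d)`. -/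
def nuF (D : ℕ) (χ : DirichletCharacter ℂ D) (n : ℕ) : ℂ :=
  ∑ d ∈ n.divisors, χ (d : ZMod D)

/-- `υ(n) = ∑_{ab = n} μ(a) μ(b) χ(b)`. -/
def upsF (D : ℕ) (χ : DirichletCharacter ℂ D) (n : ℕ) : ℂ :=
  ∑ d ∈ n.divisors,
    ((ArithmeticFunction.moebius (n / d) : ℤ) : ℂ) * ((ArithmeticFunction.moebius d : ℤ) : ℂ) *
      χ (d : ZMod D)

/-- `t₀ = 𝓛 ^ 519`. -/
def t0 (D : ℕ) : ℝ := bigL D ^ 519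

/-- `s₀ = 1/2 + 2 π i t₀`. -/
def s0 (D : ℕ) : ℂ := 1 / 2 + 2 * (Real.pi : ℂ) * Complex.I * (t0 D : ℂ)

/-- `𝓛₁ = 𝓛 ^ 405`. -/
def bigL1 (D : ℕ) : ℝ := bigL D ^ 405

/-- `ν` truncated to `n ≤ D ^ 4`, as an arithmetic function. -/
def nuT (D : ℕ) (χ : DirichletCharacter ℂ D) : ArithmeticFunction ℂ :=
  ⟨fun n => if n = 0 then 0 else if n ≤ D ^ 4 then nuF D χ n else 0, by simp⟩

/-- `υ` truncated to `n ≤ D ^ 4`, as an arithmetic function. -/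
def upsT (D : ℕ) (χ : DirichletCharacter ℂ D) : ArithmeticFunction ℂ :=
  ⟨fun n => if n = 0 then 0 else if n ≤ D ^ 4 then upsF D χ n else 0, by simp⟩

/-- `ν₂₀`, the 20-fold Dirichlet convolution of the truncation of `ν`. -/
def nu20 (D : ℕ) (χ : DirichletCharacter ℂ D) (n : ℕ) : ℂ := (nuT D χ ^ 20) n

/-- `υ₂₀`, the 20-fold Dirichlet convolution of the truncation of `υ`. -/
def ups20 (D : ℕ) (χ : DirichletCharacter ℂ D) (n : ℕ) : ℂ := (upsT D χ ^ 20) n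

/-- `ς(n) = ∑_{lm = n, l ≤ D⁴, m ≤ D⁴} ν(l) υ(m)`. -/
def sigF (D : ℕ) (χ : DirichletCharacter ℂ D) (n : ℕ) : ℂ :=
  ∑ d ∈ n.divisors,
    if d ≤ D ^ 4 ∧ n / d ≤ D ^ 4 then nuF D χ d * upsF D χ (n / d) else 0

/-- `X₁(x, ψ) = ∑_{n ≤ x} ν₂₀(n) ψ(n) n^{-s₀}`. -/
def X1 (D : ℕ) (χ : DirichletCharacter ℂ D) {p : ℕ} (ψ : DirichletCharacter ℂ p) (x : ℝ) : ℂ :=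
  ∑ n ∈ Finset.Icc 1 ⌊x⌋₊, nu20 D χ n * ψ (n : ZMod p) * (n : ℂ) ^ (-s0 D)

/-- `X₂(x, ψ) = ∑_{n ≤ x} υ₂₀(n) ψ(n) n^{-s₀}`. -/
def X2 (D : ℕ) (χ : DirichletCharacter ℂ D) {p : ℕ} (ψ : DirichletCharacter ℂ p) (x : ℝ) : ℂ :=
  ∑ n ∈ Finset.Icc 1 ⌊x⌋₊, ups20 D χ n * ψ (n : ZMod p) * (n : ℂ) ^ (-s0 D)

/-- `X₃(x, ψ) = ∑_{D⁴ < n ≤ x} ν(n) ψ(n) n^{-s₀}`. -/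
def X3 (D : ℕ) (χ : DirichletCharacter ℂ D) {p : ℕ} (ψ : DirichletCharacter ℂ p) (x : ℝ) : ℂ :=
  ∑ n ∈ Finset.Ioc (D ^ 4) ⌊x⌋₊, nuF D χ n * ψ (n : ZMod p) * (n : ℂ) ^ (-s0 D)

/-- `X₄(x, ψ) = ∑_{D⁴ < n ≤ x} ς(n) ψ(n) n^{-s₀}`. -/
def X4 (D : ℕ) (χ : DirichletCharacter ℂ D) {p : ℕ} (ψ : DirichletCharacter ℂ p) (x : ℝ) : ℂ :=
  ∑ n ∈ Finset.Ioc (D ^ 4) ⌊x⌋₊, sigF D χ n * ψ (n : ZMod p) * (n : ℂ) ^ (-s0 D)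

/-- Inequality (3.4). -/
def Ineq1 (D : ℕ) (χ : DirichletCharacter ℂ D) {p : ℕ} (ψ : DirichletCharacter ℂ p) : Prop :=
  ‖X1 D χ ψ ((D : ℝ) ^ 80)‖ + ‖X2 D χ ψ ((D : ℝ) ^ 80)‖ +
      (∫ x in (1 : ℝ)..((D : ℝ) ^ 80), (‖X1 D χ ψ x‖ + ‖X2 D χ ψ x‖) / x) <
    bigL D ^ 1171

/-- Inequality (3.5). -/
def Ineq2 (D : ℕ) (χ : DirichletCharacter ℂ D) {p : ℕ} (ψ : DirichletCharacter ℂ p) : Prop :=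
  ‖X3 D χ ψ (bigP D ^ 2)‖ + (∫ x in ((D : ℝ) ^ 4)..(bigP D ^ 2), ‖X3 D χ ψ x‖ / x) <
    bigL D ^ (-585 : ℤ)

/-- Inequality (3.6). -/
def Ineq3 (D : ℕ) (χ : DirichletCharacter ℂ D) {p : ℕ} (ψ : DirichletCharacter ℂ p) : Prop :=
  ‖X4 D χ ψ ((D : ℝ) ^ 8)‖ + (∫ x in ((D : ℝ) ^ 4)..((D : ℝ) ^ 8), ‖X4 D χ ψ x‖ / x) <
    bigL D ^ (-633 : ℤ)

/-- Membership in `Ψ₁`: `ψ` is a primitive character mod `p` with `p ~ P` satisfying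
(3.4), (3.5) and (3.6). -/
def MemPsi1 (D : ℕ) (χ : DirichletCharacter ℂ D) {p : ℕ} (ψ : DirichletCharacter ℂ p) : Prop :=
  SimP D p ∧ ψ.IsPrimitive ∧ Ineq1 D χ ψ ∧ Ineq2 D χ ψ ∧ Ineq3 D χ ψ

/-- `F(s, ψ) = ∑_{n ≤ D⁴} ν(n) ψ(n) n^{-s}`. -/
def Ffun (D : ℕ) (χ : DirichletCharacter ℂ D) {p : ℕ} (ψ : DirichletCharacter ℂ p) (s : ℂ) : ℂ :=
  ∑ n ∈ Finset.Icc 1 (D ^ 4), nuF D χ n * ψ (n : ZMod p) * (n : ℂ) ^ (-s)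

/-- `G(s, ψ) = ∑_{n ≤ D⁴} υ(n) ψ(n) n^{-s}`. -/
def Gfun (D : ℕ) (χ : DirichletCharacter ℂ D) {p : ℕ} (ψ : DirichletCharacter ℂ p) (s : ℂ) : ℂ :=
  ∑ n ∈ Finset.Icc 1 (D ^ 4), upsF D χ n * ψ (n : ZMod p) * (n : ℂ) ^ (-s)

/-- `F'(s, ψ) = -∑_{n ≤ D⁴} ν(n) ψ(n) (log n) n^{-s}`, the derivative of `F` in `s`. -/
def Ffun' (D : ℕ) (χ : DirichletCharacter ℂ D) {p : ℕ} (ψ : DirichletCharacter ℂ p) (s : ℂ) : ℂ :=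
  -∑ n ∈ Finset.Icc 1 (D ^ 4),
    nuF D χ n * ψ (n : ZMod p) * ((Real.log n : ℝ) : ℂ) * (n : ℂ) ^ (-s)

/-- `F(1 - s, ψ̄) = ∑_{n ≤ D⁴} ν(n) conj(ψ(n)) n^{s - 1}`, as a function of `s`. -/
def FfunBar (D : ℕ) (χ : DirichletCharacter ℂ D) {p : ℕ} (ψ : DirichletCharacter ℂ p)
    (s : ℂ) : ℂ :=
  ∑ n ∈ Finset.Icc 1 (D ^ 4),
    nuF D χ n * (starRingEnd ℂ) (ψ (n : ZMod p)) * (n : ℂ) ^ (s - 1)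

/-- The region `Ω`. -/
def InOmega (D : ℕ) (s : ℂ) : Prop :=
  |(s - s0 D).re| < 1 / 2 ∧ |(s - s0 D).im| < bigL1 D + 2

/-- The region `Ω₁`. -/
def InOmega1 (D : ℕ) (s : ℂ) : Prop :=
  1 / 2 - Real.log (bigL D) / (100 * bigL D) < s.re ∧
    s.re < 1 + Real.log (bigL D) / (100 * bigL D) ∧
    |s.im - 2 * Real.pi * t0 D| < bigL1 D + 5

/-- The region `Ω₂`. -/
def InOmega2 (D : ℕ) (s : ℂ) : Prop :=
  1 / 2 - (bigL D)⁻¹ < s.re ∧ s.re < 1 + (bigL D)⁻¹ ∧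
    |s.im - 2 * Real.pi * t0 D| < bigL1 D + 4

/-- `α = π / log P`. -/
def alphaD (D : ℕ) : ℝ := Real.pi / Real.log (bigP D)

/-- The region `Ω₃`. -/
def InOmega3 (D : ℕ) (s : ℂ) : Prop :=
  1 / 2 - alphaD D < s.re ∧ s.re < 1 + alphaD D ∧
    |s.im - 2 * Real.pi * t0 D| < bigL1 D + 3

/-- The Gauss sum `τ(θ) = ∑_{a mod k} θ(a) e(a/k)`. -/
def tauSum {k : ℕ} (θ : DirichletCharacter ℂ k) : ℂ :=
  ∑ a ∈ Finset.range k,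
    θ (a : ZMod k) * Complex.exp (2 * (Real.pi : ℂ) * Complex.I * (a : ℂ) / (k : ℂ))

/-- The factor `Z(s, θ)` from the functional equation. -/
def Zfun {k : ℕ} (θ : DirichletCharacter ℂ k) (s : ℂ) : ℂ :=
  if θ (-1) = 1 then
    tauSum θ * (Real.pi : ℂ) ^ (s - 1 / 2) * (k : ℂ) ^ (-s) *
      Complex.Gamma ((1 - s) / 2) / Complex.Gamma (s / 2)
  else
    -Complex.I * tauSum θ * (Real.pi : ℂ) ^ (s - 1 / 2) * (k : ℂ) ^ (-s) *
      Complex.Gamma ((2 - s) / 2) / Complex.Gamma ((1 + s) / 2)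

/-- The product character `χψ` modulo `D * p`, i.e. `n ↦ χ(n) ψ(n)`. -/
def chiPsi (D : ℕ) (χ : DirichletCharacter ℂ D) {p : ℕ} (ψ : DirichletCharacter ℂ p) :
    DirichletCharacter ℂ (D * p) :=
  DirichletCharacter.changeLevel (dvd_mul_right D p) χ *
    DirichletCharacter.changeLevel (dvd_mul_left p D) ψ

/-- `Z̃(s, ψ) = Z(s, ψ) Z(s, χψ)`. -/
def Ztilde (D : ℕ) (χ : DirichletCharacter ℂ D) {p : ℕ} (ψ : DirichletCharacter ℂ p)
    (s : ℂ) : ℂ :=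
  Zfun ψ s * Zfun (chiPsi D χ ψ) s

/-- `T = exp (𝓛 ^ 1.1)`. -/
def bigT (D : ℕ) : ℝ := Real.exp (bigL D ^ (1.1 : ℝ))

/-- `P₄ = P T⁻² t₀`. -/
def P4 (D : ℕ) : ℝ := bigP D * bigT D ^ (-2 : ℤ) * t0 D

/-- The smooth weight `g(x) = π^{-1/2} ∫_{-∞}^{𝓛^{15} log x} e^{-u²} du`. -/
def gfun (D : ℕ) (x : ℝ) : ℝ :=
  Real.pi ^ (-(1 : ℝ) / 2) * ∫ u in Set.Iio (bigL D ^ 15 * Real.log x), Real.exp (-u ^ 2)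

/-- `g*(y) = g(y)` for `y > 1/2`, and `0` otherwise. -/
def gstar (D : ℕ) (y : ℝ) : ℝ := if 1 / 2 < y then gfun D y else 0

/-- `K(s, ψ) = ∑_n ψ(n) n^{-s} g*(P₄ / n)`. -/
def Kfun (D : ℕ) {p : ℕ} (ψ : DirichletCharacter ℂ p) (s : ℂ) : ℂ :=
  ∑' n : ℕ, ψ (n : ZMod p) * (n : ℂ) ^ (-s) * ((gstar D (P4 D / n) : ℝ) : ℂ)

/-- `N(1 - s, ψ̄) = ∑_n conj(ψ(n)) n^{s-1} g*(T² / n)`, as a function of `s`. -/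
def Nfun (D : ℕ) {p : ℕ} (ψ : DirichletCharacter ℂ p) (s : ℂ) : ℂ :=
  ∑' n : ℕ,
    (starRingEnd ℂ) (ψ (n : ZMod p)) * (n : ℂ) ^ (s - 1) * ((gstar D (bigT D ^ 2 / n) : ℝ) : ℂ)

/-- `𝔞 = (6/π²) L'(1,χ)² ∏_{q ∣ D} q/(q+1)`. -/
def fraka (D : ℕ) (χ : DirichletCharacter ℂ D) : ℂ :=
  6 / (Real.pi : ℂ) ^ 2 * deriv (Lfun χ) 1 ^ 2 * ∏ q ∈ D.primeFactors, (q : ℂ) / ((q : ℂ) + 1)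

/-- summand of the Euler-Maclaurin type expansion of `(s-1) ζ(s)` -/
def zt (n : ℕ) (s : ℂ) : ℂ :=
  (s - 1) * ((n + 1 : ℝ) : ℂ) ^ (-s) - ((n + 1 : ℝ) : ℂ) ^ (1 - s) + ((n + 1 + 1 : ℝ) : ℂ) ^ (1 - s)

lemma hasDerivAt_ofReal_cpow_aux (u : ℝ) (hu : 0 < u) (r : ℂ) :
    HasDerivAt (fun y : ℝ => (y : ℂ) ^ r) (r * (u : ℂ) ^ (r - 1)) u := by
  have h1 : HasDerivAt (fun z : ℂ => z ^ r) (r * (u : ℂ) ^ (r - 1)) (u : ℂ) := by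
    have := (hasDerivAt_id (u : ℂ)).cpow_const (c := r) (Or.inl (by simpa using hu))
    simpa using this
  exact h1.comp_ofReal

lemma cpow_diff_bound (a u : ℝ) (ha : 0 < a) (hau : a ≤ u) (s : ℂ) (hs : 0 < s.re) :
    ‖(u : ℂ) ^ (-s) - (a : ℂ) ^ (-s)‖ ≤ ‖s‖ * a ^ (-s.re - 1) * (u - a) := by
  refine norm_image_sub_le_of_norm_deriv_le_segment' (f := fun y : ℝ => (y : ℂ) ^ (-s))
    (f' := fun y : ℝ => -s * (y : ℂ) ^ (-s - 1)) (b := u) ?_ ?_ u ⟨hau, le_rfl⟩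
  · intro x hx
    exact (hasDerivAt_ofReal_cpow_aux x (by linarith [hx.1]) (-s)).hasDerivWithinAt
  · intro x hx
    have hx0 : 0 < x := by linarith [hx.1]
    rw [norm_mul, norm_neg, Complex.norm_cpow_eq_rpow_re_of_pos hx0]
    refine mul_le_mul_of_nonneg_left ?_ (norm_nonneg _)
    simp only [Complex.sub_re, Complex.neg_re, Complex.one_re]
    exact Real.rpow_le_rpow_of_nonpos ha hx.1 (by linarith)

lemma zt_bound (n : ℕ) (s : ℂ) (hs : 0 < s.re) :
    ‖zt n s‖ ≤ ‖s - 1‖ * ‖s‖ * (n + 1 : ℝ) ^ (-s.re - 1) := by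
  set a : ℝ := n + 1 with ha
  have ha0 : 0 < a := by positivity
  have key := norm_image_sub_le_of_norm_deriv_le_segment'
    (f := fun y : ℝ => (y : ℂ) ^ (1 - s) + (s - 1) * (a : ℂ) ^ (-s) * (y : ℂ))
    (f' := fun y : ℝ => (1 - s) * (y : ℂ) ^ (1 - s - 1) + (s - 1) * (a : ℂ) ^ (-s) * 1)
    (a := a) (b := a + 1) (C := ‖s - 1‖ * ‖s‖ * a ^ (-s.re - 1)) ?_ ?_ (a + 1) ⟨by linarith, le_rfl⟩
  · have e : zt n s = ((a + 1 : ℝ) : ℂ) ^ (1 - s) + (s - 1) * (a : ℂ) ^ (-s) * ((a + 1 : ℝ) : ℂ) -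
        ((a : ℂ) ^ (1 - s) + (s - 1) * (a : ℂ) ^ (-s) * (a : ℂ)) := by
      unfold zt
      rw [← ha]
      push_cast
      ring
    rw [e]
    simpa using key
  · intro x hx
    have hx0 : 0 < x := by linarith [hx.1]
    refine HasDerivAt.hasDerivWithinAt ?_
    refine (hasDerivAt_ofReal_cpow_aux x hx0 (1 - s)).add ?_
    exact (Complex.ofRealCLM.hasDerivAt (x := x)).const_mul _
  · intro x hx
    have hx0 : 0 < x := by linarith [hx.1]
    have e : (1 - s) * (x : ℂ) ^ (1 - s - 1) + (s - 1) * (a : ℂ) ^ (-s) * 1 =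
        -((s - 1) * ((x : ℂ) ^ (-s) - (a : ℂ) ^ (-s))) := by
      rw [show (1 : ℂ) - s - 1 = -s by ring]; ring
    rw [e, norm_neg, norm_mul, mul_assoc]
    refine mul_le_mul_of_nonneg_left ?_ (norm_nonneg _)
    refine (cpow_diff_bound a x ha0 hx.1 s hs).trans ?_
    have : 0 ≤ ‖s‖ * a ^ (-s.re - 1) := by positivity
    nlinarith [hx.2]

lemma zt_differentiable (n : ℕ) : Differentiable ℂ (zt n) := by
  unfold zt
  have h1 : ((n + 1 : ℝ) : ℂ) ≠ 0 := by
    have : (0 : ℝ) < n + 1 := by positivity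
    exact_mod_cast this.ne'
  have h2 : ((n + 1 + 1 : ℝ) : ℂ) ≠ 0 := by
    have : (0 : ℝ) < n + 1 + 1 := by positivity
    exact_mod_cast this.ne'
  intro s
  refine DifferentiableAt.add (DifferentiableAt.sub (DifferentiableAt.mul (by fun_prop) ?_) ?_) ?_
  · exact DifferentiableAt.const_cpow (by fun_prop) (Or.inl h1)
  · exact DifferentiableAt.const_cpow (by fun_prop) (Or.inl h1)
  · exact DifferentiableAt.const_cpow (by fun_prop) (Or.inl h2)

lemma zt_sum_range (N : ℕ) (s : ℂ) :
    ∑ n ∈ Finset.range N, zt n s =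
      (s - 1) * ∑ n ∈ Finset.range N, ((n + 1 : ℝ) : ℂ) ^ (-s) + ((N + 1 : ℝ) : ℂ) ^ (1 - s) - 1 := by
  induction N with
  | zero => simp
  | succ N ih =>
    rw [Finset.sum_range_succ, ih, Finset.sum_range_succ, zt]
    push_cast
    ring

lemma zt_summable (s : ℂ) (hs : 0 < s.re) : Summable (fun n => zt n s) := by
  refine Summable.of_norm_bounded (g := fun n : ℕ => ‖s - 1‖ * ‖s‖ * (n + 1 : ℝ) ^ (-s.re - 1)) ?_
    (fun n => zt_bound n s hs)
  refine Summable.mul_left _ ?_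
  have := (summable_nat_add_iff 1).mpr (Real.summable_nat_rpow.mpr (show -s.re - 1 < -1 by linarith))
  simpa using this

lemma zt_tsum_of_one_lt (s : ℂ) (hs : 1 < s.re) : riemannZeta₁ s = 1 + ∑' n, zt n s := by
  have h1 : s ≠ 1 := by rintro rfl; simp at hs
  have hz : riemannZeta₁ s = (s - 1) * riemannZeta s := by
    rw [riemannZeta_eq_inv_sub_mul h1, ← mul_assoc, mul_inv_cancel₀ (sub_ne_zero.mpr h1), one_mul]
  have hsum : Summable (fun n : ℕ => ((n + 1 : ℝ) : ℂ) ^ (-s)) := by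
    have := (summable_nat_add_iff 1).mpr (Complex.summable_one_div_nat_cpow.mpr hs)
    refine this.congr fun n => ?_
    rw [Complex.cpow_neg, one_div]; push_cast; rfl
  have hz2 : riemannZeta s = ∑' n : ℕ, ((n + 1 : ℝ) : ℂ) ^ (-s) := by
    rw [zeta_eq_tsum_one_div_nat_add_one_cpow hs]
    refine tsum_congr fun n => ?_
    rw [Complex.cpow_neg, one_div]; push_cast; rfl
  have t1 := (zt_summable s (by linarith)).hasSum.tendsto_sum_nat
  have t2 : Filter.Tendsto (fun N => ∑ n ∈ Finset.range N, zt n s) Filter.atTop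
      (nhds ((s - 1) * riemannZeta s + 0 - 1)) := by
    simp only [zt_sum_range]
    refine ((hz2 ▸ hsum.hasSum.tendsto_sum_nat).const_mul _ |>.add ?_).sub_const _
    rw [tendsto_zero_iff_norm_tendsto_zero]
    have : ∀ N : ℕ, ‖((N + 1 : ℝ) : ℂ) ^ (1 - s)‖ = (N + 1 : ℝ) ^ (-(s.re - 1)) := by
      intro N
      rw [Complex.norm_cpow_eq_rpow_re_of_pos (by positivity)]
      simp
    simp only [this]
    exact (tendsto_rpow_neg_atTop (by linarith)).comp
      (Filter.tendsto_atTop_add_const_right _ _ tendsto_natCast_atTop_atTop)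
  have := tendsto_nhds_unique t1 t2
  rw [this, hz]; ring

lemma zt_tsum (s : ℂ) (hs : 1 / 2 < s.re) : riemannZeta₁ s = 1 + ∑' n, zt n s := by
  set U : Set ℂ := {z | 1 / 2 < z.re} ∩ Metric.ball 0 (‖s‖ + 3) with hU
  have hUo : IsOpen U := (isOpen_lt continuous_const Complex.continuous_re).inter Metric.isOpen_ball
  have hUc : Convex ℝ U := (convex_halfSpace_re_gt _).inter (convex_ball _ _)
  have hd : DifferentiableOn ℂ (fun w => ∑' n, zt n w) U := by
    refine Complex.differentiableOn_tsum_of_summable_norm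
      (u := fun n : ℕ => (‖s‖ + 4) * (‖s‖ + 3) * (n + 1 : ℝ) ^ (-(3 / 2) : ℝ)) ?_
      (fun n => (zt_differentiable n).differentiableOn) hUo ?_
    · refine Summable.mul_left _ ?_
      have := (summable_nat_add_iff 1).mpr (Real.summable_nat_rpow.mpr (show (-(3/2) : ℝ) < -1 by norm_num))
      simpa using this
    · rintro n w ⟨hw1, hw2⟩
      have hw1' : 1 / 2 < w.re := hw1
      have hw2' : ‖w‖ < ‖s‖ + 3 := by simpa using hw2
      refine (zt_bound n w (by linarith)).trans ?_
      have : ‖w - 1‖ ≤ ‖s‖ + 4 := (norm_sub_le _ _).trans (by simp; linarith)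
      gcongr
      · have : (0 : ℝ) ≤ n := by positivity
        linarith
      · linarith
  have hA : AnalyticOnNhd ℂ riemannZeta₁ U :=
    (differentiable_riemannZeta₁.differentiableOn).analyticOnNhd hUo
  have hB : AnalyticOnNhd ℂ (fun w => 1 + ∑' n, zt n w) U :=
    ((differentiableOn_const _).add hd).analyticOnNhd hUo
  have h2 : (2 : ℂ) ∈ U := by
    refine ⟨by simp; norm_num, ?_⟩
    simp; linarith [norm_nonneg s]
  refine hA.eqOn_of_preconnected_of_eventuallyEq hB hUc.isPreconnected h2 ?_ ⟨hs, by simp⟩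
  have : ∀ᶠ z : ℂ in nhds 2, 1 < z.re :=
    (isOpen_lt continuous_const Complex.continuous_re).mem_nhds (by simp)
  filter_upwards [this] with z hz using zt_tsum_of_one_lt z hz

lemma sqrt_telescope (m : ℕ) (hm : 1 ≤ m) :
    ((m : ℝ) + 1) ^ (-(3 / 2) : ℝ) ≤ 2 * (1 / √(m : ℝ) - 1 / √((m : ℝ) + 1)) := by
  have hm0 : (0 : ℝ) < m := by exact_mod_cast hm
  set a := √(m : ℝ) with ha
  set b := √((m : ℝ) + 1) with hb
  have ha0 : 0 < a := Real.sqrt_pos.mpr hm0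
  have hb0 : 0 < b := Real.sqrt_pos.mpr (by linarith)
  have hab : a ≤ b := Real.sqrt_le_sqrt (by linarith)
  have ha2 : a ^ 2 = m := Real.sq_sqrt hm0.le
  have hb2 : b ^ 2 = m + 1 := Real.sq_sqrt (by linarith)
  have e : ((m : ℝ) + 1) ^ (-(3 / 2) : ℝ) = 1 / b ^ 3 := by
    rw [← hb2, ← Real.rpow_natCast b 2, ← Real.rpow_mul hb0.le, one_div, ← Real.rpow_natCast b 3,
      ← Real.rpow_neg hb0.le]
    norm_num
  rw [e]
  have e2 : 1 / a - 1 / b = 1 / (a * b * (a + b)) := by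
    have : (b - a) * (a + b) = 1 := by nlinarith
    field_simp
    linarith
  rw [e2, mul_one_div, div_le_div_iff₀ (by positivity) (by positivity)]
  nlinarith [mul_le_mul hab hab ha0.le hb0.le, mul_pos ha0 hb0]

lemma zt_tail (N : ℕ) (hN : 1 ≤ N) (s : ℂ) (hs : 1 / 2 < s.re) :
    ‖∑' n, zt (n + N) s‖ ≤ 2 * (‖s - 1‖ * ‖s‖ * (N : ℝ) ^ (-s.re)) := by
  have hN0 : (0 : ℝ) < N := by exact_mod_cast hN
  set K : ℝ := ‖s - 1‖ * ‖s‖ * (N : ℝ) ^ (1 / 2 - s.re) with hK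
  have hK0 : 0 ≤ K := by positivity
  have hsum : HasSum (fun n : ℕ => K * (2 * (1 / √((n + N : ℕ) : ℝ) - 1 / √(((n + N : ℕ) : ℝ) + 1))))
      (K * (2 * (1 / √(N : ℝ)))) := by
    refine HasSum.mul_left _ (HasSum.mul_left _ ?_)
    rw [hasSum_iff_tendsto_nat_of_nonneg]
    · have : ∀ M : ℕ, ∑ n ∈ Finset.range M, (1 / √((n + N : ℕ) : ℝ) - 1 / √(((n + N : ℕ) : ℝ) + 1)) =
          1 / √(N : ℝ) - 1 / √((M + N : ℕ) : ℝ) := by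
        intro M
        induction M with
        | zero => simp
        | succ M ih =>
          rw [Finset.sum_range_succ, ih]
          have : ((M + 1 + N : ℕ) : ℝ) = ((M + N : ℕ) : ℝ) + 1 := by push_cast; ring
          rw [this]; ring
      simp only [this]
      have h : Filter.Tendsto (fun M : ℕ => 1 / √((M + N : ℕ) : ℝ)) Filter.atTop (nhds 0) := by
        have h1 : Filter.Tendsto (fun M : ℕ => √((M + N : ℕ) : ℝ)) Filter.atTop Filter.atTop :=
          Real.tendsto_sqrt_atTop.comp (tendsto_natCast_atTop_atTop.comp
            (Filter.tendsto_add_atTop_nat N))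
        simp only [one_div]
        exact h1.inv_tendsto_atTop
      simpa using h.const_sub (1 / √(N : ℝ))
    · intro n
      have h0 : (0 : ℝ) < ((n + N : ℕ) : ℝ) := by exact_mod_cast (by omega)
      have := one_div_le_one_div_of_le (Real.sqrt_pos.mpr h0)
        (Real.sqrt_le_sqrt (show ((n + N : ℕ) : ℝ) ≤ ((n + N : ℕ) : ℝ) + 1 by linarith))
      linarith
  refine (tsum_of_norm_bounded hsum ?_).trans ?_
  · intro n
    refine (zt_bound (n + N) s (by linarith)).trans ?_
    rw [hK, mul_assoc (‖s - 1‖ * ‖s‖)]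
    refine mul_le_mul_of_nonneg_left ?_ (by positivity)
    have h0 : (0 : ℝ) < ((n + N : ℕ) : ℝ) + 1 := by positivity
    rw [show -s.re - 1 = (1 / 2 - s.re) + (-(3 / 2)) by ring, Real.rpow_add h0]
    refine mul_le_mul ?_ (sqrt_telescope (n + N) (by omega)) (by positivity) (by positivity)
    refine Real.rpow_le_rpow_of_nonpos hN0 ?_ (by linarith)
    push_cast
    have : (0 : ℝ) ≤ n := by positivity
    linarith
  · refine le_of_eq ?_
    have : (N : ℝ) ^ (-s.re) = (N : ℝ) ^ (1 / 2 - s.re) * (1 / √(N : ℝ)) := by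
      rw [Real.sqrt_eq_rpow, one_div ((N : ℝ) ^ (1 / 2 : ℝ)), ← Real.rpow_neg hN0.le,
        ← Real.rpow_add hN0]
      congr 1; ring
    rw [this, hK]; ring

lemma zeta1_bound (N : ℕ) (hN : 1 ≤ N) (s : ℂ) (hs : 1 / 2 < s.re) :
    ‖riemannZeta₁ s‖ ≤ ‖s - 1‖ * ∑ n ∈ Finset.range N, (n + 1 : ℝ) ^ (-s.re) +
      (N + 1 : ℝ) ^ (1 - s.re) + 2 * (‖s - 1‖ * ‖s‖ * (N : ℝ) ^ (-s.re)) := by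
  rw [zt_tsum s hs, ← (zt_summable s (by linarith)).sum_add_tsum_nat_add N, zt_sum_range]
  have : (1 : ℂ) + ((s - 1) * ∑ n ∈ Finset.range N, ((n + 1 : ℝ) : ℂ) ^ (-s) +
      ((N + 1 : ℝ) : ℂ) ^ (1 - s) - 1 + ∑' n, zt (n + N) s) =
      (s - 1) * ∑ n ∈ Finset.range N, ((n + 1 : ℝ) : ℂ) ^ (-s) +
      ((N + 1 : ℝ) : ℂ) ^ (1 - s) + ∑' n, zt (n + N) s := by ring
  rw [this]
  refine (norm_add₃_le).trans (add_le_add (add_le_add ?_ ?_) (zt_tail N hN s hs))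
  · rw [norm_mul]
    refine mul_le_mul_of_nonneg_left ((norm_sum_le _ _).trans (Finset.sum_le_sum fun n _ => ?_))
      (norm_nonneg _)
    rw [Complex.norm_cpow_eq_rpow_re_of_pos (by positivity)]
    simp
  · rw [Complex.norm_cpow_eq_rpow_re_of_pos (by positivity)]
    simp

lemma zeta_growth (r : ℝ) (hr : 0 < r) (hr2 : r < 1 / 2) : ∃ C : ℝ, 0 < C ∧ ∀ s : ℂ,
    1 - r ≤ s.re → s.re ≤ 3 → 1 ≤ |s.im| → ‖riemannZeta s‖ ≤ C * |s.im| ^ (2 * r) := by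
  refine ⟨(1 + 1 / r) * 2 + 3 + 8, by positivity, fun s h1 h3 ht => ?_⟩
  set t := |s.im| with htd
  have ht0 : 0 < t := by linarith
  set N := ⌈t⌉₊ with hNd
  have hNt : t ≤ N := Nat.le_ceil t
  have hN1 : 1 ≤ N := Nat.one_le_ceil_iff.mpr ht0
  have hN2 : (N : ℝ) ≤ 2 * t := by linarith [Nat.ceil_lt_add_one ht0.le]
  have hN0 : (0 : ℝ) < N := by linarith
  have hN1' : (1 : ℝ) ≤ N := by linarith
  have hs1 : s ≠ 1 := by
    rintro rfl
    simp at htd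
    linarith
  have hst : t ≤ ‖s - 1‖ := by
    have := Complex.abs_im_le_norm (s - 1)
    simpa using this
  have hpos : 0 < ‖s - 1‖ := by linarith
  have hsn : ‖s‖ ≤ 4 * t := by
    refine (Complex.norm_le_abs_re_add_abs_im s).trans ?_
    have : |s.re| ≤ 3 := abs_le.mpr ⟨by linarith, h3⟩
    linarith
  have hz : ‖riemannZeta s‖ = ‖riemannZeta₁ s‖ / ‖s - 1‖ := by
    rw [riemannZeta_eq_inv_sub_mul hs1, norm_mul, norm_inv]; field_simp
  have htr : 1 ≤ t ^ r := Real.one_le_rpow ht hr.le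
  have ht2r : t ^ (2 * r) = t ^ r * t ^ r := by rw [two_mul, Real.rpow_add ht0]
  have hr2r : t ^ r ≤ t ^ (2 * r) := by rw [ht2r]; nlinarith
  have h12r : 1 ≤ t ^ (2 * r) := by linarith
  -- first sum
  have b1 : ∑ n ∈ Finset.range N, (n + 1 : ℝ) ^ (-s.re) ≤ (1 + 1 / r) * 2 * t ^ (2 * r) := by
    have c1 : ∑ n ∈ Finset.range N, (n + 1 : ℝ) ^ (-s.re) ≤
        ∑ n ∈ Finset.range N, (N : ℝ) ^ r * ((n + 1 : ℝ)⁻¹) := by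
      refine Finset.sum_le_sum fun n hn => ?_
      have hn' : (n : ℝ) + 1 ≤ N := by exact_mod_cast Finset.mem_range.mp hn
      have hn1 : (1 : ℝ) ≤ n + 1 := by
        have : (0 : ℝ) ≤ n := by positivity
        linarith
      calc (n + 1 : ℝ) ^ (-s.re) ≤ (n + 1 : ℝ) ^ (r + (-1)) :=
            Real.rpow_le_rpow_of_exponent_le hn1 (by linarith)
        _ = (n + 1 : ℝ) ^ r * (n + 1 : ℝ)⁻¹ := by
            rw [Real.rpow_add (by linarith), Real.rpow_neg_one]
        _ ≤ _ := by gcongr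
    rw [← Finset.mul_sum] at c1
    have c2 : ∑ n ∈ Finset.range N, ((n + 1 : ℝ)⁻¹) ≤ 1 + Real.log N := by
      have := harmonic_le_one_add_log N
      simpa [harmonic] using this
    have c3 : Real.log N ≤ (N : ℝ) ^ r / r := Real.log_le_rpow_div hN0.le hr
    have c4 : 1 ≤ (N : ℝ) ^ r := Real.one_le_rpow hN1' hr.le
    have c5 : (N : ℝ) ^ r * (N : ℝ) ^ r ≤ 2 * t ^ (2 * r) := by
      rw [← Real.rpow_add hN0, ← two_mul]
      calc (N : ℝ) ^ (2 * r) ≤ (2 * t) ^ (2 * r) := by gcongr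
        _ = 2 ^ (2 * r) * t ^ (2 * r) := Real.mul_rpow (by norm_num) ht0.le
        _ ≤ 2 ^ (1 : ℝ) * t ^ (2 * r) := by
            gcongr
            · norm_num
            · linarith
        _ = _ := by simp
    calc _ ≤ (N : ℝ) ^ r * ∑ n ∈ Finset.range N, ((n + 1 : ℝ)⁻¹) := c1
      _ ≤ (N : ℝ) ^ r * ((N : ℝ) ^ r + (N : ℝ) ^ r / r) := by gcongr; linarith
      _ = (1 + 1 / r) * ((N : ℝ) ^ r * (N : ℝ) ^ r) := by ring
      _ ≤ (1 + 1 / r) * (2 * t ^ (2 * r)) := by gcongr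
      _ = _ := by ring
  have b2 : (N + 1 : ℝ) ^ (1 - s.re) ≤ 3 * t ^ (2 * r) := by
    calc (N + 1 : ℝ) ^ (1 - s.re) ≤ (N + 1 : ℝ) ^ r :=
          Real.rpow_le_rpow_of_exponent_le (by linarith) (by linarith)
      _ ≤ (3 * t) ^ r := by gcongr; linarith
      _ = 3 ^ r * t ^ r := Real.mul_rpow (by norm_num) ht0.le
      _ ≤ 3 ^ (1 : ℝ) * t ^ (2 * r) := by
          refine mul_le_mul ?_ hr2r (by positivity) (by positivity)
          exact Real.rpow_le_rpow_of_exponent_le (by norm_num) (by linarith)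
      _ = _ := by simp
  have b3 : 2 * (‖s‖ * (N : ℝ) ^ (-s.re)) ≤ 8 * t ^ (2 * r) := by
    have : (N : ℝ) ^ (-s.re) ≤ t ^ r * t⁻¹ := by
      calc (N : ℝ) ^ (-s.re) ≤ (N : ℝ) ^ (r + (-1)) :=
            Real.rpow_le_rpow_of_exponent_le hN1' (by linarith)
        _ ≤ t ^ (r + (-1)) := Real.rpow_le_rpow_of_nonpos ht0 hNt (by linarith)
        _ = _ := by rw [Real.rpow_add ht0, Real.rpow_neg_one]
    calc 2 * (‖s‖ * (N : ℝ) ^ (-s.re)) ≤ 2 * (4 * t * (t ^ r * t⁻¹)) := by gcongr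
      _ = 8 * t ^ r := by field_simp; ring
      _ ≤ _ := by gcongr
  rw [hz, div_le_iff₀ hpos]
  refine (zeta1_bound N hN1 s (by linarith)).trans ?_
  have b2' : (N + 1 : ℝ) ^ (1 - s.re) ≤ 3 * t ^ (2 * r) * ‖s - 1‖ := by
    have : 0 ≤ 3 * t ^ (2 * r) := by positivity
    nlinarith
  nlinarith [mul_le_mul_of_nonneg_left b1 hpos.le, mul_le_mul_of_nonneg_left b3 hpos.le]

lemma zeta_near_one : ∃ K : ℝ, 0 < K ∧ ∀ x : ℝ, 0 < x → x ≤ 1 → ‖riemannZeta (1 + x)‖ ≤ K / x := by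
  obtain ⟨K, hK⟩ := (isCompact_closedBall (1:ℂ) 1).exists_bound_of_continuousOn
    (differentiable_riemannZeta₁.continuous.continuousOn)
  refine ⟨|K| + 1, by positivity, fun x hx hx1 => ?_⟩
  have h1 : (1 + x : ℂ) ≠ 1 := by
    intro h
    have : (x : ℂ) = 0 := by linear_combination h
    exact hx.ne' (by exact_mod_cast this)
  rw [riemannZeta_eq_inv_sub_mul h1, norm_mul]
  have h2 := hK (1 + x) (by simp [abs_of_pos hx, hx1])
  have h3 : ‖(1 + (x:ℂ) - 1)⁻¹‖ = x⁻¹ := by simp [abs_of_pos hx]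
  rw [h3, div_eq_inv_mul]
  gcongr
  exact h2.trans ((le_abs_self K).trans (by linarith))

lemma zeta_deriv_growth (r : ℝ) (hr : 0 < r) (hr2 : r < 1 / 2) : ∃ C : ℝ, 0 < C ∧
    ∀ s : ℂ, 1 - r / 2 ≤ s.re → s.re ≤ 2 → 2 ≤ |s.im| →
      ‖deriv riemannZeta s‖ ≤ C * |s.im| ^ (2 * r) := by
  obtain ⟨C, hC, h⟩ := zeta_growth r hr hr2
  refine ⟨C * 2 / (r / 2), by positivity, fun s h1 h2 h3 => ?_⟩
  have key : ∀ z ∈ Metric.closedBall s (r / 2), |z.re - s.re| ≤ r / 2 ∧ |z.im - s.im| ≤ r / 2 := by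
    intro z hz
    rw [mem_closedBall_iff_norm] at hz
    exact ⟨by simpa using (Complex.abs_re_le_norm (z - s)).trans hz,
      by simpa using (Complex.abs_im_le_norm (z - s)).trans hz⟩
  have key2 : ∀ z ∈ Metric.closedBall s (r / 2), 1 ≤ |z.im| ∧ |z.im| ≤ 2 * |s.im| := by
    intro z hz
    have h4 := (key z hz).2
    have h5 : |s.im| ≤ |z.im| + |z.im - s.im| := by
      have := abs_sub_abs_le_abs_sub s.im z.im
      rw [abs_sub_comm] at this
      linarith
    have h6 : |z.im| ≤ |s.im| + |z.im - s.im| := by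
      have := abs_sub_abs_le_abs_sub z.im s.im
      linarith
    constructor <;> linarith
  have hd : DiffContOnCl ℂ riemannZeta (Metric.ball s (r / 2)) := by
    apply DifferentiableOn.diffContOnCl_ball (U := {z | z ≠ 1})
    · intro z hz
      exact (differentiableAt_riemannZeta hz).differentiableWithinAt
    · intro z hz hz1
      have := (key2 z hz).1
      rw [hz1] at this
      norm_num at this
  have := Complex.norm_deriv_le_of_forall_mem_sphere_norm_le (f := riemannZeta) (c := s)
    (R := r / 2) (C := C * 2 * |s.im| ^ (2 * r)) (by positivity) hd ?_
  · refine this.trans (le_of_eq (by ring))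
  · intro z hz
    have hz' := Metric.sphere_subset_closedBall hz
    obtain ⟨a1, a2⟩ := key2 z hz'
    have a3 := abs_le.mp (key z hz').1
    refine (h z (by linarith) (by linarith) a1).trans ?_
    calc C * |z.im| ^ (2 * r) ≤ C * (2 * |s.im|) ^ (2 * r) := by gcongr
      _ = C * 2 ^ (2 * r) * |s.im| ^ (2 * r) := by
          rw [Real.mul_rpow (by norm_num) (by positivity)]; ring
      _ ≤ C * 2 ^ (1 : ℝ) * |s.im| ^ (2 * r) := by
          gcongr
          · norm_num
          · linarith
      _ = _ := by simp

lemma zeta_341 (x t : ℝ) (hx : 0 < x) :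
    1 ≤ ‖riemannZeta (1 + x)‖ ^ 3 * ‖riemannZeta (1 + x + Complex.I * t)‖ ^ 4 *
      ‖riemannZeta (1 + x + 2 * Complex.I * t)‖ := by
  have := DirichletCharacter.norm_LFunction_product_ge_one (N := 1) (1 : DirichletCharacter ℂ 1) hx t
  simpa using this

lemma zeta_logderiv (r : ℝ) (hr : 0 < r) (hr2 : r < 1 / 2) : ∃ κ : ℝ, 0 < κ ∧ κ ≤ r / 2 ∧
    ∀ s : ℂ, 2 ≤ |s.im| → 1 - κ * |s.im| ^ (-(10 * r)) ≤ s.re → s.re ≤ 2 →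
      riemannZeta s ≠ 0 ∧
      ‖deriv riemannZeta s / riemannZeta s‖ ≤ |s.im| ^ (10 * r) / (2 * κ) := by
  obtain ⟨K, hK0, hK⟩ := zeta_near_one
  obtain ⟨A, hA0, hA⟩ := zeta_growth r hr hr2
  obtain ⟨M, hM0, hM⟩ := zeta_deriv_growth r hr hr2
  set c : ℝ := 1 / (2 * K ^ 3 * A) with hc
  have hc0 : 0 < c := by positivity
  set κ : ℝ := min (c / (256 * M ^ 4)) (r / 2) with hκ
  have hκ0 : 0 < κ := by positivity
  have hκ1 : κ ≤ c / (256 * M ^ 4) := min_le_left _ _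
  have hκ2 : κ ≤ r / 2 := min_le_right _ _
  refine ⟨κ, hκ0, hκ2, fun s hs h1 h2 => ?_⟩
  set T := |s.im| with hT
  have hT0 : 0 < T := by linarith
  set η := κ * T ^ (-(10 * r)) with hη
  have hη0 : 0 < η := by positivity
  have hηκ : η ≤ κ := by
    have : T ^ (-(10 * r)) ≤ 1 := Real.rpow_le_one_of_one_le_of_nonpos (by linarith) (by linarith)
    calc η ≤ κ * 1 := by rw [hη]; gcongr
      _ = κ := mul_one _
  -- lower bound to the right
  have low : ∀ x : ℝ, η ≤ x → x ≤ 1 →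
      4 * M * η * T ^ (2 * r) ≤ ‖riemannZeta (1 + x + Complex.I * s.im)‖ := by
    intro x hx hx1
    have hx0 : 0 < x := by linarith
    have e1 := zeta_341 x s.im hx0
    have e2 := hK x hx0 hx1
    have e3 : ‖riemannZeta (1 + x + 2 * Complex.I * s.im)‖ ≤ A * (2 * T ^ (2 * r)) := by
      have hre : (1 + (x:ℂ) + 2 * Complex.I * s.im).re = 1 + x := by simp
      have him : (1 + (x:ℂ) + 2 * Complex.I * s.im).im = 2 * s.im := by simp
      have := hA (1 + x + 2 * Complex.I * s.im) (by rw [hre]; linarith) (by rw [hre]; linarith)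
        (by rw [him, abs_mul]; norm_num; linarith)
      rw [him, abs_mul, ← hT, abs_of_pos (by norm_num : (0:ℝ) < 2),
        Real.mul_rpow (by norm_num) hT0.le] at this
      refine this.trans ?_
      gcongr
      calc (2:ℝ) ^ (2 * r) ≤ 2 ^ (1 : ℝ) := by
            apply Real.rpow_le_rpow_of_exponent_le <;> linarith
        _ = 2 := by simp
    set z := ‖riemannZeta (1 + x + Complex.I * s.im)‖ with hz
    have e4 : 1 ≤ (K / x) ^ 3 * z ^ 4 * (A * (2 * T ^ (2 * r))) := by
      refine e1.trans ?_
      gcongr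
    have hz0 : 0 ≤ z := norm_nonneg _
    have e5 : c * x ^ 3 * T ^ (-(2 * r)) ≤ z ^ 4 := by
      rw [Real.rpow_neg hT0.le, hc]
      have hTr : 0 < T ^ (2 * r) := by positivity
      rw [← div_eq_mul_inv, div_le_iff₀ hTr, one_div, mul_comm, ← div_eq_mul_inv,
        div_le_iff₀ (by positivity)]
      have : (K / x) ^ 3 * x ^ 3 = K ^ 3 := by field_simp
      calc x ^ 3 = 1 * x ^ 3 := by ring
        _ ≤ ((K / x) ^ 3 * z ^ 4 * (A * (2 * T ^ (2 * r)))) * x ^ 3 := by gcongr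
        _ = ((K / x) ^ 3 * x ^ 3) * z ^ 4 * (A * (2 * T ^ (2 * r))) := by ring
        _ = _ := by rw [this]; ring
    have e6 : (4 * M * η * T ^ (2 * r)) ^ 4 ≤ z ^ 4 := by
      refine le_trans ?_ e5
      have f1 : (T ^ (2 * r)) ^ 4 = T ^ (10 * r) * T ^ (-(2 * r)) := by
        rw [← Real.rpow_natCast, ← Real.rpow_mul hT0.le, ← Real.rpow_add hT0]
        norm_num; ring_nf
      have f2 : η * T ^ (10 * r) = κ := by
        rw [hη, mul_assoc, ← Real.rpow_add hT0]; simp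
      calc (4 * M * η * T ^ (2 * r)) ^ 4 = 256 * M ^ 4 * η ^ 3 * (η * (T ^ (2 * r)) ^ 4) := by ring
        _ = 256 * M ^ 4 * κ * η ^ 3 * T ^ (-(2 * r)) := by
            rw [f1, ← mul_assoc η, f2]; ring
        _ ≤ c * x ^ 3 * T ^ (-(2 * r)) := by
            have : 256 * M ^ 4 * κ ≤ c := by
              rw [le_div_iff₀ (by positivity)] at hκ1; linarith
            gcongr
    exact le_of_pow_le_pow_left₀ (by norm_num) hz0 e6
  have hs_eq : s = s.re + Complex.I * s.im := by
    rw [mul_comm]; exact (Complex.re_add_im s).symm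
  have main : 2 * M * η * T ^ (2 * r) ≤ ‖riemannZeta s‖ := by
    have hp : 0 ≤ 2 * M * η * T ^ (2 * r) := by positivity
    by_cases hc1 : 1 + η ≤ s.re
    · have := low (s.re - 1) (by linarith) (by linarith)
      have e : (1 + ((s.re - 1 : ℝ) : ℂ) + Complex.I * s.im) = s := by
        conv_rhs => rw [hs_eq]
        push_cast; ring
      rw [e] at this
      linarith
    · push Not at hc1
      have hl := low η le_rfl (by linarith)
      set w : ℂ := 1 + η + Complex.I * s.im with hw
      have hwre : w.re = 1 + η := by simp [hw]
      have hwim : w.im = s.im := by simp [hw]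
      let S : Set ℂ := {z | s.re ≤ z.re} ∩ {z | z.re ≤ 1 + η} ∩ ({z | z.im ≤ s.im} ∩ {z | s.im ≤ z.im})
      have hS : Convex ℝ S :=
        ((convex_halfSpace_re_ge _).inter (convex_halfSpace_re_le _)).inter
          ((convex_halfSpace_im_le _).inter (convex_halfSpace_im_ge _))
      have hmv := Convex.norm_image_sub_le_of_norm_deriv_le (𝕜 := ℂ) (f := riemannZeta) (s := S)
        (C := M * T ^ (2 * r)) (x := s) (y := w) ?_ ?_ hS ?_ ?_
      · have hn : ‖w - s‖ ≤ 2 * η := by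
          have : w - s = ((1 + η - s.re : ℝ) : ℂ) := by
            conv_lhs => rw [hs_eq, hw]
            push_cast; ring
          rw [this, Complex.norm_real, Real.norm_eq_abs, abs_of_nonneg (by linarith)]
          linarith
        have h5 := norm_sub_norm_le (riemannZeta w) (riemannZeta s)
        have h6 : M * T ^ (2 * r) * ‖w - s‖ ≤ M * T ^ (2 * r) * (2 * η) := by gcongr
        nlinarith
      · rintro z ⟨⟨a1, a2⟩, a3, a4⟩
        apply differentiableAt_riemannZeta
        rintro rfl
        simp at a3 a4
        have : s.im = 0 := le_antisymm a4 a3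
        rw [hT, this] at hs
        norm_num at hs
      · rintro z ⟨⟨a1, a2⟩, a3, a4⟩
        have a5 : z.im = s.im := le_antisymm a3 a4
        simp only [Set.mem_setOf_eq] at a1 a2
        have := hM z (by linarith) (by linarith) (by rw [a5]; exact hs)
        rwa [a5] at this
      · exact ⟨⟨le_refl s.re, hc1.le⟩, le_refl s.im, le_refl s.im⟩
      · exact ⟨⟨by simp only [Set.mem_setOf_eq, hwre]; exact hc1.le, hwre.le⟩, hwim.le, hwim.ge⟩
  have hMT : 0 < 2 * M * η * T ^ (2 * r) := by positivity
  refine ⟨fun h0 => ?_, ?_⟩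
  · rw [h0, norm_zero] at main; linarith
  · rw [norm_div, div_le_iff₀ (by linarith)]
    have h7 := hM s (by linarith) h2 hs
    refine h7.trans ?_
    have f2 : η * T ^ (10 * r) = κ := by
      rw [hη, mul_assoc, ← Real.rpow_add hT0]; simp
    calc M * T ^ (2 * r) = T ^ (10 * r) / (2 * κ) * (2 * M * η * T ^ (2 * r)) := by
          rw [← f2]; field_simp
      _ ≤ _ := by gcongr

def GG (s : ℂ) : ℂ := -(deriv riemannZeta₁ s / riemannZeta₁ s) - riemannZeta₀ s

def GU : Set ℂ := {z | riemannZeta₁ z ≠ 0}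

lemma GU_open : IsOpen GU :=
  isOpen_ne_fun differentiable_riemannZeta₁.continuous continuous_const

lemma GG_diff : DifferentiableOn ℂ GG GU := by
  have h1 : Differentiable ℂ (deriv riemannZeta₁) := differentiable_riemannZeta₁.deriv
  intro z hz
  apply DifferentiableAt.differentiableWithinAt
  exact ((h1 z).div (differentiable_riemannZeta₁ z) hz).neg.sub (differentiable_riemannZeta₀ z)

lemma GG_analytic : AnalyticOnNhd ℂ GG GU := GG_diff.analyticOnNhd GU_open

lemma zeta1_ne {s : ℂ} (hs : s ≠ 1) (h : riemannZeta s ≠ 0) : s ∈ GU := by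
  intro h0
  apply h
  rw [riemannZeta_eq_inv_sub_mul hs, h0, mul_zero]

lemma mem_GU_of_one_le {s : ℂ} (h : 1 ≤ s.re) : s ∈ GU := by
  by_cases hs : s = 1
  · subst hs
    show riemannZeta₁ 1 ≠ 0
    rw [riemannZeta₁_one]; exact one_ne_zero
  · exact zeta1_ne hs (riemannZeta_ne_zero_of_one_le_re h)

lemma GG_eq {s : ℂ} (hs : s ≠ 1) (h : riemannZeta s ≠ 0) :
    GG s = -(deriv riemannZeta s / riemannZeta s) - riemannZeta s := by
  have h1 : riemannZeta₁ s ≠ 0 := zeta1_ne hs h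
  have h2 : s - 1 ≠ 0 := sub_ne_zero.mpr hs
  have h3 : riemannZeta s = (s-1)⁻¹ + riemannZeta₀ s := riemannZeta_eq_inv_sub_add hs
  have h4 : deriv riemannZeta s / riemannZeta s = deriv riemannZeta₁ s / riemannZeta₁ s - (s-1)⁻¹ := by
    rw [deriv_riemannZeta_eq_neg_inv_sub_sq_mul_add hs, riemannZeta_eq_inv_sub_mul hs]
    field_simp
    ring
  rw [h4, h3, GG]; ring

lemma GG_iter_bound : ∃ C : ℝ, 0 < C ∧ ∀ j : ℕ, j ≤ 9 → ∀ σ t : ℝ, 1 ≤ σ → σ ≤ 3 / 2 →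
    ‖iteratedDeriv j GG (σ + t * Complex.I)‖ ≤ C * (1 + |t|) ^ ((1:ℝ) / 100) := by
  -- compact part
  have hcomp : ∀ j : ℕ, ∃ B : ℝ, ∀ s ∈ (Set.Icc (1:ℝ) (3/2)) ×ℂ (Set.Icc (-3:ℝ) 3),
      ‖iteratedDeriv j GG s‖ ≤ B := by
    intro j
    apply IsCompact.exists_bound_of_continuousOn
    · exact isCompact_Icc.reProdIm isCompact_Icc
    · have := (GG_analytic.iterated_deriv j).continuousOn
      rw [iteratedDeriv_eq_iterate]
      refine this.mono ?_
      intro s hs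
      exact mem_GU_of_one_le hs.1.1
  choose B hB using hcomp
  obtain ⟨κ, hκ0, hκr, hκ⟩ := zeta_logderiv (1/10000) (by norm_num) (by norm_num)
  obtain ⟨A, hA0, hA⟩ := zeta_growth (1/10000) (by norm_num) (by norm_num)
  set E : ℝ := 1 / (2 * κ) + A with hE
  have hE0 : 0 < E := by positivity
  refine ⟨(∑ j ∈ Finset.range 10, |B j|) + 2 * ((Nat.factorial 9 : ℕ) : ℝ) * E * (κ ^ 9)⁻¹, by positivity,
    fun j hj σ t h1 h2 => ?_⟩
  have hone : 1 ≤ (1 + |t|) ^ ((1:ℝ) / 100) :=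
    Real.one_le_rpow (by linarith [abs_nonneg t]) (by norm_num)
  by_cases ht : |t| ≤ 3
  · have hm : (σ + t * Complex.I : ℂ) ∈ (Set.Icc (1:ℝ) (3/2)) ×ℂ (Set.Icc (-3:ℝ) 3) := by
      rw [Complex.mem_reProdIm]
      simp only [Complex.add_re, Complex.ofReal_re, Complex.mul_re, Complex.I_re, Complex.I_im, Complex.ofReal_im,
        Complex.add_im, Complex.mul_im]
      norm_num
      exact ⟨⟨h1, by linarith⟩, abs_le.mp ht⟩
    have h3 := hB j _ hm
    have h4 : |B j| ≤ ∑ j ∈ Finset.range 10, |B j| :=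
      Finset.single_le_sum (f := fun j => |B j|) (fun i _ => abs_nonneg _) (Finset.mem_range.mpr (by omega))
    have h5 := le_abs_self (B j)
    have h6 : 0 < 2 * ((Nat.factorial 9 : ℕ) : ℝ) * E * (κ ^ 9)⁻¹ := by positivity
    calc _ ≤ (∑ j ∈ Finset.range 10, |B j|) + 2 * ((Nat.factorial 9 : ℕ) : ℝ) * E * (κ ^ 9)⁻¹ := by linarith
      _ ≤ _ := le_mul_of_one_le_right (by positivity) hone
  · push Not at ht
    set T := |t| with hT
    have hT0 : 0 < T := by linarith
    set s : ℂ := σ + t * Complex.I with hs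
    have hsre : s.re = σ := by simp [hs]
    have hsim : s.im = t := by simp [hs]
    set ρ : ℝ := κ * (2 * T) ^ (-(10 * (1/10000:ℝ))) with hρ
    have hρ0 : 0 < ρ := by positivity
    have hρκ : ρ ≤ κ := by
      have : (2 * T) ^ (-(10 * (1/10000:ℝ))) ≤ 1 :=
        Real.rpow_le_one_of_one_le_of_nonpos (by linarith) (by norm_num)
      calc ρ ≤ κ * 1 := by rw [hρ]; gcongr
        _ = κ := mul_one _
    have key : ∀ z ∈ Metric.closedBall s ρ, z ≠ 1 ∧ riemannZeta z ≠ 0 ∧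
        ‖GG z‖ ≤ E * (2 * T) ^ (10 * (1/10000:ℝ)) := by
      intro z hz
      rw [mem_closedBall_iff_norm] at hz
      have a1 : |z.re - σ| ≤ ρ := by
        rw [← hsre]; simpa using (Complex.abs_re_le_norm (z - s)).trans hz
      have a2 : |z.im - t| ≤ ρ := by
        rw [← hsim]; simpa using (Complex.abs_im_le_norm (z - s)).trans hz
      have a3 : 2 ≤ |z.im| := by
        have := abs_sub_abs_le_abs_sub t z.im
        rw [abs_sub_comm] at this
        linarith
      have a4 : |z.im| ≤ 2 * T := by
        have := abs_sub_abs_le_abs_sub z.im t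
        linarith
      rw [abs_le] at a1
      have hz1 : z ≠ 1 := by
        rintro rfl
        norm_num at a3
      have a5 : ρ ≤ κ * |z.im| ^ (-(10 * (1/10000:ℝ))) := by
        rw [hρ]
        gcongr ?_ * ?_
        exact Real.rpow_le_rpow_of_nonpos (by linarith) a4 (by norm_num)
      obtain ⟨b1, b2⟩ := hκ z a3 (by linarith) (by linarith)
      have b3 := hA z (by linarith) (by linarith) (by linarith)
      refine ⟨hz1, b1, ?_⟩
      rw [GG_eq hz1 b1]
      refine (norm_sub_le _ _).trans ?_
      rw [norm_neg, hE, add_mul]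
      refine add_le_add (b2.trans ?_) (b3.trans ?_)
      · rw [div_eq_inv_mul, ← one_div]
        gcongr
      · gcongr ?_ * ?_
        calc |z.im| ^ (2 * (1/10000:ℝ)) ≤ |z.im| ^ (10 * (1/10000:ℝ)) := by
              apply Real.rpow_le_rpow_of_exponent_le <;> linarith
          _ ≤ _ := by gcongr
    have hd : DiffContOnCl ℂ GG (Metric.ball s ρ) := by
      apply GG_diff.diffContOnCl_ball
      intro z hz
      exact zeta1_ne (key z hz).1 (key z hz).2.1
    have := Complex.norm_iteratedDeriv_le_of_forall_mem_sphere_norm_le j hρ0 hd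
      (fun z hz => (key z (Metric.sphere_subset_closedBall hz)).2.2)
    refine this.trans ?_
    set Q : ℝ := (2 * T) ^ (10 * (1/10000:ℝ)) with hQ
    have hQ1 : 1 ≤ Q := Real.one_le_rpow (by linarith) (by norm_num)
    have hρQ : ρ = κ * Q⁻¹ := by rw [hρ, hQ, Real.rpow_neg (by linarith)]
    have hinv : (ρ ^ j)⁻¹ ≤ (κ ^ 9)⁻¹ * Q ^ 9 := by
      rw [hρQ, mul_pow, mul_inv, inv_pow, inv_inv]
      gcongr ?_ * ?_
      · rw [← inv_pow, ← inv_pow]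
        exact pow_le_pow_right₀ ((one_le_inv₀ hκ0).mpr (by linarith)) hj
      · exact pow_le_pow_right₀ hQ1 hj
    have hQ10 : Q ^ 10 ≤ 2 * (1 + T) ^ ((1:ℝ)/100) := by
      rw [hQ, ← Real.rpow_natCast, ← Real.rpow_mul (by linarith)]
      calc (2 * T) ^ (10 * (1/10000:ℝ) * ((10:ℕ):ℝ)) ≤ (2 * (1 + T)) ^ ((1:ℝ)/100) := by
            norm_num
            gcongr
            linarith
        _ = 2 ^ ((1:ℝ)/100) * (1 + T) ^ ((1:ℝ)/100) := Real.mul_rpow (by norm_num) (by linarith)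
        _ ≤ 2 * (1 + T) ^ ((1:ℝ)/100) := by
            gcongr
            calc (2:ℝ) ^ ((1:ℝ)/100) ≤ 2 ^ (1:ℝ) := by
                  apply Real.rpow_le_rpow_of_exponent_le <;> norm_num
              _ = 2 := by simp
    have hfac : ((j.factorial : ℕ) : ℝ) ≤ ((Nat.factorial 9 : ℕ) : ℝ) := by
      exact_mod_cast Nat.factorial_le hj
    calc (j.factorial : ℝ) * (E * Q) / ρ ^ j = (j.factorial : ℝ) * (E * Q) * (ρ ^ j)⁻¹ := by
          rw [div_eq_mul_inv]
      _ ≤ ((Nat.factorial 9 : ℕ) : ℝ) * (E * Q) * ((κ ^ 9)⁻¹ * Q ^ 9) := by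
          apply mul_le_mul _ hinv (by positivity) (by positivity)
          gcongr
      _ = ((Nat.factorial 9 : ℕ) : ℝ) * E * (κ ^ 9)⁻¹ * Q ^ 10 := by ring
      _ ≤ ((Nat.factorial 9 : ℕ) : ℝ) * E * (κ ^ 9)⁻¹ * (2 * (1 + T) ^ ((1:ℝ)/100)) := by
          gcongr
      _ = (2 * ((Nat.factorial 9 : ℕ) : ℝ) * E * (κ ^ 9)⁻¹) * (1 + T) ^ ((1:ℝ)/100) := by ring
      _ ≤ _ := by
          gcongr
          have : 0 ≤ ∑ j ∈ Finset.range 10, |B j| := by positivity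
          linarith

open scoped FourierTransform SchwartzMap in
lemma schw_decay (V : 𝓢(ℝ, ℂ)) : ∃ C : ℝ, 0 < C ∧ ∀ j : ℕ, j ≤ 9 → ∀ t : ℝ,
    ‖iteratedFDeriv ℝ j V t‖ * (1 + |t|) ≤ C * (1 + t ^ 2)⁻¹ := by
  refine ⟨2 ^ 3 * ((Finset.Iic ((3, 9) : ℕ × ℕ)).sup (fun m => SchwartzMap.seminorm ℝ m.1 m.2) V) + 1,
    ?_, fun j hj t => ?_⟩
  · have : 0 ≤ ((Finset.Iic ((3, 9) : ℕ × ℕ)).sup (fun m => SchwartzMap.seminorm ℝ m.1 m.2) V) :=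
      apply_nonneg _ _
    positivity
  · have := SchwartzMap.one_add_le_sup_seminorm_apply (𝕜 := ℝ) (m := (3, 9)) (k := 3) (n := j)
      le_rfl hj V t
    rw [Real.norm_eq_abs] at this
    rw [← div_eq_mul_inv, le_div_iff₀ (by positivity)]
    have h1 : 1 + t ^ 2 ≤ (1 + |t|) ^ 2 := by
      rw [← sq_abs t]; nlinarith [abs_nonneg t]
    calc _ ≤ ‖iteratedFDeriv ℝ j V t‖ * (1 + |t|) * (1 + |t|) ^ 2 := by gcongr
      _ = (1 + |t|) ^ 3 * ‖iteratedFDeriv ℝ j V t‖ := by ring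
      _ ≤ _ := by simp only at this; linarith

def gg (σ c : ℝ) (t : ℝ) : ℂ := GG (σ + ((c * t : ℝ) : ℂ) * Complex.I)

lemma gg_iter (σ c : ℝ) (hσ : 1 ≤ σ) (j : ℕ) : iteratedDeriv j (gg σ c) =
    fun t : ℝ => ((c : ℂ) * Complex.I) ^ j * iteratedDeriv j GG (σ + ((c * t : ℝ) : ℂ) * Complex.I) := by
  induction j with
  | zero => ext t; simp [gg]
  | succ k ih =>
    ext t
    rw [iteratedDeriv_succ, ih]
    have hmem : (σ + ((c * t : ℝ) : ℂ) * Complex.I) ∈ GU :=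
      mem_GU_of_one_le (by simpa using hσ)
    have hd : HasDerivAt (iteratedDeriv k GG) (iteratedDeriv (k+1) GG (σ + ((c * t : ℝ) : ℂ) * Complex.I))
        (σ + ((c * t : ℝ) : ℂ) * Complex.I) := by
      rw [iteratedDeriv_succ]
      apply DifferentiableAt.hasDerivAt
      have := (GG_analytic.iterated_deriv k) _ hmem
      rw [iteratedDeriv_eq_iterate]
      exact this.differentiableAt
    have hl : HasDerivAt (fun t : ℝ => (σ + ((c * t : ℝ) : ℂ) * Complex.I)) ((c : ℂ) * Complex.I) t := by
      have h1 : HasDerivAt (fun t : ℝ => ((c * t : ℝ) : ℂ)) ((c * 1 : ℝ) : ℂ) t :=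
        ((hasDerivAt_id t).const_mul c).ofReal_comp
      have h2 := (h1.mul_const Complex.I).const_add (σ : ℂ)
      simpa using h2
    have h3 := (HasDerivAt.comp (𝕜' := ℂ) t hd hl).const_mul (((c : ℂ) * Complex.I) ^ k)
    have h4 := h3.deriv
    simp only [Function.comp_def] at h4
    rw [h4, pow_succ]
    ring

lemma gg_contDiff (σ c : ℝ) (hσ : 1 ≤ σ) (n : ℕ∞) : ContDiff ℝ n (gg σ c) := by
  rw [contDiff_iff_contDiffAt]
  intro t
  have hmem : (σ + ((c * t : ℝ) : ℂ) * Complex.I) ∈ GU :=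
    mem_GU_of_one_le (by simpa using hσ)
  have h1 : ContDiffAt ℂ n GG (σ + ((c * t : ℝ) : ℂ) * Complex.I) := (GG_analytic _ hmem).contDiffAt
  have h2 : ContDiffAt ℝ n (fun t : ℝ => (σ + ((c * t : ℝ) : ℂ) * Complex.I)) t := by
    have : ContDiff ℝ n (fun t : ℝ => (σ + ((c * t : ℝ) : ℂ) * Complex.I)) := by
      apply ContDiff.add contDiff_const
      apply ContDiff.mul _ contDiff_const
      exact Complex.ofRealCLM.contDiff.comp (contDiff_const.mul contDiff_id)
    exact this.contDiffAt
  exact (h1.restrict_scalars ℝ).comp t h2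

open scoped FourierTransform SchwartzMap in
lemma hh_bound (V : 𝓢(ℝ, ℂ)) : ∃ C : ℝ, 0 < C ∧ ∀ σ δ : ℝ, 1 ≤ σ → σ ≤ 3/2 → 0 < δ → δ ≤ 1 →
    ∀ k : ℕ, k ≤ 9 → ∀ t : ℝ,
    ‖iteratedDeriv k (fun t => V t * gg σ (-(2 * Real.pi / δ)) t) t‖ ≤
      C * (δ⁻¹) ^ 9 * (δ⁻¹) ^ ((1:ℝ)/100) * (1 + t ^ 2)⁻¹ := by
  obtain ⟨A, hA0, hA⟩ := schw_decay V
  obtain ⟨B, hB0, hB⟩ := GG_iter_bound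
  refine ⟨2 ^ 9 * A * (7 ^ 10 * B), by positivity, fun σ δ h1 h2 h3 h4 k hk t => ?_⟩
  rw [← norm_iteratedFDeriv_eq_norm_iteratedDeriv]
  refine (norm_iteratedFDeriv_mul_le (N := ((k : ℕ∞) : WithTop ℕ∞)) (V.smooth k)
    (gg_contDiff σ _ h1 k) t (n := k) le_rfl).trans ?_
  have hinv : 1 ≤ δ⁻¹ := (one_le_inv₀ h3).mpr h4
  have hpi : 2 * Real.pi ≤ 7 := by linarith [Real.pi_lt_d2]
  have hpi0 := Real.pi_pos
  have hg : ∀ j ≤ 9, ‖iteratedFDeriv ℝ j (gg σ (-(2 * Real.pi / δ))) t‖ ≤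
      7 ^ 10 * B * (δ⁻¹) ^ 9 * (δ⁻¹) ^ ((1:ℝ)/100) * (1 + |t|) := by
    intro j hj
    rw [norm_iteratedFDeriv_eq_norm_iteratedDeriv, gg_iter σ _ h1]
    simp only
    rw [norm_mul, norm_pow, norm_mul, Complex.norm_I, mul_one, Complex.norm_real, norm_neg,
      Real.norm_eq_abs, abs_of_pos (by positivity)]
    have e1 : (2 * Real.pi / δ) ^ j ≤ 7 ^ 9 * (δ⁻¹) ^ 9 := by
      calc (2 * Real.pi / δ) ^ j ≤ (7 * δ⁻¹) ^ j := by
            rw [div_eq_mul_inv]; gcongr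
        _ ≤ (7 * δ⁻¹) ^ 9 := pow_le_pow_right₀ (by linarith) hj
        _ = _ := by ring
    have e2 := hB j hj σ (-(2 * Real.pi / δ) * t) h1 h2
    have e3 : (1 + |(-(2 * Real.pi / δ) * t)|) ^ ((1:ℝ)/100) ≤ 7 * (δ⁻¹) ^ ((1:ℝ)/100) * (1 + |t|) := by
      have : 1 + |(-(2 * Real.pi / δ) * t)| ≤ 7 * δ⁻¹ * (1 + |t|) := by
        rw [abs_mul, abs_neg, abs_of_pos (by positivity), div_eq_mul_inv]
        have : 2 * Real.pi * δ⁻¹ * |t| ≤ 7 * δ⁻¹ * |t| := by gcongr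
        linarith
      calc _ ≤ (7 * δ⁻¹ * (1 + |t|)) ^ ((1:ℝ)/100) := by gcongr
        _ = 7 ^ ((1:ℝ)/100) * (δ⁻¹) ^ ((1:ℝ)/100) * (1 + |t|) ^ ((1:ℝ)/100) := by
            rw [Real.mul_rpow (by positivity) (by positivity), Real.mul_rpow (by positivity) (by positivity)]
        _ ≤ 7 ^ (1:ℝ) * (δ⁻¹) ^ ((1:ℝ)/100) * (1 + |t|) ^ (1:ℝ) := by
            gcongr <;> first | norm_num | (linarith [abs_nonneg t])
        _ = _ := by simp
    calc _ ≤ (7 ^ 9 * (δ⁻¹) ^ 9) * (B * (7 * (δ⁻¹) ^ ((1:ℝ)/100) * (1 + |t|))) := by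
          apply mul_le_mul e1 _ (norm_nonneg _) (by positivity)
          exact e2.trans (by gcongr)
      _ = _ := by ring
  calc ∑ i ∈ Finset.range (k + 1), (k.choose i : ℝ) * ‖iteratedFDeriv ℝ i V t‖ *
        ‖iteratedFDeriv ℝ (k - i) (gg σ (-(2 * Real.pi / δ))) t‖
      ≤ ∑ i ∈ Finset.range (k + 1), (k.choose i : ℝ) *
        (A * (7 ^ 10 * B) * (δ⁻¹) ^ 9 * (δ⁻¹) ^ ((1:ℝ)/100) * (1 + t ^ 2)⁻¹) := by
        refine Finset.sum_le_sum fun i hi => ?_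
        have hi' : i ≤ 9 := by have := Finset.mem_range.mp hi; omega
        rw [mul_assoc]
        gcongr ?_ * ?_
        have := hA i hi' t
        have e := hg (k - i) (by omega)
        calc _ ≤ ‖iteratedFDeriv ℝ i V t‖ * (7 ^ 10 * B * (δ⁻¹) ^ 9 * (δ⁻¹) ^ ((1:ℝ)/100) * (1 + |t|)) := by
              gcongr
          _ = (7 ^ 10 * B * (δ⁻¹) ^ 9 * (δ⁻¹) ^ ((1:ℝ)/100)) * (‖iteratedFDeriv ℝ i V t‖ * (1 + |t|)) := by ring
          _ ≤ (7 ^ 10 * B * (δ⁻¹) ^ 9 * (δ⁻¹) ^ ((1:ℝ)/100)) * (A * (1 + t ^ 2)⁻¹) := by gcongr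
          _ = _ := by ring
    _ = 2 ^ k * (A * (7 ^ 10 * B) * (δ⁻¹) ^ 9 * (δ⁻¹) ^ ((1:ℝ)/100) * (1 + t ^ 2)⁻¹) := by
        rw [← Finset.sum_mul]
        congr 1
        exact_mod_cast Nat.sum_range_choose k
    _ ≤ 2 ^ 9 * (A * (7 ^ 10 * B) * (δ⁻¹) ^ 9 * (δ⁻¹) ^ ((1:ℝ)/100) * (1 + t ^ 2)⁻¹) := by
        gcongr
        norm_num
    _ = _ := by ring

open scoped FourierTransform SchwartzMap in
lemma hh_fourier (V : 𝓢(ℝ, ℂ)) : ∃ C : ℝ, 0 < C ∧ ∀ σ δ y : ℝ, 1 ≤ σ → σ ≤ 3/2 → 0 < δ → δ ≤ 1 → 0 < y →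
    ‖𝓕 (fun t => V t * gg σ (-(2 * Real.pi / δ)) t) (y / δ)‖ ≤ C * (δ⁻¹) ^ ((1:ℝ)/100) * (y ^ 9)⁻¹ := by
  obtain ⟨C, hC0, hC⟩ := hh_bound V
  refine ⟨C * Real.pi, by positivity, fun σ δ y h1 h2 h3 h4 hy => ?_⟩
  set h := (fun t => V t * gg σ (-(2 * Real.pi / δ)) t) with hh
  have hcd : ContDiff ℝ (9 : ℕ∞) h := by
    have := (V.smooth 9).mul (gg_contDiff σ (-(2 * Real.pi / δ)) h1 9)
    exact this
  have hIntg : ∀ n : ℕ, n ≤ (9 : ℕ∞) → MeasureTheory.Integrable (iteratedDeriv n h) := by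
    intro n hn
    refine MeasureTheory.Integrable.mono' (integrable_inv_one_add_sq.const_mul
      (C * (δ⁻¹) ^ 9 * (δ⁻¹) ^ ((1:ℝ)/100))) ?_ ?_
    · exact (hcd.continuous_iteratedDeriv n (by exact_mod_cast hn)).aestronglyMeasurable
    · filter_upwards with t
      exact hC σ δ h1 h2 h3 h4 n (by exact_mod_cast hn) t
  have hf := Real.fourier_iteratedDeriv hcd hIntg (n := 9) le_rfl
  have hf2 := congrFun hf (y / δ)
  have hb : ‖𝓕 (iteratedDeriv 9 h) (y / δ)‖ ≤ C * (δ⁻¹) ^ 9 * (δ⁻¹) ^ ((1:ℝ)/100) * Real.pi := by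
    have e1 : ‖𝓕 (iteratedDeriv 9 h) (y / δ)‖ ≤ ∫ t, ‖iteratedDeriv 9 h t‖ :=
      VectorFourier.norm_fourierIntegral_le_integral_norm _ _ _ _ _
    refine e1.trans ?_
    rw [← integral_univ_inv_one_add_sq, ← MeasureTheory.integral_const_mul]
    apply MeasureTheory.integral_mono (hIntg 9 le_rfl).norm
    · exact integrable_inv_one_add_sq.const_mul _
    · intro t
      exact hC σ δ h1 h2 h3 h4 9 le_rfl t
  rw [hf2, norm_smul, norm_pow] at hb
  have e5 : ‖(2 * (Real.pi:ℂ) * Complex.I * ((y/δ : ℝ) : ℂ))‖ = 2 * Real.pi * (y / δ) := by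
    rw [norm_mul, norm_mul, norm_mul, Complex.norm_I, Complex.norm_real, Complex.norm_real,
      Real.norm_eq_abs, Real.norm_eq_abs, abs_of_pos Real.pi_pos, abs_of_pos (by positivity)]
    norm_num
  rw [e5] at hb
  have e6 : y * δ⁻¹ ≤ 2 * Real.pi * (y / δ) := by
    rw [div_eq_mul_inv]
    have : 0 < y * δ⁻¹ := by positivity
    nlinarith [Real.pi_gt_three]
  have e7 : (y * δ⁻¹) ^ 9 * ‖𝓕 h (y / δ)‖ ≤ C * (δ⁻¹) ^ 9 * (δ⁻¹) ^ ((1:ℝ)/100) * Real.pi := by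
    refine le_trans ?_ hb
    gcongr
  rw [← div_eq_mul_inv, le_div_iff₀ (by positivity)]
  have e8 : 0 < (δ⁻¹) ^ 9 := by positivity
  rw [← mul_le_mul_iff_of_pos_right e8]
  calc _ = (y * δ⁻¹) ^ 9 * ‖𝓕 h (y / δ)‖ := by ring
    _ ≤ _ := e7
    _ = _ := by ring

def fLam (n : ℕ) : ℂ := (ArithmeticFunction.vonMangoldt n : ℂ) - 1

lemma fLam_summable {s : ℂ} (hs : 1 < s.re) : LSeriesSummable fLam s := by
  have h1 := ArithmeticFunction.LSeriesSummable_vonMangoldt hs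
  have h2 : LSeriesSummable (1 : ℕ → ℂ) s := LSeriesSummable_one_iff.mpr hs
  exact h1.sub h2

lemma fLam_LSeries {s : ℂ} (hs : 1 < s.re) : LSeries fLam s = GG s := by
  have h1 := ArithmeticFunction.LSeriesSummable_vonMangoldt hs
  have h2 : LSeriesSummable (1 : ℕ → ℂ) s := LSeriesSummable_one_iff.mpr hs
  have h3 := LSeries_sub h1 h2
  rw [LSeries_one_eq_riemannZeta hs, ArithmeticFunction.LSeries_vonMangoldt_eq_deriv_riemannZeta_div hs] at h3
  have hs1 : s ≠ 1 := by rintro rfl; simp at hs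
  rw [GG_eq hs1 (riemannZeta_ne_zero_of_one_lt_re hs), ← neg_div, ← h3]
  rfl

open scoped FourierTransform SchwartzMap in
lemma fourier_identity (W : 𝓢(ℝ, ℂ)) (σ δ y : ℝ) (hσ : 1 < σ) (hδ : 0 < δ) :
    HasSum (fun n : ℕ => LSeries.term fLam σ n * W ((Real.log n - y) / δ))
      (𝓕 (fun t => (𝓕 W : 𝓢(ℝ, ℂ)) t * gg σ (-(2 * Real.pi / δ)) t) (y / δ)) := by
  set V : 𝓢(ℝ, ℂ) := 𝓕 W with hV
  let F : ℕ → ℝ → ℂ := fun n t => LSeries.term fLam σ n *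
    (Complex.exp ((2 * Real.pi * (t * ((Real.log n - y) / δ)) : ℝ) * Complex.I) * V t)
  have hnorm : ∀ n t, ‖F n t‖ = ‖LSeries.term fLam σ n‖ * ‖V t‖ := by
    intro n t
    simp only [F]
    rw [norm_mul, norm_mul, Complex.norm_exp_ofReal_mul_I, one_mul]
  have hcont : ∀ n, Continuous (F n) := by
    intro n
    have := V.continuous
    simp only [F]
    fun_prop
  have hIntg : ∀ n, MeasureTheory.Integrable (F n) := by
    intro n
    refine MeasureTheory.Integrable.mono' (V.integrable.norm.const_mul ‖LSeries.term fLam σ n‖)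
      (hcont n).aestronglyMeasurable ?_
    filter_upwards with t
    exact (hnorm n t).le
  have hsum0 : Summable (fun n => ‖LSeries.term fLam σ n‖) :=
    (fLam_summable (s := σ) (by simpa using hσ)).norm
  have hsum : Summable fun n => ∫ t, ‖F n t‖ := by
    simp_rw [hnorm, MeasureTheory.integral_const_mul]
    exact hsum0.mul_right _
  have key := MeasureTheory.hasSum_integral_of_summable_integral_norm hIntg hsum
  have hL : ∀ n, ∫ t, F n t = LSeries.term fLam σ n * W ((Real.log n - y) / δ) := by
    intro n
    simp only [F]
    rw [MeasureTheory.integral_const_mul]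
    congr 1
    have h1 : (𝓕⁻ V : 𝓢(ℝ, ℂ)) = W := by rw [hV]; exact FourierTransform.fourierInv_fourier_eq W
    have h2 : W ((Real.log n - y) / δ) = 𝓕⁻ (V : ℝ → ℂ) ((Real.log n - y) / δ) := by
      rw [← SchwartzMap.fourierInv_coe, h1]
    rw [h2, Real.fourierInv_eq']
    simp only [smul_eq_mul, RCLike.inner_apply, conj_trivial]
    congr 1
    ext t
    congr 3
    push_cast; ring
  have hR : ∫ t, ∑' n, F n t = 𝓕 (fun t => V t * gg σ (-(2 * Real.pi / δ)) t) (y / δ) := by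
    rw [Real.fourier_eq']
    congr 1
    ext t
    have hs : 1 < (σ + ((-(2 * Real.pi / δ) * t : ℝ) : ℂ) * Complex.I).re := by simpa using hσ
    rw [gg, ← fLam_LSeries hs, LSeries, smul_eq_mul, ← tsum_mul_left, ← tsum_mul_left]
    congr 1
    ext n
    simp only [F]
    rcases eq_or_ne n 0 with rfl | hn
    · simp
    · rw [LSeries.term_of_ne_zero hn, LSeries.term_of_ne_zero hn]
      have hn0 : (n : ℂ) ≠ 0 := by exact_mod_cast hn
      rw [Complex.cpow_add _ _ hn0, Complex.cpow_def_of_ne_zero hn0 (((-(2 * Real.pi / δ) * t : ℝ) : ℂ) * Complex.I)]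
      rw [← Complex.natCast_log]
      simp only [RCLike.inner_apply, conj_trivial]
      have e1 : Complex.exp ((2 * Real.pi * (t * ((Real.log n - y) / δ)) : ℝ) * Complex.I) =
          Complex.exp (((-2 * Real.pi * ((y / δ) * t) : ℝ) : ℂ) * Complex.I) /
          Complex.exp (((Real.log n : ℝ) : ℂ) * (((-(2 * Real.pi / δ) * t : ℝ) : ℂ) * Complex.I)) := by
        rw [← Complex.exp_sub]
        congr 1
        push_cast
        ring
      rw [e1]
      have e0 : (n : ℂ) ^ (σ : ℂ) ≠ 0 := by simp [Complex.cpow_eq_zero_iff, hn]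
      have e2 := Complex.exp_ne_zero (((Real.log n : ℝ) : ℂ) * (((-(2 * Real.pi / δ) * t : ℝ) : ℂ) * Complex.I))
      field_simp
  rw [hR] at key
  simp_rw [hL] at key
  exact key

def bmp : ContDiffBump (1/2 : ℝ) := ⟨1/4, 1/2, by norm_num, by norm_num⟩

lemma bmp_cs : HasCompactSupport (fun x : ℝ => (bmp x : ℂ)) :=
  bmp.hasCompactSupport.comp_left (g := fun x : ℝ => (x : ℂ)) Complex.ofReal_zero

lemma bmp_smooth : ContDiff ℝ (⊤ : ℕ∞) (fun x : ℝ => (bmp x : ℂ)) :=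
  Complex.ofRealCLM.contDiff.comp bmp.contDiff

open scoped SchwartzMap in
def bmpS : 𝓢(ℝ, ℂ) := bmp_cs.toSchwartzMap bmp_smooth

lemma bmpS_apply (x : ℝ) : bmpS x = (bmp x : ℂ) := rfl

lemma bmp_zero {x : ℝ} (h : ¬ (0 < x ∧ x < 1)) : bmp x = 0 := by
  apply bmp.zero_of_le_dist
  show (1/2 : ℝ) ≤ dist x (1/2)
  rw [Real.dist_eq, le_abs]
  by_cases h0 : 0 < x
  · left
    have : 1 ≤ x := by by_contra h1; exact h ⟨h0, by linarith⟩
    linarith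
  · right; linarith

lemma bmp_one {x : ℝ} (h : 1/4 ≤ x) (h' : x ≤ 3/4) : bmp x = 1 := by
  apply bmp.one_of_mem_closedBall
  rw [Metric.mem_closedBall, Real.dist_eq, abs_le]
  show -(1/4) ≤ _ ∧ _ ≤ (1/4:ℝ)
  constructor <;> linarith

def shortN (y δ : ℝ) : Finset ℕ := (Finset.range ⌈Real.exp (y + δ)⌉₊).filter (fun n => Real.exp y < n)

lemma mem_shortN {y δ : ℝ} {n : ℕ} : n ∈ shortN y δ ↔ Real.exp y < n ∧ (n:ℝ) < Real.exp (y + δ) := by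
  simp [shortN, Nat.lt_ceil, and_comm]

lemma short_weighted : ∃ C : ℝ, 0 < C ∧ ∀ y δ : ℝ, 2 ≤ y → 0 < δ → δ ≤ 1 →
    |∑ n ∈ shortN y δ, (ArithmeticFunction.vonMangoldt n - 1) * (n:ℝ) ^ (-(1 + 1/y)) *
      bmp ((Real.log n - y) / δ)| ≤ C * (δ⁻¹) ^ ((1:ℝ)/100) * (y ^ 9)⁻¹ := by
  obtain ⟨C, hC0, hC⟩ := hh_fourier (FourierTransform.fourier bmpS)
  refine ⟨C, hC0, fun y δ hy hδ hδ1 => ?_⟩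
  have hy0 : 0 < y := by linarith
  have hyi : 1 / y ≤ 1 / 2 := one_div_le_one_div_of_le (by norm_num) hy
  have hyi0 : 0 < 1 / y := by positivity
  have h1 := hC (1 + 1/y) δ y (by linarith) (by linarith) hδ hδ1 hy0
  have h2 := fourier_identity bmpS (1 + 1/y) δ y (by linarith) hδ
  have h3 : HasSum (fun n : ℕ => LSeries.term fLam ((1 + 1/y : ℝ) : ℂ) n * bmpS ((Real.log n - y) / δ))
      (∑ n ∈ shortN y δ, LSeries.term fLam ((1 + 1/y : ℝ) : ℂ) n * bmpS ((Real.log n - y) / δ)) := by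
    apply hasSum_sum_of_ne_finset_zero
    intro n hn
    rcases eq_or_ne n 0 with rfl | hn0
    · simp
    have hnp : (0:ℝ) < n := by exact_mod_cast Nat.pos_of_ne_zero hn0
    rw [bmpS_apply, bmp_zero, Complex.ofReal_zero, mul_zero]
    rintro ⟨a, b⟩
    apply hn
    rw [mem_shortN]
    rw [div_pos_iff_of_pos_right hδ] at a
    rw [div_lt_one hδ] at b
    constructor
    · rw [← Real.lt_log_iff_exp_lt hnp]; linarith
    · rw [← Real.log_lt_iff_lt_exp hnp]; linarith
  rw [h2.unique h3] at h1
  refine le_trans (le_of_eq ?_) h1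
  rw [← Real.norm_eq_abs, ← Complex.norm_real]
  congr 1
  push_cast
  refine Finset.sum_congr rfl fun n hn => ?_
  have hn0 : n ≠ 0 := by
    rintro rfl
    have := (mem_shortN.mp hn).1
    have := Real.exp_pos y
    simp at *
    linarith
  rw [LSeries.term_of_ne_zero hn0, bmpS_apply, fLam]
  rw [Complex.ofReal_cpow (by positivity)]
  push_cast
  rw [Complex.cpow_neg]
  simp only [div_eq_mul_inv]

lemma short_main (y δ : ℝ) (hy : 2 ≤ y) (hδ : 0 < δ) (hδ1 : δ ≤ 1) (hbig : 4 ≤ Real.exp y * δ) :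
    Real.exp (-3) / 4 * δ ≤ ∑ n ∈ shortN y δ, (n:ℝ) ^ (-(1 + 1/y)) * bmp ((Real.log n - y) / δ) := by
  set A := Real.exp (y + δ / 4) with hA
  set B := Real.exp (y + 3 * δ / 4) with hB
  have hy0 : 0 < y := by linarith
  have hA0 : 0 < A := Real.exp_pos _
  have hB0 : 0 < B := Real.exp_pos _
  have hBA : Real.exp y * δ / 2 ≤ B - A := by
    have e1 : B = A * Real.exp (δ / 2) := by rw [hA, hB, ← Real.exp_add]; congr 1; ring
    have e2 := Real.add_one_le_exp (δ / 2)
    have e3 : Real.exp y ≤ A := Real.exp_le_exp.mpr (by linarith)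
    rw [e1]
    nlinarith [Real.exp_pos y]
  have hsub : Finset.Icc ⌈A⌉₊ ⌊B⌋₊ ⊆ shortN y δ := by
    intro n hn
    rw [Finset.mem_Icc, Nat.ceil_le, Nat.le_floor_iff hB0.le] at hn
    rw [mem_shortN]
    constructor
    · refine lt_of_lt_of_le ?_ hn.1
      exact Real.exp_lt_exp.mpr (by linarith)
    · refine lt_of_le_of_lt hn.2 ?_
      exact Real.exp_lt_exp.mpr (by linarith)
  have hcard : Real.exp y * δ / 4 ≤ ((Finset.Icc ⌈A⌉₊ ⌊B⌋₊).card : ℝ) := by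
    rw [Nat.card_Icc]
    have e1 : (⌊B⌋₊ : ℝ) + 1 - ⌈A⌉₊ ≤ ((⌊B⌋₊ + 1 - ⌈A⌉₊ : ℕ) : ℝ) := by
      have : (((⌊B⌋₊ + 1 : ℕ) : ℝ)) - (⌈A⌉₊ : ℝ) ≤ ((⌊B⌋₊ + 1 - ⌈A⌉₊ : ℕ) : ℝ) := by
        rw [sub_le_iff_le_add]
        exact_mod_cast (by omega : ⌊B⌋₊ + 1 ≤ ⌊B⌋₊ + 1 - ⌈A⌉₊ + ⌈A⌉₊)
      push_cast at this; linarith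
    have e2 := Nat.lt_floor_add_one B
    have e3 := Nat.ceil_lt_add_one hA0.le
    linarith
  calc Real.exp (-3) / 4 * δ = (Real.exp y * δ / 4) * Real.exp (-(y + 3)) := by
        rw [show -(y+3) = -y + (-3) by ring, Real.exp_add, Real.exp_neg y]
        have := Real.exp_pos y
        field_simp
    _ ≤ ((Finset.Icc ⌈A⌉₊ ⌊B⌋₊).card : ℝ) * Real.exp (-(y + 3)) := by gcongr
    _ = ∑ n ∈ Finset.Icc ⌈A⌉₊ ⌊B⌋₊, Real.exp (-(y + 3)) := by rw [Finset.sum_const, nsmul_eq_mul]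
    _ ≤ ∑ n ∈ Finset.Icc ⌈A⌉₊ ⌊B⌋₊, (n:ℝ) ^ (-(1 + 1/y)) * bmp ((Real.log n - y) / δ) := by
        refine Finset.sum_le_sum fun n hn => ?_
        rw [Finset.mem_Icc, Nat.ceil_le, Nat.le_floor_iff hB0.le] at hn
        have hn0 : (0:ℝ) < n := by linarith [hn.1]
        have l1 : y + δ / 4 ≤ Real.log n := (Real.le_log_iff_exp_le hn0).mpr hn.1
        have l2 : Real.log n ≤ y + 3 * δ / 4 := (Real.log_le_iff_le_exp hn0).mpr hn.2
        rw [bmp_one, mul_one, Real.rpow_def_of_pos hn0]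
        · apply Real.exp_le_exp.mpr
          have : Real.log n * (1 + 1/y) ≤ (y + 1) * (1 + 1/y) := by
            gcongr; linarith
          have e : (y + 1) * (1 + 1/y) = y + 2 + 1 / y := by field_simp; ring
          have e' : 1 / y ≤ 1 := by rw [div_le_one hy0]; linarith
          linarith
        · rw [le_div_iff₀ hδ]; linarith
        · rw [div_le_iff₀ hδ]; linarith
    _ ≤ _ := by
        apply Finset.sum_le_sum_of_subset_of_nonneg hsub
        intro n _ _
        have := bmp.nonneg (x := (Real.log n - y) / δ)
        positivity

lemma pnt_short : ∃ c : ℝ, 0 < c ∧ ∃ Y : ℝ, ∀ y δ : ℝ, Y ≤ y → y ^ (-8 : ℤ) ≤ δ → δ ≤ 1 →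
    c * δ * Real.exp y ≤ ∑ n ∈ shortN y δ, ArithmeticFunction.vonMangoldt n := by
  obtain ⟨C, hC0, hC⟩ := short_weighted
  have ev1 : ∀ᶠ y : ℝ in Filter.atTop, 4 * y ^ 8 ≤ Real.exp y := by
    have := (Real.tendsto_exp_div_pow_atTop 8).eventually_ge_atTop 4
    filter_upwards [this, Filter.eventually_gt_atTop 0] with y h1 h2
    rwa [le_div_iff₀ (by positivity)] at h1
  have ev2 : ∀ᶠ y : ℝ in Filter.atTop, C * y ^ ((1:ℝ)/2) * (y⁻¹) ≤ Real.exp (-3) / 8 := by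
    have h1 := tendsto_rpow_neg_atTop (y := (1:ℝ)/2) (by norm_num)
    have h2 := (h1.const_mul C).eventually_le_const (u := Real.exp (-3) / 8) (by rw [mul_zero]; positivity)
    filter_upwards [h2, Filter.eventually_gt_atTop 0] with y h3 h4
    refine le_trans (le_of_eq ?_) h3
    rw [mul_assoc, ← Real.rpow_neg_one y, ← Real.rpow_add h4]
    norm_num
  obtain ⟨Y, hY⟩ := Filter.eventually_atTop.mp (ev1.and (ev2.and (Filter.eventually_ge_atTop 2)))
  refine ⟨Real.exp (-3) / 8, by positivity, Y, fun y δ hy hδ hδ1 => ?_⟩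
  obtain ⟨g1, g2, g3⟩ := hY y hy
  have hy0 : 0 < y := by linarith
  have hδ0 : 0 < δ := lt_of_lt_of_le (by positivity) hδ
  have hδ' : 1 ≤ y ^ 8 * δ := by
    have : y ^ (-8 : ℤ) = (y ^ 8)⁻¹ := by rw [zpow_neg]; rfl
    rw [this, inv_le_iff_one_le_mul₀' (by positivity)] at hδ
    exact hδ
  have hbig : 4 ≤ Real.exp y * δ := by nlinarith
  have hm := short_main y δ g3 hδ0 hδ1 hbig
  have he := hC y δ g3 hδ0 hδ1
  have herr : C * (δ⁻¹) ^ ((1:ℝ)/100) * (y ^ 9)⁻¹ ≤ Real.exp (-3) / 8 * δ := by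
    have e1 : (δ⁻¹) ^ ((1:ℝ)/100) ≤ y ^ ((1:ℝ)/2) := by
      have : δ⁻¹ ≤ y ^ 8 := by
        rw [inv_le_iff_one_le_mul₀' hδ0]; linarith
      calc (δ⁻¹) ^ ((1:ℝ)/100) ≤ (y ^ 8) ^ ((1:ℝ)/100) := by gcongr
        _ = y ^ ((8:ℕ) * ((1:ℝ)/100)) := by rw [Real.rpow_mul hy0.le, Real.rpow_natCast]
        _ ≤ _ := by
          apply Real.rpow_le_rpow_of_exponent_le
          · linarith
          · norm_num
    have e2 : (y ^ 9)⁻¹ ≤ y⁻¹ * δ := by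
      rw [inv_le_iff_one_le_mul₀' (by positivity)]
      calc 1 ≤ y ^ 8 * δ := hδ'
        _ = y ^ 9 * (y⁻¹ * δ) := by field_simp
    calc _ ≤ C * y ^ ((1:ℝ)/2) * (y⁻¹ * δ) := by gcongr
      _ = C * y ^ ((1:ℝ)/2) * y⁻¹ * δ := by ring
      _ ≤ _ := by gcongr
  have hsplit : ∑ n ∈ shortN y δ, (ArithmeticFunction.vonMangoldt n - 1) * (n:ℝ) ^ (-(1 + 1/y)) *
      bmp ((Real.log n - y) / δ) = ∑ n ∈ shortN y δ, ArithmeticFunction.vonMangoldt n * (n:ℝ) ^ (-(1 + 1/y)) *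
      bmp ((Real.log n - y) / δ) - ∑ n ∈ shortN y δ, (n:ℝ) ^ (-(1 + 1/y)) * bmp ((Real.log n - y) / δ) := by
    rw [← Finset.sum_sub_distrib]
    refine Finset.sum_congr rfl fun n _ => by ring
  have hup : ∑ n ∈ shortN y δ, ArithmeticFunction.vonMangoldt n * (n:ℝ) ^ (-(1 + 1/y)) *
      bmp ((Real.log n - y) / δ) ≤ ∑ n ∈ shortN y δ, ArithmeticFunction.vonMangoldt n * Real.exp (-y) := by
    refine Finset.sum_le_sum fun n hn => ?_
    have hn1 := (mem_shortN.mp hn).1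
    have hn0 : (0:ℝ) < n := lt_trans (Real.exp_pos _) hn1
    have hΛ := ArithmeticFunction.vonMangoldt_nonneg (n := n)
    have e1 : (n:ℝ) ^ (-(1 + 1/y)) ≤ Real.exp (-y) := by
      have l1 : y < Real.log n := (Real.lt_log_iff_exp_lt hn0).mpr hn1
      rw [Real.rpow_def_of_pos hn0]
      apply Real.exp_le_exp.mpr
      have : 0 < 1 / y := by positivity
      nlinarith
    have e2 := bmp.le_one (x := (Real.log n - y) / δ)
    have e3 := bmp.nonneg (x := (Real.log n - y) / δ)
    calc _ ≤ ArithmeticFunction.vonMangoldt n * Real.exp (-y) * 1 := by gcongr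
      _ = _ := mul_one _
  rw [← Finset.sum_mul] at hup
  rw [hsplit] at he
  have he' := (abs_le.mp he).1
  have hfin : Real.exp (-3) / 8 * δ ≤ (∑ n ∈ shortN y δ, ArithmeticFunction.vonMangoldt n) * Real.exp (-y) := by
    linarith
  rw [Real.exp_neg y, ← div_eq_mul_inv, le_div_iff₀ (Real.exp_pos y)] at hfin
  exact hfin

lemma tendsto_bigL : Filter.Tendsto bigL Filter.atTop Filter.atTop :=
  Real.tendsto_log_atTop.comp tendsto_natCast_atTop_atTop

lemma ev_exp (K : ℝ) : ∀ᶠ y : ℝ in Filter.atTop, K * y ^ 8 ≤ Real.exp (y / 2) := by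
  have h0 : Filter.Tendsto (fun y : ℝ => y / 2) Filter.atTop Filter.atTop :=
    Filter.tendsto_id.atTop_div_const (by norm_num)
  have := ((Real.tendsto_exp_div_pow_atTop 8).comp h0).eventually_ge_atTop (|K| * 2 ^ 8)
  filter_upwards [this, Filter.eventually_gt_atTop 0] with y h1 h2
  simp only [Function.comp] at h1
  rw [le_div_iff₀ (by positivity)] at h1
  calc K * y ^ 8 ≤ |K| * y ^ 8 := by gcongr; exact le_abs_self K
    _ = |K| * 2 ^ 8 * (y / 2) ^ 8 := by ring
    _ ≤ _ := h1

lemma calP_lower : ∃ c : ℝ, 0 < c ∧ ∀ᶠ D : ℕ in Filter.atTop,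
    c * bigP D ^ 2 * bigL D ^ (-77 : ℤ) ≤ calP D := by
  obtain ⟨c, hc, Y, hY⟩ := pnt_short
  obtain ⟨C, hC⟩ := Chebyshev.psi_sub_theta_le_mul_sqrt
  refine ⟨c / 8, by positivity, ?_⟩
  have t9 : Filter.Tendsto (fun D => bigL D ^ 9) Filter.atTop Filter.atTop :=
    (Filter.tendsto_pow_atTop (by norm_num)).comp tendsto_bigL
  filter_upwards [tendsto_bigL.eventually_ge_atTop 2, t9.eventually_ge_atTop Y,
    t9.eventually (ev_exp (8 * |C| / c))] with D g1 g2 g3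
  set L := bigL D with hL
  set y := L ^ 9 with hy
  have hP : bigP D = Real.exp y := rfl
  set P := Real.exp y with hPd
  have hP0 : 0 < P := Real.exp_pos _
  have hL0 : 0 < L := by linarith
  set δ := L ^ (-68 : ℤ) / 2 with hδ
  have hδ0 : 0 < δ := by positivity
  have hz68 : L ^ (-68 : ℤ) = (L ^ 68)⁻¹ := by rw [zpow_neg]; rfl
  have hL68 : (1:ℝ) ≤ L ^ 68 := one_le_pow₀ (by linarith)
  have hinv68 : (L ^ 68)⁻¹ ≤ 1 := inv_le_one_of_one_le₀ hL68
  have hδ1 : δ ≤ 1 := by rw [hδ, hz68]; linarith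
  have hδy : y ^ (-8 : ℤ) ≤ δ := by
    have : y ^ (-8 : ℤ) = (y ^ 8)⁻¹ := by rw [zpow_neg]; rfl
    rw [this, hδ, hz68, hy, ← pow_mul, ← one_div, ← one_div, div_div]
    apply one_div_le_one_div_of_le (by positivity)
    calc L ^ 68 * 2 ≤ L ^ 68 * L ^ 4 := by
          gcongr
          have : L ≤ L ^ 4 := le_self_pow₀ (by linarith) (by norm_num)
          linarith
      _ = _ := by ring
  have h1 := hY y δ g2 hδy hδ1
  have hexpδ : Real.exp (y + δ) ≤ P * (1 + L ^ (-68 : ℤ)) := by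
    rw [Real.exp_add]
    gcongr
    have := Real.abs_exp_sub_one_le (x := δ) (by rw [abs_of_pos hδ0]; exact hδ1)
    rw [abs_of_pos hδ0] at this
    have := (abs_le.mp this).2
    have : 2 * δ = L ^ (-68 : ℤ) := by rw [hδ]; ring
    linarith
  have h2P : P * (1 + L ^ (-68 : ℤ)) ≤ 2 * P := by
    rw [hz68]; nlinarith
  have hlog : Real.log (2 * P) ≤ 2 * L ^ 9 := by
    rw [Real.log_mul (by norm_num) hP0.ne', hPd, Real.log_exp]
    have : Real.log 2 ≤ 1 := by have := Real.log_two_lt_d9; linarith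
    have : (1:ℝ) ≤ L ^ 9 := one_le_pow₀ (by linarith)
    linarith
  -- split
  have hsplit : ∑ n ∈ shortN y δ, ArithmeticFunction.vonMangoldt n ≤
      ∑ n ∈ primesP D, (2 * L ^ 9) + (Chebyshev.psi (2 * P) - Chebyshev.theta (2 * P)) := by
    rw [Chebyshev.psi_sub_theta_eq_sum_not_prime, ← Finset.sum_filter_add_sum_filter_not (shortN y δ) Nat.Prime]
    refine add_le_add ?_ ?_
    · calc ∑ n ∈ (shortN y δ).filter Nat.Prime, ArithmeticFunction.vonMangoldt n
          ≤ ∑ n ∈ (shortN y δ).filter Nat.Prime, (2 * L ^ 9) := by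
            refine Finset.sum_le_sum fun n hn => ?_
            rw [Finset.mem_filter, mem_shortN] at hn
            refine ArithmeticFunction.vonMangoldt_le_log.trans (le_trans ?_ hlog)
            apply Real.log_le_log
            · exact_mod_cast hn.2.pos
            · linarith [hn.1.2]
        _ ≤ _ := by
            apply Finset.sum_le_sum_of_subset_of_nonneg
            · intro n hn
              rw [Finset.mem_filter, mem_shortN] at hn
              rw [primesP, Finset.mem_filter, Finset.mem_range, Nat.lt_ceil]
              refine ⟨?_, hn.2, ?_, ?_⟩
              · rw [hP]; linarith [hn.1.2]
              · rw [hP]; exact hn.1.1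
              · rw [hP]; exact hn.1.2.trans_le hexpδ
            · intros; positivity
    · refine le_trans (Finset.sum_le_sum_of_subset_of_nonneg (t := Finset.filter (fun n => ¬ n.Prime) (Finset.Ioc 0 ⌊2 * P⌋₊)) ?_ ?_) (le_of_eq ?_)
      · intro n hn
        rw [Finset.mem_filter, mem_shortN] at hn
        rw [Finset.mem_filter, Finset.mem_Ioc, Nat.le_floor_iff (by positivity)]
        refine ⟨⟨?_, by linarith [hn.1.2]⟩, hn.2⟩
        have : (0:ℝ) < n := hP0.trans hn.1.1
        exact_mod_cast this
      · intros; exact ArithmeticFunction.vonMangoldt_nonneg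
      · congr 1
  have hCb : C * Real.sqrt (2 * P) ≤ c * δ * P / 2 := by
    have e1 : Real.sqrt (2 * P) ≤ 2 * Real.exp (y / 2) := by
      rw [Real.sqrt_le_left (by positivity)]
      have : Real.exp (y/2) ^ 2 = P := by rw [← Real.exp_nat_mul]; congr 1; push_cast; ring
      nlinarith
    have e2 : P = Real.exp (y/2) * Real.exp (y/2) := by rw [← Real.exp_add, hPd]; congr 1; ring
    have e3 : 1 ≤ y ^ 8 * δ := by
      have : y ^ (-8 : ℤ) = (y ^ 8)⁻¹ := by rw [zpow_neg]; rfl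
      rw [this, inv_le_iff_one_le_mul₀' (by positivity)] at hδy
      exact hδy
    have e4 : 8 * |C| / c ≤ Real.exp (y/2) * δ := by
      calc 8 * |C| / c ≤ 8 * |C| / c * (y ^ 8 * δ) := le_mul_of_one_le_right (by positivity) e3
        _ = 8 * |C| / c * y ^ 8 * δ := by ring
        _ ≤ _ := by gcongr
    rw [div_le_iff₀ hc] at e4
    have hE := Real.exp_pos (y/2)
    calc C * Real.sqrt (2 * P) ≤ |C| * (2 * Real.exp (y / 2)) := by
          gcongr; exact le_abs_self C
      _ = (8 * |C|) * Real.exp (y/2) / 4 := by ring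
      _ ≤ (Real.exp (y/2) * δ * c) * Real.exp (y/2) / 4 := by gcongr
      _ = c * δ * P / 4 := by rw [e2]; ring
      _ ≤ _ := by
        have : 0 < c * δ * P := by positivity
        linarith
  have hfin : c * δ * P / 2 ≤ ∑ n ∈ primesP D, (2 * L ^ 9) := by
    have := hC (2 * P)
    linarith
  rw [← Finset.sum_congr rfl (fun x _ => rfl), Finset.sum_const, nsmul_eq_mul] at hfin
  have hcard : ((primesP D).card : ℝ) * P ≤ calP D := by
    rw [calP, ← nsmul_eq_mul, ← Finset.sum_const]
    refine Finset.sum_le_sum fun p hp => ?_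
    rw [primesP, Finset.mem_filter] at hp
    exact hp.2.2.1.le
  refine le_trans ?_ hcard
  rw [hP]
  have hz77 : L ^ (-77 : ℤ) = (L ^ 68)⁻¹ * (L ^ 9)⁻¹ := by
    rw [← mul_inv, ← pow_add, zpow_neg]; rfl
  rw [hz77]
  rw [hδ, hz68] at hfin
  have hL9 : 0 < L ^ 9 := by positivity
  have : c / 8 * P * (L ^ 68)⁻¹ * (L ^ 9)⁻¹ ≤ ((primesP D).card : ℝ) := by
    rw [← div_eq_mul_inv, div_le_iff₀ hL9]
    nlinarith
  calc c / 8 * P ^ 2 * ((L ^ 68)⁻¹ * (L ^ 9)⁻¹) = (c / 8 * P * (L ^ 68)⁻¹ * (L ^ 9)⁻¹) * P := by ring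
    _ ≤ _ := by gcongr

/-- A completely multiplicative function with values in -1, 0, 1. -/
structure RC (c : ℕ → ℝ) : Prop where
  zero : c 0 = 0
  one : c 1 = 1
  mul : ∀ m n, c (m * n) = c m * c n
  val : ∀ n, c n = 0 ∨ c n = 1 ∨ c n = -1

def rcV (c : ℕ → ℝ) (n : ℕ) : ℝ := ∑ d ∈ n.divisors, c d

def rcA {c : ℕ → ℝ} (h : RC c) : ArithmeticFunction ℝ := ⟨c, h.zero⟩

def rcF {c : ℕ → ℝ} (h : RC c) : ArithmeticFunction ℝ := (ArithmeticFunction.zeta : ArithmeticFunction ℝ) * rcA h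

theorem rcF_apply {c : ℕ → ℝ} (h : RC c) (n : ℕ) : rcF h n = rcV c n := by
  unfold rcF rcV
  rw [ArithmeticFunction.coe_zeta_mul_apply]
  rfl

theorem rcF_mult {c : ℕ → ℝ} (h : RC c) : (rcF h).IsMultiplicative := by
  unfold rcF
  refine ArithmeticFunction.IsMultiplicative.mul ArithmeticFunction.isMultiplicative_zeta.natCast ?_
  refine ⟨h.one, ?_⟩
  intro m n _
  exact h.mul m n

theorem RC.pow {c : ℕ → ℝ} (h : RC c) (n k : ℕ) : c (n ^ k) = c n ^ k := by
  induction k with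
  | zero => simp [h.one]
  | succ k ih => rw [pow_succ, h.mul, ih, pow_succ]

theorem rcV_pp {c : ℕ → ℝ} (h : RC c) {p : ℕ} (hp : p.Prime) (k : ℕ) :
    rcV c (p ^ k) = ∑ i ∈ Finset.range (k + 1), c p ^ i := by
  unfold rcV
  rw [Nat.sum_divisors_prime_pow hp]
  exact Finset.sum_congr rfl fun i _ => h.pow p i

theorem rcV_pp_cases {c : ℕ → ℝ} (h : RC c) {p : ℕ} (hp : p.Prime) :
    (∀ k : ℕ, rcV c (p ^ k) = k + 1) ∨ (∀ k : ℕ, rcV c (p ^ k) = 0 ∨ rcV c (p ^ k) = 1) := by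
  rcases h.val p with h0 | h0 | h0
  · right; intro k; right
    rw [rcV_pp h hp, h0, Finset.sum_range_succ']
    simp
  · left; intro k
    rw [rcV_pp h hp, h0]; simp
  · right; intro k
    rw [rcV_pp h hp, h0]
    rcases Nat.even_or_odd (k + 1) with he | he
    · left; rw [neg_one_geom_sum, if_pos he]
    · right; rw [neg_one_geom_sum, if_neg (Nat.not_even_iff_odd.mpr he)]

theorem rcV_pp_nonneg {c : ℕ → ℝ} (h : RC c) {p : ℕ} (hp : p.Prime) (k : ℕ) :
    0 ≤ rcV c (p ^ k) := by
  rcases rcV_pp_cases h hp with h1 | h1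
  · rw [h1]; positivity
  · rcases h1 k with h2 | h2 <;> rw [h2]; norm_num

theorem rcV_nonneg {c : ℕ → ℝ} (h : RC c) (n : ℕ) : 0 ≤ rcV c n := by
  induction n using Nat.recOnPosPrimePosCoprime with
  | zero => simp [rcV]
  | one => simp [rcV, h.one]
  | prime_pow p k hp hk => exact rcV_pp_nonneg h hp k
  | coprime a b ha hb hab iha ihb =>
    rw [← rcF_apply h, (rcF_mult h).map_mul_of_coprime hab, rcF_apply, rcF_apply]
    positivity

theorem rcV_sq_le {c : ℕ → ℝ} (h : RC c) (n : ℕ) :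
    rcV c n ^ 2 ≤ ∑ x ∈ n.divisorsAntidiagonal, rcV c x.1 * rcV c x.2 := by
  have e : ∀ n, ∑ x ∈ n.divisorsAntidiagonal, rcV c x.1 * rcV c x.2 = (rcF h * rcF h) n := by
    intro n
    rw [ArithmeticFunction.mul_apply]
    simp_rw [rcF_apply]
  induction n using Nat.recOnPosPrimePosCoprime with
  | zero => simp [rcV]
  | one => simp [rcV, h.one]
  | prime_pow p k hp hk =>
    rw [Nat.sum_divisorsAntidiagonal (fun a b => rcV c a * rcV c b), Nat.sum_divisors_prime_pow hp]
    have e2 : ∀ i ∈ Finset.range (k + 1), rcV c (p ^ i) * rcV c (p ^ k / p ^ i) =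
        rcV c (p ^ i) * rcV c (p ^ (k - i)) := by
      intro i hi
      rw [Nat.pow_div (by simpa [Nat.lt_succ_iff] using hi) hp.pos]
    rw [Finset.sum_congr rfl e2]
    rcases rcV_pp_cases h hp with h1 | h1
    · simp_rw [h1]
      have : ∀ i ∈ Finset.range (k + 1), (k + 1 : ℝ) ≤ ((i : ℝ) + 1) * (((k - i : ℕ) : ℝ) + 1) := by
        intro i hi
        have hi' : i ≤ k := by simpa [Nat.lt_succ_iff] using hi
        rw [Nat.cast_sub hi']
        have : (i : ℝ) ≤ k := by exact_mod_cast hi'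
        have h0 : (0:ℝ) ≤ i := by positivity
        nlinarith
      have h2 := Finset.sum_le_sum this
      simp only [Finset.sum_const, Finset.card_range, nsmul_eq_mul] at h2
      push_cast at h2
      linarith [pow_two ((k:ℝ)+1)]
    · have h2 : rcV c (p ^ k) ^ 2 = rcV c (p ^ 0) * rcV c (p ^ (k - 0)) := by
        have h3 : rcV c (p ^ 0) = 1 := by simp [rcV, h.one]
        rw [h3, Nat.sub_zero]
        rcases h1 k with h2 | h2 <;> rw [h2] <;> norm_num
      rw [h2]
      exact Finset.single_le_sum (f := fun i => rcV c (p ^ i) * rcV c (p ^ (k - i)))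
        (fun i _ => mul_nonneg (rcV_nonneg h _) (rcV_nonneg h _)) (by simp)
  | coprime a b ha hb hab iha ihb =>
    rw [e] at *
    rw [((rcF_mult h).mul (rcF_mult h)).map_mul_of_coprime hab]
    have : rcV c (a * b) = rcV c a * rcV c b := by
      rw [← rcF_apply h, (rcF_mult h).map_mul_of_coprime hab, rcF_apply, rcF_apply]
    rw [this, mul_pow]
    exact mul_le_mul iha ihb (by positivity) (le_trans (by positivity) iha)

/-- Reduction of the sum of squares. -/
theorem rcV_S {c : ℕ → ℝ} (h : RC c) (X Y : ℕ) :
    ∑ n ∈ Finset.Ioc (X ^ 2) Y, rcV c n ^ 2 / n ≤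
      2 * (∑ n ∈ Finset.Ioc X Y, rcV c n / n) * ∑ n ∈ Finset.Ioc 0 Y, rcV c n / n := by
  have nn := fun n => rcV_nonneg h n
  have qn : ∀ n : ℕ, 0 ≤ rcV c n / n := fun n => div_nonneg (nn n) (Nat.cast_nonneg n)
  have h1 : ∑ n ∈ Finset.Ioc (X ^ 2) Y, rcV c n ^ 2 / n ≤
      ∑ n ∈ Finset.Ioc (X ^ 2) Y, ∑ x ∈ n.divisorsAntidiagonal,
        (rcV c x.1 / x.1) * (rcV c x.2 / x.2) := by
    refine Finset.sum_le_sum fun n hn => ?_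
    have hn0 : 0 < n := by rw [Finset.mem_Ioc] at hn; omega
    have h2 := div_le_div_of_nonneg_right (rcV_sq_le h n) (Nat.cast_nonneg (α := ℝ) n)
    refine h2.trans (le_of_eq ?_)
    rw [Finset.sum_div]
    refine Finset.sum_congr rfl fun x hx => ?_
    have := (Nat.mem_divisorsAntidiagonal.mp hx).1
    rw [← this]; push_cast
    rw [div_mul_div_comm]
  refine h1.trans ?_
  rw [Finset.sum_sigma']
  set G : ℕ × ℕ → ℝ := fun x => (rcV c x.1 / x.1) * (rcV c x.2 / x.2) with hG
  have Gn : ∀ x, 0 ≤ G x := fun x => mul_nonneg (qn _) (qn _)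
  have h2 : ∑ x ∈ (Finset.Ioc (X ^ 2) Y).sigma fun n => n.divisorsAntidiagonal, G x.2 =
      ∑ z ∈ ((Finset.Ioc (X ^ 2) Y).sigma fun n => n.divisorsAntidiagonal).image (fun x => x.2), G z := by
    rw [Finset.sum_image]
    rintro ⟨n, x⟩ hx ⟨m, y⟩ hy hxy
    simp only [Finset.coe_sigma, Set.mem_sigma_iff, Finset.mem_coe, Nat.mem_divisorsAntidiagonal] at hx hy hxy
    subst hxy
    have : n = m := by rw [← hx.2.1, ← hy.2.1]
    subst this
    rfl
  have h3 : ((Finset.Ioc (X ^ 2) Y).sigma fun n => n.divisorsAntidiagonal).image (fun x => x.2) ⊆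
      (Finset.Ioc X Y ×ˢ Finset.Ioc 0 Y) ∪ (Finset.Ioc 0 Y ×ˢ Finset.Ioc X Y) := by
    intro z hz
    rw [Finset.mem_image] at hz
    obtain ⟨⟨n, x⟩, hx, rfl⟩ := hz
    simp only [Finset.mem_sigma, Finset.mem_Ioc, Nat.mem_divisorsAntidiagonal] at hx
    obtain ⟨⟨hx1, hx2⟩, hx3, hx4⟩ := hx
    simp only [Finset.mem_union, Finset.mem_product, Finset.mem_Ioc]
    have p1 : 0 < x.1 := by
      rcases Nat.eq_zero_or_pos x.1 with h0 | h0
      · rw [h0] at hx3; omega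
      · exact h0
    have p2 : 0 < x.2 := by
      rcases Nat.eq_zero_or_pos x.2 with h0 | h0
      · rw [h0] at hx3; omega
      · exact h0
    have l1 : x.1 ≤ Y := by
      have : x.1 ≤ x.1 * x.2 := Nat.le_mul_of_pos_right _ p2
      omega
    have l2 : x.2 ≤ Y := by
      have : x.2 ≤ x.1 * x.2 := Nat.le_mul_of_pos_left _ p1
      omega
    by_cases hX : X < x.1
    · left; exact ⟨⟨hX, l1⟩, p2, l2⟩
    · right
      refine ⟨⟨p1, l1⟩, ?_, l2⟩
      by_contra hX2
      have : x.1 * x.2 ≤ X * X := Nat.mul_le_mul (by omega) (by omega)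
      rw [pow_two] at hx1
      omega
  show ∑ x ∈ (Finset.Ioc (X ^ 2) Y).sigma fun n => n.divisorsAntidiagonal, G x.2 ≤ _
  rw [h2]
  refine (Finset.sum_le_sum_of_subset_of_nonneg h3 fun z _ _ => Gn z).trans ?_
  have h4 := Finset.sum_union_inter (s₁ := Finset.Ioc X Y ×ˢ Finset.Ioc 0 Y)
    (s₂ := Finset.Ioc 0 Y ×ˢ Finset.Ioc X Y) (f := G)
  have h5 : 0 ≤ ∑ x ∈ (Finset.Ioc X Y ×ˢ Finset.Ioc 0 Y) ∩ (Finset.Ioc 0 Y ×ˢ Finset.Ioc X Y), G x :=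
    Finset.sum_nonneg fun z _ => Gn z
  have h6 : ∑ x ∈ Finset.Ioc X Y ×ˢ Finset.Ioc 0 Y, G x =
      (∑ n ∈ Finset.Ioc X Y, rcV c n / n) * ∑ n ∈ Finset.Ioc 0 Y, rcV c n / n := by
    rw [Finset.sum_mul_sum, Finset.sum_product]
  have h7 : ∑ x ∈ Finset.Ioc 0 Y ×ˢ Finset.Ioc X Y, G x =
      (∑ n ∈ Finset.Ioc 0 Y, rcV c n / n) * ∑ n ∈ Finset.Ioc X Y, rcV c n / n := by
    rw [Finset.sum_mul_sum, Finset.sum_product]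
  linarith [mul_comm (∑ n ∈ Finset.Ioc 0 Y, rcV c n / n) (∑ n ∈ Finset.Ioc X Y, rcV c n / n)]


theorem rc_abel (c g : ℕ → ℝ) (B : ℝ) (U : ℕ)
    (hB : ∀ n, |∑ d ∈ Finset.Ioc U n, c d| ≤ B)
    (hg0 : ∀ m, U ≤ m → 0 ≤ g m) (hg : ∀ m, U ≤ m → g (m + 1) ≤ g m) (V : ℕ) :
    |∑ d ∈ Finset.Ioc U V, c d * g d| ≤ B * g U := by
  have hB0 : 0 ≤ B := (abs_nonneg _).trans (hB 0)
  rcases le_or_gt V U with hV | hV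
  · rw [Finset.Ioc_eq_empty (by omega)]
    simpa using mul_nonneg hB0 (hg0 U le_rfl)
  have key : ∀ k, |∑ d ∈ Finset.Ioc U (U + k), c d * g d -
      (∑ d ∈ Finset.Ioc U (U + k), c d) * g (U + k)| ≤ B * (g U - g (U + k)) := by
    intro k
    induction k with
    | zero => simp
    | succ k ih =>
      rw [← add_assoc, Finset.sum_Ioc_succ_top (by omega), Finset.sum_Ioc_succ_top (by omega)]
      set S1 := ∑ d ∈ Finset.Ioc U (U + k), c d * g d
      set S2 := ∑ d ∈ Finset.Ioc U (U + k), c d with hS2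
      have h2 : |S2 * (g (U + k) - g (U + k + 1))| ≤ B * (g (U + k) - g (U + k + 1)) := by
        rw [abs_mul, abs_of_nonneg (sub_nonneg.mpr (hg _ (by omega)))]
        exact mul_le_mul_of_nonneg_right (hB _) (sub_nonneg.mpr (hg _ (by omega)))
      calc _ = |(S1 - S2 * g (U + k)) + S2 * (g (U + k) - g (U + k + 1))| := by ring_nf
        _ ≤ _ := abs_add_le _ _
        _ ≤ _ := by linarith
  have h1 := key (V - U)
  rw [Nat.add_sub_cancel' hV.le] at h1
  have h2 : |(∑ d ∈ Finset.Ioc U V, c d) * g V| ≤ B * g V := by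
    rw [abs_mul, abs_of_nonneg (hg0 V hV.le)]
    exact mul_le_mul_of_nonneg_right (hB _) (hg0 V hV.le)
  calc _ = |(∑ d ∈ Finset.Ioc U V, c d * g d - (∑ d ∈ Finset.Ioc U V, c d) * g V) +
      (∑ d ∈ Finset.Ioc U V, c d) * g V| := by ring_nf
    _ ≤ _ := abs_add_le _ _
    _ ≤ _ := by linarith

theorem rc_harm_up (m : ℕ) (hm : 0 < m) (n : ℕ) (hn : m ≤ n) :
    ∑ e ∈ Finset.Ioc m n, (1 / e : ℝ) ≤ Real.log (n / m) := by
  induction n, hn using Nat.le_induction with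
  | base => simp
  | succ n hn ih =>
    rw [Finset.sum_Ioc_succ_top (by omega)]
    have hn0 : (0:ℝ) < n := by exact_mod_cast (by omega : 0 < n)
    have hm0 : (0:ℝ) < m := by exact_mod_cast hm
    have h1 := Real.log_le_sub_one_of_pos (x := (n : ℝ) / (n + 1)) (by positivity)
    rw [Real.log_div hn0.ne' hm0.ne'] at ih
    rw [Real.log_div (by positivity) hm0.ne']
    rw [Real.log_div hn0.ne' (by positivity)] at h1
    have h2 : (n:ℝ) / (n + 1) - 1 = - (1 / (n + 1)) := by field_simp; ring
    push_cast
    linarith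

theorem rc_harm_low (m : ℕ) (n : ℕ) (hn : m ≤ n) :
    Real.log ((n + 1) / (m + 1)) ≤ ∑ e ∈ Finset.Ioc m n, (1 / e : ℝ) := by
  induction n, hn using Nat.le_induction with
  | base => rw [div_self (by positivity)]; simp
  | succ n hn ih =>
    rw [Finset.sum_Ioc_succ_top (by omega)]
    have h1 := Real.log_le_sub_one_of_pos (x := ((n : ℝ) + 2) / (n + 1)) (by positivity)
    rw [Real.log_div (by positivity) (by positivity)] at ih h1 ⊢
    have h2 : ((n:ℝ) + 2) / (n + 1) - 1 = 1 / (n + 1) := by field_simp; ring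
    push_cast
    rw [show (n:ℝ) + 1 + 1 = n + 2 by ring]
    linarith

theorem rc_harm_div (x y d : ℕ) (hd : 0 < d) (hx : 2 * d ≤ x) (hxy : x ≤ y) :
    |∑ e ∈ Finset.Ioc (x / d) (y / d), (1 / e : ℝ) - Real.log (y / x)| ≤ 2 * d / x := by
  have hd0 : (0:ℝ) < d := by exact_mod_cast hd
  have hx' : 2 * (d:ℝ) ≤ x := by exact_mod_cast hx
  have hxy' : (x:ℝ) ≤ y := by exact_mod_cast hxy
  have hx0 : (0:ℝ) < x := by linarith
  have hy0 : (0:ℝ) < y := by linarith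
  have hm : 0 < x / d := Nat.div_pos (by omega) hd
  have hmn : x / d ≤ y / d := Nat.div_le_div_right hxy
  have hm0 : (0:ℝ) < (x / d : ℕ) := by exact_mod_cast hm
  have up := rc_harm_up _ hm _ hmn
  have low := rc_harm_low _ _ hmn
  have hxm : ((x / d : ℕ) : ℝ) ≤ x / d := Nat.cast_div_le
  have hxm2 : (x : ℝ) / d < (x / d : ℕ) + 1 := by
    rw [div_lt_iff₀ hd0]
    have := Nat.lt_div_mul_add (a := x) hd
    have h2 : x < (x / d + 1) * d := by rw [add_mul, one_mul]; exact this
    exact_mod_cast h2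
  have hyn : ((y / d : ℕ) : ℝ) ≤ y / d := Nat.cast_div_le
  have hyn2 : (y : ℝ) / d < (y / d : ℕ) + 1 := by
    rw [div_lt_iff₀ hd0]
    have := Nat.lt_div_mul_add (a := y) hd
    have h2 : y < (y / d + 1) * d := by rw [add_mul, one_mul]; exact this
    exact_mod_cast h2
  have hn0 : (0:ℝ) < (y / d : ℕ) := by exact_mod_cast (lt_of_lt_of_le hm hmn)
  rw [abs_le]
  constructor
  · have h1 : (y : ℝ) / (x + d) ≤ ((y / d : ℕ) + 1) / ((x / d : ℕ) + 1) := by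
      have : (y : ℝ) / (x + d) = (y / d) / (x / d + 1) := by field_simp
      rw [this]
      gcongr
    have h2 := Real.log_le_log (by positivity) h1
    rw [Real.log_div hy0.ne' (by positivity)] at h2
    rw [Real.log_div hy0.ne' hx0.ne']
    have h3 := Real.log_le_sub_one_of_pos (x := ((x:ℝ) + d) / x) (by positivity)
    rw [Real.log_div (by positivity) (by positivity)] at h3
    have h4 : ((x:ℝ) + d) / x - 1 = d / x := by field_simp; ring
    have h5 : 2 * (d:ℝ) / x = d / x + d / x := by ring
    have h6 : 0 < (d:ℝ) / x := by positivity
    linarith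
  · have hxd : (0:ℝ) < x - d := by linarith
    have h1 : ((y / d : ℕ) : ℝ) / (x / d : ℕ) ≤ y / (x - d) := by
      have : (y : ℝ) / (x - d) = (y / d) / (x / d - 1) := by field_simp
      rw [this]
      have : (0:ℝ) < x / d - 1 := by
        rw [sub_pos, lt_div_iff₀ hd0]; linarith
      gcongr
      linarith
    have h2 := Real.log_le_log (by positivity) h1
    rw [Real.log_div hy0.ne' hxd.ne'] at h2
    rw [Real.log_div hy0.ne' hx0.ne']
    have h3 := Real.log_le_sub_one_of_pos (x := (x:ℝ) / (x - d)) (by positivity)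
    rw [Real.log_div (by positivity) hxd.ne'] at h3
    have h4 : (x:ℝ) / (x - d) - 1 = d / (x - d) := by field_simp; ring
    have h5 : (d:ℝ) / (x - d) ≤ 2 * d / x := by
      rw [div_le_div_iff₀ hxd hx0]; nlinarith
    linarith

theorem rc_divisor_sum (c : ℕ → ℝ) (x y : ℕ) :
    ∑ n ∈ Finset.Ioc x y, rcV c n / n =
      ∑ d ∈ Finset.Ioc 0 y, ∑ e ∈ Finset.Ioc (x / d) (y / d), c d / d * (1 / e) := by
  unfold rcV
  simp_rw [Finset.sum_div]
  rw [Finset.sum_comm' (t' := Finset.Ioc 0 y) (s' := fun d => (Finset.Ioc x y).filter (d ∣ ·))]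
  · refine Finset.sum_congr rfl fun d hd => ?_
    have hd0 : 0 < d := (Finset.mem_Ioc.mp hd).1
    symm
    refine Finset.sum_bij (fun e _ => d * e) ?_ ?_ ?_ ?_
    · intro e he
      rw [Finset.mem_Ioc, Nat.div_lt_iff_lt_mul hd0, Nat.le_div_iff_mul_le hd0] at he
      rw [Finset.mem_filter, Finset.mem_Ioc, mul_comm]
      exact ⟨he, Dvd.intro_left e rfl⟩
    · intro a _ b _ hab
      exact Nat.eq_of_mul_eq_mul_left hd0 hab
    · intro n hn
      rw [Finset.mem_filter, Finset.mem_Ioc] at hn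
      obtain ⟨hn1, e, rfl⟩ := hn
      refine ⟨e, ?_, rfl⟩
      rw [Finset.mem_Ioc, Nat.div_lt_iff_lt_mul hd0, Nat.le_div_iff_mul_le hd0, mul_comm]
      exact hn1
    · intro e _
      push_cast
      rw [div_mul_div_comm, mul_one]
  · intro n d
    simp only [Finset.mem_Ioc, Nat.mem_divisors, Finset.mem_filter]
    constructor
    · rintro ⟨⟨h1, h2⟩, h3, h4⟩
      exact ⟨⟨⟨h1, h2⟩, h3⟩, Nat.pos_of_dvd_of_pos h3 (by omega),
        (Nat.le_of_dvd (by omega) h3).trans h2⟩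
    · rintro ⟨⟨⟨h1, h2⟩, h3⟩, h4, h5⟩
      exact ⟨⟨h1, h2⟩, h3, by omega⟩

theorem rc_harm (y : ℕ) (hy : 1 ≤ y) : ∑ e ∈ Finset.Ioc 0 y, (1 / e : ℝ) ≤ 1 + Real.log y := by
  have h := rc_harm_up 1 one_pos y hy
  rw [← Finset.sum_Ioc_consecutive _ (Nat.zero_le 1) hy]
  simp at h ⊢
  exact h

theorem rc_hyper {c : ℕ → ℝ} (h : RC c) (B : ℝ) (hB : ∀ m n, |∑ d ∈ Finset.Ioc m n, c d| ≤ B)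
    (x y U : ℕ) (hU : 0 < U) (hx : 2 * U ≤ x) (hxy : x ≤ y) :
    |∑ n ∈ Finset.Ioc x y, rcV c n / n - (∑ d ∈ Finset.Ioc 0 U, c d / d) * Real.log (y / x)| ≤
      2 * U / x + B / U * (1 + Real.log y) := by
  have hB0 : 0 ≤ B := (abs_nonneg _).trans (hB 0 0)
  have hU0 : (0:ℝ) < U := by exact_mod_cast hU
  have hx0 : (0:ℝ) < x := by exact_mod_cast (by omega : 0 < x)
  rw [rc_divisor_sum, ← Finset.sum_Ioc_consecutive _ (Nat.zero_le U) (by omega : U ≤ y)]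
  have p1 : |∑ d ∈ Finset.Ioc 0 U, ∑ e ∈ Finset.Ioc (x / d) (y / d), c d / d * (1 / e : ℝ) -
      (∑ d ∈ Finset.Ioc 0 U, c d / d) * Real.log (y / x)| ≤ 2 * U / x := by
    rw [Finset.sum_mul, ← Finset.sum_sub_distrib]
    refine (Finset.abs_sum_le_sum_abs _ _).trans ?_
    have : ∀ d ∈ Finset.Ioc 0 U, |∑ e ∈ Finset.Ioc (x / d) (y / d), c d / d * (1 / e : ℝ) -
        c d / d * Real.log (y / x)| ≤ 2 / x := by
      intro d hd
      rw [Finset.mem_Ioc] at hd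
      have hd0 : (0:ℝ) < d := by exact_mod_cast hd.1
      rw [← Finset.mul_sum, ← mul_sub, abs_mul, abs_div, abs_of_pos hd0]
      have h1 := rc_harm_div x y d hd.1 (by omega) hxy
      have h2 : |c d| ≤ 1 := by rcases h.val d with h | h | h <;> rw [h] <;> norm_num
      calc _ ≤ 1 / (d:ℝ) * (2 * d / x) := by gcongr
        _ = 2 / x := by field_simp
    refine (Finset.sum_le_sum this).trans (le_of_eq ?_)
    simp; ring
  have p2 : |∑ d ∈ Finset.Ioc U y, ∑ e ∈ Finset.Ioc (x / d) (y / d), c d / d * (1 / e : ℝ)| ≤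
      B / U * (1 + Real.log y) := by
    rw [Finset.sum_comm' (t' := Finset.Ioc 0 y) (s' := fun e => Finset.Ioc (max U (x / e)) (y / e))]
    · refine (Finset.abs_sum_le_sum_abs _ _).trans ?_
      have : ∀ e ∈ Finset.Ioc 0 y, |∑ d ∈ Finset.Ioc (max U (x / e)) (y / e), c d / d * (1 / e : ℝ)| ≤
          B / U * (1 / e) := by
        intro e he
        rw [← Finset.sum_mul, abs_mul, abs_of_nonneg (by positivity : (0:ℝ) ≤ 1 / e)]
        refine mul_le_mul_of_nonneg_right ?_ (by positivity)
        have h1 := rc_abel c (fun n => 1 / (n:ℝ)) B (max U (x / e)) (fun n => hB _ n)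
          (fun m _ => by positivity) (fun m hm => by
            have : 0 < m := by omega
            have : (0:ℝ) < m := by exact_mod_cast this
            push_cast
            gcongr
            linarith) (y / e)
        simp only [mul_one_div] at h1
        refine h1.trans ?_
        gcongr
        exact le_max_left _ _
      refine (Finset.sum_le_sum this).trans ?_
      rw [← Finset.mul_sum]
      refine mul_le_mul_of_nonneg_left (rc_harm y (by omega)) (by positivity)
    · intro d e
      simp only [Finset.mem_Ioc, max_lt_iff]
      constructor
      · rintro ⟨⟨h1, h2⟩, h3, h4⟩
        have hd : 0 < d := by omega
        have he : 0 < e := lt_of_le_of_lt (Nat.zero_le _) h3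
        rw [Nat.div_lt_iff_lt_mul hd] at h3
        rw [Nat.le_div_iff_mul_le hd] at h4
        refine ⟨⟨⟨h1, ?_⟩, ?_⟩, he, ?_⟩
        · rw [Nat.div_lt_iff_lt_mul he, mul_comm]; exact h3
        · rw [Nat.le_div_iff_mul_le he, mul_comm]; exact h4
        · exact (Nat.le_mul_of_pos_right e hd).trans h4
      · rintro ⟨⟨⟨h1, h2⟩, h3⟩, he, h4⟩
        have hd : 0 < d := by omega
        rw [Nat.div_lt_iff_lt_mul he] at h2
        rw [Nat.le_div_iff_mul_le he] at h3
        refine ⟨⟨h1, ?_⟩, ?_, ?_⟩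
        · exact (Nat.le_mul_of_pos_right d he).trans h3
        · rw [Nat.div_lt_iff_lt_mul hd, mul_comm]; exact h2
        · rw [Nat.le_div_iff_mul_le hd, mul_comm]; exact h3
  rw [add_sub_right_comm]
  exact (abs_add_le _ _).trans (add_le_add p1 p2)

/-- Trivial bound. -/
theorem rc_triv {c : ℕ → ℝ} (h : RC c) (y : ℕ) (hy : 1 ≤ y) :
    ∑ n ∈ Finset.Ioc 0 y, rcV c n / n ≤ (1 + Real.log y) ^ 2 := by
  rw [rc_divisor_sum, pow_two]
  have hl : 0 ≤ Real.log y := Real.log_natCast_nonneg y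
  have hh := rc_harm y hy
  calc _ ≤ ∑ d ∈ Finset.Ioc 0 y, ∑ e ∈ Finset.Ioc 0 y, (1 / d : ℝ) * (1 / e) := by
        refine Finset.sum_le_sum fun d hd => ?_
        rw [← Finset.mul_sum, ← Finset.mul_sum]
        have h2 : c d ≤ 1 := by rcases h.val d with h | h | h <;> rw [h] <;> norm_num
        have h3 : ∑ e ∈ Finset.Ioc (0 / d) (y / d), (1 / e : ℝ) ≤ ∑ e ∈ Finset.Ioc 0 y, (1 / e : ℝ) := by
          refine Finset.sum_le_sum_of_subset_of_nonneg ?_ (fun _ _ _ => by positivity)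
          refine Finset.Ioc_subset_Ioc (Nat.zero_le _) (Nat.div_le_self _ _)
        have h4 : 0 ≤ ∑ e ∈ Finset.Ioc (0 / d) (y / d), (1 / e : ℝ) :=
          Finset.sum_nonneg fun _ _ => by positivity
        have h5 : c d / d ≤ 1 / d := by gcongr
        exact mul_le_mul h5 h3 h4 (by positivity)
    _ = (∑ d ∈ Finset.Ioc 0 y, (1 / d : ℝ)) * ∑ e ∈ Finset.Ioc 0 y, (1 / e : ℝ) := by
        rw [Finset.sum_mul_sum]
    _ ≤ _ := by
        have : 0 ≤ ∑ e ∈ Finset.Ioc 0 y, (1 / e : ℝ) := Finset.sum_nonneg fun _ _ => by positivity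
        exact mul_le_mul hh hh this (by linarith)


def rcOf {D : ℕ} (χ : DirichletCharacter ℂ D) (n : ℕ) : ℝ := (χ (n : ZMod D)).re

theorem rcOf_eq {D : ℕ} {χ : DirichletCharacter ℂ D} (hr : IsRealChar χ) (n : ℕ) :
    χ (n : ZMod D) = (rcOf χ n : ℂ) := by
  apply Complex.ext
  · simp [rcOf]
  · simpa using hr _

theorem rcOf_rc {D : ℕ} (hD : 1 < D) {χ : DirichletCharacter ℂ D} (hr : IsRealChar χ) :
    RC (rcOf χ) := by
  have : Fact (1 < D) := ⟨hD⟩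
  constructor
  · simp [rcOf, MulChar.map_zero]
  · simp [rcOf]
  · intro m n
    have h := rcOf_eq hr (m * n)
    push_cast at h
    rw [map_mul, rcOf_eq hr, rcOf_eq hr] at h
    exact_mod_cast h.symm
  · intro n
    by_cases hu : IsUnit (n : ZMod D)
    · right
      have h1 := χ.unit_norm_eq_one hu.unit
      rw [IsUnit.unit_spec, rcOf_eq hr, Complex.norm_real, Real.norm_eq_abs] at h1
      exact eq_or_eq_neg_of_abs_eq h1
    · left
      simp [rcOf, MulChar.map_nonunit χ hu]

theorem rcOf_ne_one {D : ℕ} (hD : 1 < D) {χ : DirichletCharacter ℂ D} (hp : χ.IsPrimitive) : χ ≠ 1 := by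
  rintro rfl
  have : NeZero D := ⟨by omega⟩
  unfold DirichletCharacter.IsPrimitive at hp
  rw [DirichletCharacter.conductor_one] at hp
  omega

theorem rc_period {D : ℕ} (hD : 1 < D) {χ : DirichletCharacter ℂ D} (h1 : χ ≠ 1) (m : ℕ) :
    ∑ d ∈ Finset.Ioc m (m + D), rcOf χ d = 0 := by
  have : NeZero D := ⟨by omega⟩
  have inj : Set.InjOn (fun d : ℕ => (d : ZMod D)) (Finset.Ioc m (m + D)) := by
    have aux : ∀ a b : ℕ, a ∈ Finset.Ioc m (m + D) → b ∈ Finset.Ioc m (m + D) → a ≤ b →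
        (a : ZMod D) = b → a = b := by
      intro a b ha hb hab h
      rw [Finset.mem_Ioc] at ha hb
      rw [ZMod.natCast_eq_natCast_iff, Nat.modEq_iff_dvd' hab] at h
      have := Nat.eq_zero_of_dvd_of_lt h (by omega)
      omega
    intro a ha b hb h
    rcases le_total a b with hab | hab
    · exact aux a b ha hb hab h
    · exact (aux b a hb ha hab h.symm).symm
  have h2 : ∑ d ∈ Finset.Ioc m (m + D), χ (d : ZMod D) = ∑ a : ZMod D, χ a := by
    rw [← Finset.sum_image (f := fun a => χ a) inj]
    congr 1
    apply Finset.eq_univ_of_card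
    rw [Finset.card_image_of_injOn inj, ZMod.card]
    simp
  rw [MulChar.sum_eq_zero_of_ne_one h1] at h2
  have h3 := congrArg Complex.re h2
  rw [Complex.re_sum] at h3
  exact h3

theorem rc_bound {D : ℕ} (hD : 1 < D) {χ : DirichletCharacter ℂ D} (h1 : χ ≠ 1) (m n : ℕ) :
    |∑ d ∈ Finset.Ioc m n, rcOf χ d| ≤ D := by
  obtain ⟨k, hk⟩ : ∃ k, k = n - m := ⟨_, rfl⟩
  induction k using Nat.strong_induction_on generalizing m with
  | _ k ih =>
    rcases le_or_gt (m + D) n with h | h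
    · rw [← Finset.sum_Ioc_consecutive _ (by omega : m ≤ m + D) h, rc_period hD h1, zero_add]
      exact ih (n - (m + D)) (by omega) (m + D) rfl
    · refine (Finset.abs_sum_le_sum_abs _ _).trans ?_
      have : ∀ d ∈ Finset.Ioc m n, |rcOf χ d| ≤ 1 := fun d _ =>
        (Complex.abs_re_le_norm _).trans (χ.norm_le_one _)
      refine (Finset.sum_le_sum this).trans ?_
      simp only [Finset.sum_const, Nat.card_Ioc, nsmul_eq_mul, mul_one]
      exact_mod_cast (by omega : n - m ≤ D)

theorem rc_L_gt {D : ℕ} (hD : 1 < D) {χ : DirichletCharacter ℂ D} (h1 : χ ≠ 1)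
    (U : ℕ) (hU : 0 < U) (s : ℝ) (hs : 1 < s) :
    |(Lfun χ (s : ℂ)).re - ∑ d ∈ Finset.Ioc 0 U, rcOf χ d * (d:ℝ) ^ (-s)| ≤ D / U := by
  have : NeZero D := ⟨by omega⟩
  have hU1 : (1:ℝ) ≤ U := by exact_mod_cast hU
  have hL : Lfun χ (s : ℂ) = LSeries (fun n => χ n) s := by
    unfold Lfun
    rw [dif_neg (by omega)]
    exact DirichletCharacter.LFunction_eq_LSeries χ (by simpa using hs)
  have hsum : LSeriesSummable (fun n => χ n) (s : ℂ) :=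
    ZMod.LSeriesSummable_of_one_lt_re χ (by simpa using hs)
  have hH := hsum.LSeriesHasSum
  rw [LSeriesHasSum] at hH
  have hR := (Complex.reCLM.hasSum hH).tendsto_sum_nat
  rw [← Filter.tendsto_add_atTop_iff_nat 1] at hR
  have hterm : ∀ n : ℕ, (Complex.reCLM (LSeries.term (fun n => χ n) s n)) =
      if n = 0 then 0 else rcOf χ n * (n:ℝ) ^ (-s) := by
    intro n
    by_cases hn : n = 0
    · simp [hn]
    · rw [LSeries.term_of_ne_zero hn, if_neg hn]
      have : ((n : ℂ) ^ (s : ℂ)) = (((n : ℝ) ^ s : ℝ) : ℂ) := by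
        rw [Complex.ofReal_cpow (by positivity)]; simp
      rw [this]
      simp only [Complex.reCLM_apply, Complex.div_ofReal_re, rcOf]
      rw [Real.rpow_neg (by positivity), div_eq_mul_inv]
  have hpart : ∀ V, ∑ n ∈ Finset.range (V + 1), (Complex.reCLM (LSeries.term (fun n => χ n) s n)) =
      ∑ d ∈ Finset.Ioc 0 V, rcOf χ d * (d:ℝ) ^ (-s) := by
    intro V
    rw [Finset.sum_range_succ', hterm 0, if_pos rfl, add_zero]
    rw [Finset.sum_congr rfl fun n _ => by rw [hterm (n + 1), if_neg (by omega)]]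
    rw [Finset.range_eq_Ico, Finset.sum_Ico_add' (fun d : ℕ => rcOf χ d * (d:ℝ) ^ (-s)) 0 V 1]
    rfl
  simp only [hpart] at hR
  rw [hL]
  have hlim := ((hR.sub_const (∑ d ∈ Finset.Ioc 0 U, rcOf χ d * (d:ℝ) ^ (-s))).abs)
  refine le_of_tendsto hlim ?_
  filter_upwards [Filter.eventually_ge_atTop U] with V hV
  rw [← Finset.sum_Ioc_consecutive _ (Nat.zero_le U) hV, add_sub_cancel_left]
  have hab := rc_abel (rcOf χ) (fun n => (n:ℝ) ^ (-s)) D U (fun n => rc_bound hD h1 U n)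
    (fun m _ => by positivity) (fun m hm => by
      have : (0:ℝ) < m := by exact_mod_cast (by omega : 0 < m)
      exact Real.rpow_le_rpow_of_nonpos this (by push_cast; linarith) (by linarith)) V
  refine hab.trans ?_
  rw [div_eq_mul_inv]
  refine mul_le_mul_of_nonneg_left ?_ (by positivity)
  rw [← Real.rpow_neg_one]
  exact Real.rpow_le_rpow_of_exponent_le hU1 (by linarith)

theorem rc_L {D : ℕ} (hD : 1 < D) {χ : DirichletCharacter ℂ D} (h1 : χ ≠ 1)
    (U : ℕ) (hU : 0 < U) :
    |(Lfun χ 1).re - ∑ d ∈ Finset.Ioc 0 U, rcOf χ d / d| ≤ D / U := by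
  have : NeZero D := ⟨by omega⟩
  have hc : Continuous fun s : ℝ => (Lfun χ (s : ℂ)).re := by
    have h2 := (DirichletCharacter.differentiable_LFunction h1).continuous
    have e : (fun s : ℝ => (Lfun χ (s : ℂ)).re) =
      fun s : ℝ => (DirichletCharacter.LFunction χ (s : ℂ)).re := by
      ext s
      unfold Lfun
      rw [dif_neg (by omega)]
    rw [e]
    exact Complex.continuous_re.comp (h2.comp Complex.continuous_ofReal)
  have hc2 : Filter.Tendsto (fun s : ℝ => ∑ d ∈ Finset.Ioc 0 U, rcOf χ d * (d:ℝ) ^ (-s)) (nhds 1)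
      (nhds (∑ d ∈ Finset.Ioc 0 U, rcOf χ d / d)) := by
    apply tendsto_finsetSum
    intro d hd
    have hd0 : (0:ℝ) < d := by exact_mod_cast (Finset.mem_Ioc.mp hd).1
    have h3 : ContinuousAt (fun s : ℝ => rcOf χ d * (d:ℝ) ^ (-s)) 1 := by
      refine ContinuousAt.mul continuousAt_const ?_
      exact ContinuousAt.rpow continuousAt_const (continuous_neg.continuousAt) (Or.inl hd0.ne')
    have h4 := h3.tendsto
    rw [Real.rpow_neg_one, ← div_eq_mul_inv] at h4
    exact h4
  have hl := ((hc.tendsto 1).sub hc2).abs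
  have hl2 := hl.mono_left (nhdsWithin_le_nhds (s := Set.Ioi 1))
  have := le_of_tendsto hl2 (b := (D:ℝ) / U) (by
    filter_upwards [self_mem_nhdsWithin] with s hs
    exact rc_L_gt hD h1 U hU s hs)
  simpa using this

theorem nuF_eq {D : ℕ} {χ : DirichletCharacter ℂ D} (hr : IsRealChar χ) (n : ℕ) :
    nuF D χ n = (rcV (rcOf χ) n : ℂ) := by
  unfold nuF rcV
  push_cast
  exact Finset.sum_congr rfl fun d _ => rcOf_eq hr d


theorem rc_S_core {D : ℕ} (hD : 16 ≤ D) {χ : DirichletCharacter ℂ D} (hr : IsRealChar χ)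
    (hp : χ.IsPrimitive) (hA : AssumptionA D χ) (hy : 1 ≤ bigL D)
    (he : 2 * bigL D ^ 2022 ≤ Real.exp (bigL D / 2)) :
    ∑ n ∈ Finset.Ioc (D ^ 4) ⌊bigP D ^ 2⌋₊, rcV (rcOf χ) n ^ 2 / n ≤
      324 * bigL D ^ (-2011 : ℤ) := by
  have hD1 : 1 < D := by omega
  have h1 := rcOf_ne_one hD1 hp
  have rc := rcOf_rc hD1 hr
  set y := bigL D with hydef
  set e : ℝ := y ^ (-2022 : ℤ) with hedef
  have hy0 : 0 < y := by linarith
  have he0 : 0 < e := by positivity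
  have hey : e * y ^ 9 ≤ 1 := by
    rw [hedef, zpow_neg, inv_mul_le_iff₀ (by positivity), mul_one]
    exact pow_le_pow_right₀ hy (by norm_num)
  have hDR : (0:ℝ) < D := by exact_mod_cast (by omega : 0 < D)
  have hexp : Real.exp y = D := Real.exp_log hDR
  set q := Nat.sqrt D with hq
  have hq4 : 4 ≤ q := by rw [hq, Nat.le_sqrt]; omega
  have hqq : q * q ≤ D := Nat.sqrt_le D
  have hq2 : D < (q + 1) * (q + 1) := Nat.sqrt_lt.mp (Nat.lt_succ_self _)
  have hq0 : (0:ℝ) < q := by exact_mod_cast (by omega : 0 < q)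
  have hqe : Real.exp (y / 2) < 2 * q := by
    have h2 : Real.exp (y / 2) ^ 2 = D := by
      rw [← Real.exp_nat_mul, ← hexp]; congr 1; push_cast; ring
    have h3 : (D:ℝ) < (2 * q) ^ 2 := by
      have : D < (2 * q) ^ 2 := by nlinarith
      exact_mod_cast this
    rw [← h2] at h3
    exact lt_of_pow_lt_pow_left₀ 2 (by positivity) h3
  have hqr : 1 / (q:ℝ) ≤ e := by
    rw [hedef, zpow_neg, one_div]
    apply inv_anti₀ (by positivity)
    have : y ^ (2022 : ℤ) = y ^ 2022 := by norm_cast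
    rw [this]
    linarith
  set U := D * q with hU
  have hU0 : 0 < U := by positivity
  have hDU : (D:ℝ) / U = 1 / q := by
    rw [hU]; push_cast; field_simp
  have hUx : 2 * (U:ℝ) / (D ^ 2 : ℕ) ≤ 2 * (1 / q) := by
    rw [hU]; push_cast
    have : (q:ℝ) * q ≤ D := by exact_mod_cast hqq
    rw [mul_one_div, div_le_div_iff₀ (by positivity) hq0]
    nlinarith
  have h2U : 2 * U ≤ D ^ 2 := by rw [hU, pow_two]; nlinarith
  set Y := ⌊bigP D ^ 2⌋₊ with hY
  have hP2 : bigP D ^ 2 = Real.exp (2 * y ^ 9) := by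
    unfold bigP; rw [← Real.exp_nat_mul]; push_cast; rfl
  have hD2Y : D ^ 2 ≤ Y := by
    apply Nat.le_floor
    rw [hP2]; push_cast
    rw [← hexp, ← Real.exp_nat_mul]
    apply Real.exp_le_exp.mpr
    push_cast
    have : y ≤ y ^ 9 := le_self_pow₀ hy (by norm_num)
    linarith
  have hD20 : (0:ℝ) < (D ^ 2 : ℕ) := by positivity
  have hD2Y' : ((D ^ 2 : ℕ) : ℝ) ≤ Y := by exact_mod_cast hD2Y
  have hY0 : (0:ℝ) < Y := lt_of_lt_of_le hD20 hD2Y'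
  have hlogY : Real.log Y ≤ 2 * y ^ 9 := by
    rw [Real.log_le_iff_le_exp hY0, ← hP2]
    exact Nat.floor_le (by positivity)
  have hlogD2 : Real.log (D ^ 2 : ℕ) = 2 * y := by
    push_cast
    rw [Real.log_pow]; push_cast; rfl
  have hlr0 : 0 ≤ Real.log (Y / (D ^ 2 : ℕ)) := Real.log_nonneg ((one_le_div hD20).mpr hD2Y')
  have hlr : Real.log (Y / (D ^ 2 : ℕ)) ≤ 2 * y ^ 9 := by
    rw [Real.log_div hY0.ne' hD20.ne', hlogD2]; linarith
  have hyp := (abs_le.mp (rc_hyper rc D (rc_bound hD1 h1) (D ^ 2) Y U hU0 h2U hD2Y)).2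
  have hL := (abs_le.mp (rc_L hD1 h1 U hU0)).1
  have hA' : (Lfun χ 1).re < e := hA
  rw [hDU] at hyp hL
  set W := ∑ n ∈ Finset.Ioc (D ^ 2) Y, rcV (rcOf χ) n / n with hW
  set A := ∑ d ∈ Finset.Ioc 0 U, rcOf χ d / d with hAdef
  have hA2 : A ≤ 2 * e := by linarith
  have hy9 : 1 ≤ y ^ 9 := one_le_pow₀ hy
  have hW1 : W ≤ 9 * (e * y ^ 9) := by
    have t1 : A * Real.log (Y / (D ^ 2 : ℕ)) ≤ 2 * e * (2 * y ^ 9) :=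
      (mul_le_mul_of_nonneg_right hA2 hlr0).trans (mul_le_mul_of_nonneg_left hlr (by positivity))
    have t2 : 1 / (q:ℝ) * (1 + Real.log Y) ≤ e * (1 + 2 * y ^ 9) := by
      have : 0 ≤ Real.log Y := Real.log_natCast_nonneg _
      gcongr
    have t3 : e ≤ e * y ^ 9 := le_mul_of_one_le_right he0.le hy9
    linarith
  have hW0 : 0 ≤ W := Finset.sum_nonneg fun n _ => div_nonneg (rcV_nonneg rc n) (Nat.cast_nonneg n)
  have hT : ∑ n ∈ Finset.Ioc 0 Y, rcV (rcOf χ) n / n ≤ 18 * y ^ 2 := by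
    rw [← Finset.sum_Ioc_consecutive _ (Nat.zero_le (D ^ 2)) hD2Y]
    have t := rc_triv rc (D ^ 2) (Nat.one_le_pow _ _ (by omega))
    rw [hlogD2] at t
    have : (1 + 2 * y) ^ 2 ≤ 9 * y ^ 2 := by nlinarith
    have : 1 ≤ y ^ 2 := one_le_pow₀ hy
    linarith
  have hT0 : 0 ≤ ∑ n ∈ Finset.Ioc 0 Y, rcV (rcOf χ) n / n :=
    Finset.sum_nonneg fun n _ => div_nonneg (rcV_nonneg rc n) (Nat.cast_nonneg n)
  have hS := rcV_S rc (D ^ 2) Y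
  rw [← pow_mul] at hS
  refine hS.trans ?_
  calc 2 * W * ∑ n ∈ Finset.Ioc 0 Y, rcV (rcOf χ) n / n ≤ 2 * (9 * (e * y ^ 9)) * (18 * y ^ 2) := by
        gcongr
    _ = 324 * (e * y ^ (11 : ℤ)) := by
        have : y ^ (11 : ℤ) = y ^ 11 := by norm_cast
        rw [this]; ring
    _ = _ := by
        rw [hedef, ← zpow_add₀ hy0.ne']; norm_num

theorem rc_S : ∀ᶠ D : ℕ in Filter.atTop, ∀ χ : DirichletCharacter ℂ D, IsRealChar χ → χ.IsPrimitive →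
    AssumptionA D χ →
    ∑ n ∈ Finset.Ioc (D ^ 4) ⌊bigP D ^ 2⌋₊, rcV (rcOf χ) n ^ 2 / n ≤
      324 * bigL D ^ (-2011 : ℤ) := by
  have hev : ∀ᶠ y : ℝ in Filter.atTop, 2 * y ^ 2022 ≤ Real.exp (y / 2) := by
    have h := (Real.tendsto_exp_div_pow_atTop 2022).eventually_ge_atTop (2 * 2 ^ 2022)
    have h2 := (Filter.tendsto_id.atTop_div_const (show (0:ℝ) < 2 by norm_num)).eventually h
    filter_upwards [h2, Filter.eventually_gt_atTop 0] with y hy hy0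
    simp only [id] at hy
    rw [le_div_iff₀ (by positivity), div_pow] at hy
    have : (2:ℝ) * 2 ^ 2022 * (y ^ 2022 / 2 ^ 2022) = 2 * y ^ 2022 := by
      rw [mul_assoc, mul_div_cancel₀]
      positivity
    rw [this] at hy
    exact hy
  filter_upwards [tendsto_bigL.eventually hev, tendsto_bigL.eventually_ge_atTop 1,
    Filter.eventually_ge_atTop 16] with D h1 h2 h3 χ hr hp hA
  exact rc_S_core h3 hr hp hA h2 h1


theorem ls_norm_gauss {p : ℕ} [Fact p.Prime] (ψ : DirichletCharacter ℂ p) (hψ : ψ ≠ 1) :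
    ‖gaussSum ψ (ZMod.stdAddChar (N := p))‖ ^ 2 = p := by
  have h := gaussSum_mul_gaussSum_eq_card hψ (ZMod.isPrimitive_stdAddChar p)
  rw [← star_gaussSum_eq] at h
  have h2 : ((‖gaussSum ψ (ZMod.stdAddChar (N := p))‖ ^ 2 : ℝ) : ℂ) = (p : ℂ) := by
    rw [ZMod.card p] at h
    rw [← h]
    push_cast
    rw [← Complex.mul_conj']
    rfl
  exact_mod_cast h2

theorem ls_expand {p : ℕ} [Fact p.Prime] (ψ : DirichletCharacter ℂ p) (hψ : ψ.IsPrimitive)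
    (s : Finset ℕ) (a : ℕ → ℂ) :
    gaussSum ψ⁻¹ (ZMod.stdAddChar (N := p)) * ∑ n ∈ s, a n * ψ n =
      ∑ b : ZMod p, ψ⁻¹ b * ∑ n ∈ s, a n * ZMod.stdAddChar (N := p) (b * n) := by
  have hp : (ψ⁻¹).IsPrimitive := by
    have := hψ
    unfold DirichletCharacter.IsPrimitive at *
    rw [DirichletCharacter.conductor_inv]
    exact this
  rw [Finset.mul_sum]
  have : ∀ n ∈ s, gaussSum ψ⁻¹ (ZMod.stdAddChar (N := p)) * (a n * ψ n) =
      ∑ b : ZMod p, a n * (ψ⁻¹ b * ZMod.stdAddChar (N := p) (b * n)) := by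
    intro n _
    have h := gaussSum_mulShift_of_isPrimitive (ZMod.stdAddChar (N := p)) hp (n : ZMod p)
    rw [inv_inv] at h
    rw [← Finset.mul_sum]
    have h3 : gaussSum ψ⁻¹ ((ZMod.stdAddChar (N := p)).mulShift (n : ZMod p)) =
      ∑ b : ZMod p, ψ⁻¹ b * ZMod.stdAddChar (N := p) (b * n) := by
      unfold gaussSum
      refine Finset.sum_congr rfl fun b _ => ?_
      rw [AddChar.mulShift_apply, mul_comm b]
    rw [← h3, h]; ring
  rw [Finset.sum_congr rfl this, Finset.sum_comm]
  refine Finset.sum_congr rfl fun b _ => ?_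
  rw [Finset.mul_sum]
  refine Finset.sum_congr rfl fun n _ => ?_
  ring

/-- Orthogonality of characters. -/
theorem ls_orth {p : ℕ} [Fact p.Prime] (F : ZMod p → ℂ) :
    ∑ ψ : DirichletCharacter ℂ p, ‖∑ b : ZMod p, ψ⁻¹ b * F b‖ ^ 2 ≤
      (p : ℝ) * ∑ b ∈ (Finset.univ.filter fun b : ZMod p => b ≠ 0), ‖F b‖ ^ 2 := by
  have key : ((∑ ψ : DirichletCharacter ℂ p, ‖∑ b : ZMod p, ψ⁻¹ b * F b‖ ^ 2 : ℝ) : ℂ) =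
      (((p.totient : ℝ) * ∑ b ∈ (Finset.univ.filter fun b : ZMod p => b ≠ 0), ‖F b‖ ^ 2 : ℝ) : ℂ) := by
    push_cast
    have e1 : ∀ ψ : DirichletCharacter ℂ p, (‖∑ b : ZMod p, ψ⁻¹ b * F b‖ : ℂ) ^ 2 =
        ∑ b : ZMod p, ∑ c : ZMod p, (F b * star (F c)) * (ψ⁻¹ b * ψ c) := by
      intro ψ
      rw [← Complex.mul_conj', map_sum, Finset.sum_mul_sum]
      refine Finset.sum_congr rfl fun b _ => Finset.sum_congr rfl fun c _ => ?_
      rw [map_mul]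
      have : (starRingEnd ℂ) (ψ⁻¹ c) = ψ c := by
        rw [← MulChar.star_apply']
        simp
      rw [this]
      simp only [Complex.star_def]
      ring
    rw [Finset.sum_congr rfl fun ψ _ => e1 ψ, Finset.sum_comm, Finset.mul_sum, Finset.sum_filter]
    refine Finset.sum_congr rfl fun b _ => ?_
    split_ifs with hb
    · rw [Finset.sum_comm]
      simp_rw [← Finset.mul_sum]
      have hu : IsUnit b := isUnit_iff_ne_zero.mpr hb
      have := fun c => DirichletCharacter.sum_char_inv_mul_char_eq ℂ hu c
      have e2 : ∀ (ψ : DirichletCharacter ℂ p), ψ⁻¹ b = ψ b⁻¹ := by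
        intro ψ
        exact MulChar.inv_apply' ψ b
      simp_rw [e2, this]
      simp only [mul_ite, mul_zero, Finset.sum_ite_eq, Finset.mem_univ, if_true]
      rw [Complex.star_def, Complex.mul_conj']
      ring
    · push Not at hb
      subst hb
      have e3 : ∀ ψ : DirichletCharacter ℂ p, ψ⁻¹ 0 = 0 := fun ψ => MulChar.map_zero ψ⁻¹
      simp [e3]
  have key' : (∑ ψ : DirichletCharacter ℂ p, ‖∑ b : ZMod p, ψ⁻¹ b * F b‖ ^ 2 : ℝ) =
      (((p.totient : ℝ) * ∑ b ∈ (Finset.univ.filter fun b : ZMod p => b ≠ 0), ‖F b‖ ^ 2 : ℝ)) := by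
    exact_mod_cast key
  rw [key']
  gcongr
  exact Nat.totient_le p

theorem ls_mult {p : ℕ} [Fact p.Prime] (s : Finset ℕ) (a : ℕ → ℂ) :
    ∑ ψ ∈ (Finset.univ.filter fun ψ : DirichletCharacter ℂ p => ψ.IsPrimitive),
      ‖∑ n ∈ s, a n * ψ n‖ ^ 2 ≤
    ∑ b ∈ (Finset.univ.filter fun b : ZMod p => b ≠ 0),
      ‖∑ n ∈ s, a n * ZMod.stdAddChar (N := p) (b * n)‖ ^ 2 := by
  have hp0 : (0 : ℝ) < p := by exact_mod_cast (Fact.out : p.Prime).pos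
  have h := ls_orth (p := p) (fun b => ∑ n ∈ s, a n * ZMod.stdAddChar (N := p) (b * n))
  refine le_of_mul_le_mul_left ?_ hp0
  refine le_trans ?_ h
  rw [Finset.mul_sum]
  refine le_trans (le_of_eq ?_) (Finset.sum_le_sum_of_subset_of_nonneg
    (Finset.filter_subset (fun ψ : DirichletCharacter ℂ p => ψ.IsPrimitive) Finset.univ)
    (fun _ _ _ => by positivity))
  refine Finset.sum_congr rfl fun ψ hψ => ?_
  have hψ' := (Finset.mem_filter.mp hψ).2
  rw [← ls_expand ψ hψ', norm_mul, mul_pow, ls_norm_gauss]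
  intro h1
  have h2 : ψ = 1 := inv_eq_one.mp h1
  subst h2
  unfold DirichletCharacter.IsPrimitive at hψ'
  rw [DirichletCharacter.conductor_one] at hψ'
  exact (Fact.out : p.Prime).one_lt.ne hψ'


def lsF (s : Finset ℕ) (a : ℕ → ℂ) (t : ℝ) : ℂ :=
  ∑ n ∈ s, a n * Complex.exp (2 * Real.pi * Complex.I * n * t)

theorem lsF_deriv (s : Finset ℕ) (a : ℕ → ℂ) (t : ℝ) :
    HasDerivAt (lsF s a) (lsF s (fun n => 2 * Real.pi * Complex.I * n * a n) t) t := by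
  unfold lsF
  apply HasDerivAt.fun_sum
  intro n _
  have h1 : HasDerivAt (fun t : ℝ => (2 * Real.pi * Complex.I * n * t : ℂ))
      (2 * Real.pi * Complex.I * n) t := by
    simpa using (Complex.ofRealCLM.hasDerivAt (x := t)).const_mul (2 * Real.pi * Complex.I * n : ℂ)
  have h2 := (h1.cexp).const_mul (a n)
  refine h2.congr_deriv ?_
  ring

theorem lsF_cont (s : Finset ℕ) (a : ℕ → ℂ) : Continuous (lsF s a) :=
  continuous_iff_continuousAt.mpr fun t => (lsF_deriv s a t).continuousAt

theorem ls_int_exp (k : ℤ) :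
    ∫ t in (0:ℝ)..1, Complex.exp (2 * Real.pi * Complex.I * k * t) = if k = 0 then 1 else 0 := by
  split_ifs with h
  · subst h; simp
  · have hc : (2 * Real.pi * Complex.I * k : ℂ) ≠ 0 := by
      have : (k : ℂ) ≠ 0 := by exact_mod_cast h
      have h2 := Complex.two_pi_I_ne_zero
      positivity
    rw [integral_exp_mul_complex hc]
    have : Complex.exp (2 * Real.pi * Complex.I * k * (1:ℝ)) = 1 := by
      rw [Complex.exp_eq_one_iff]
      exact ⟨k, by push_cast; ring⟩
    rw [this]; simp

theorem ls_parseval (s : Finset ℕ) (a : ℕ → ℂ) :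
    ∫ t in (0:ℝ)..1, ‖lsF s a t‖ ^ 2 = ∑ n ∈ s, ‖a n‖ ^ 2 := by
  have key : ((∫ t in (0:ℝ)..1, ‖lsF s a t‖ ^ 2 : ℝ) : ℂ) = ((∑ n ∈ s, ‖a n‖ ^ 2 : ℝ) : ℂ) := by
    rw [← intervalIntegral.integral_ofReal]
    have e1 : ∀ t : ℝ, ((‖lsF s a t‖ ^ 2 : ℝ) : ℂ) =
        ∑ n ∈ s, ∑ m ∈ s, (a n * (starRingEnd ℂ) (a m)) *
          Complex.exp (2 * Real.pi * Complex.I * ((n - m : ℤ) : ℂ) * t) := by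
      intro t
      push_cast
      rw [← Complex.mul_conj']
      unfold lsF
      rw [map_sum, Finset.sum_mul_sum]
      refine Finset.sum_congr rfl fun n _ => Finset.sum_congr rfl fun m _ => ?_
      rw [map_mul, ← Complex.exp_conj]
      simp only [map_mul, Complex.conj_I, Complex.conj_ofReal, map_natCast, map_ofNat]
      rw [show a n * Complex.exp (2 * Real.pi * Complex.I * n * t) *
        ((starRingEnd ℂ) (a m) * Complex.exp (2 * Real.pi * -Complex.I * m * t)) =
        a n * (starRingEnd ℂ) (a m) * (Complex.exp (2 * Real.pi * Complex.I * n * t) *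
          Complex.exp (2 * Real.pi * -Complex.I * m * t)) by ring, ← Complex.exp_add]
      congr 2
      ring
    simp_rw [e1]
    rw [intervalIntegral.integral_finsetSum]
    · push_cast
      refine Finset.sum_congr rfl fun n hn => ?_
      rw [intervalIntegral.integral_finsetSum]
      · have e2 : ∀ m ∈ s, ∫ t in (0:ℝ)..1, (a n * (starRingEnd ℂ) (a m)) *
          Complex.exp (2 * Real.pi * Complex.I * ((n - m : ℤ) : ℂ) * t) =
          if n = m then (‖a n‖ : ℂ) ^ 2 else 0 := by
          intro m _
          rw [intervalIntegral.integral_const_mul, ls_int_exp]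
          by_cases h : n = m
          · subst h
            simp [Complex.mul_conj']
          · have : ((n : ℤ) - m) ≠ 0 := by omega
            simp [h, this]
        have e3 := Finset.sum_congr rfl e2
        push_cast at e3 ⊢
        rw [e3]
        simp [hn]
      · intro m _
        apply Continuous.intervalIntegrable
        fun_prop
    · intro n _
      apply Continuous.intervalIntegrable
      fun_prop
  exact_mod_cast key

/-- Gallagher-type inequality. -/
theorem ls_gallagher (s : Finset ℕ) (a : ℕ → ℂ) (α δ N : ℝ) (hδ : 0 < δ) (hN : 0 < N) :
    ‖lsF s a α‖ ^ 2 ≤ ∫ t in Set.Ioc (α - δ / 2) (α + δ / 2),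
      ((1 / δ + N) * ‖lsF s a t‖ ^ 2 +
        (1 / N) * ‖lsF s (fun n => 2 * Real.pi * Complex.I * n * a n) t‖ ^ 2) := by
  set g := lsF s (fun n => 2 * Real.pi * Complex.I * n * a n) with hg
  have cf := lsF_cont s a
  have cg : Continuous g := lsF_cont s _
  set k : ℝ → ℝ := fun t => N * ‖lsF s a t‖ ^ 2 + (1 / N) * ‖g t‖ ^ 2 with hk
  have ck : Continuous k := by fun_prop
  have kn : ∀ t, 0 ≤ k t := fun t => by positivity
  have le1 : α - δ / 2 ≤ α + δ / 2 := by linarith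
  -- derivative
  have hd : ∀ t, HasDerivAt (fun t => ‖lsF s a t‖ ^ 2) (2 * inner ℝ (lsF s a t) (g t)) t := by
    intro t
    exact (lsF_deriv s a t).norm_sq
  have hdb : ∀ t, |2 * inner ℝ (lsF s a t) (g t)| ≤ k t := by
    intro t
    have h1 := abs_real_inner_le_norm (lsF s a t) (g t)
    rw [abs_mul, abs_two]
    refine (mul_le_mul_of_nonneg_left h1 zero_le_two).trans ?_
    have h2 : 0 ≤ (1/N) * (N * ‖lsF s a t‖ - ‖g t‖) ^ 2 := by positivity
    have h3 : (1/N) * (N * ‖lsF s a t‖ - ‖g t‖) ^ 2 =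
      k t - 2 * (‖lsF s a t‖ * ‖g t‖) := by
      simp only [hk]; field_simp; ring
    linarith
  have cd : Continuous fun t => 2 * inner ℝ (lsF s a t) (g t) := by fun_prop
  have hpt : ∀ t ∈ Set.Icc (α - δ / 2) (α + δ / 2),
      ‖lsF s a α‖ ^ 2 ≤ ‖lsF s a t‖ ^ 2 + ∫ u in (α - δ / 2)..(α + δ / 2), k u := by
    intro t ht
    have h1 := intervalIntegral.integral_eq_sub_of_hasDerivAt (a := t) (b := α)
      (fun u _ => hd u) (cd.intervalIntegrable _ _)
    have h2 : |∫ u in t..α, 2 * inner ℝ (lsF s a u) (g u)| ≤ |∫ u in t..α, k u| := by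
      rw [← Real.norm_eq_abs]
      refine intervalIntegral.norm_integral_le_abs_of_norm_le ?_ (ck.intervalIntegrable _ _)
      exact Filter.Eventually.of_forall fun u => by
        rw [Real.norm_eq_abs]; exact hdb u
    have h3 : |∫ u in t..α, k u| ≤ ∫ u in (α - δ / 2)..(α + δ / 2), k u := by
      refine le_trans (intervalIntegral.abs_integral_mono_interval (c := α - δ/2) (d := α + δ/2) ?_ ?_
        (ck.intervalIntegrable _ _)) (le_of_eq ?_)
      · intro u hu
        rw [Set.mem_uIoc] at *
        obtain ⟨h1, h2⟩ := ht
        rcases hu with hu | hu <;> left <;> constructor <;> linarith [hu.1, hu.2]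
      · exact Filter.Eventually.of_forall kn
      · exact abs_of_nonneg (intervalIntegral.integral_nonneg le1 fun u _ => kn u)
    have := le_abs_self (∫ u in t..α, 2 * inner ℝ (lsF s a u) (g u))
    linarith
  have h4 := intervalIntegral.integral_mono_on (μ := MeasureTheory.volume) le1
    (f := fun _ => ‖lsF s a α‖ ^ 2)
    (g := fun t => ‖lsF s a t‖ ^ 2 + ∫ u in (α - δ / 2)..(α + δ / 2), k u)
    (by simp) (by apply Continuous.intervalIntegrable; fun_prop) hpt
  rw [intervalIntegral.integral_const, intervalIntegral.integral_add
    (by apply Continuous.intervalIntegrable; fun_prop) (by simp),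
    intervalIntegral.integral_const, show α + δ / 2 - (α - δ / 2) = δ by ring] at h4
  simp only [smul_eq_mul] at h4
  rw [← intervalIntegral.integral_of_le le1]
  have h5 : ∫ t in (α - δ / 2)..(α + δ / 2), ((1 / δ + N) * ‖lsF s a t‖ ^ 2 + (1 / N) * ‖g t‖ ^ 2) =
     (1/δ) * (∫ t in (α - δ / 2)..(α + δ / 2), ‖lsF s a t‖ ^ 2) +
      ∫ t in (α - δ / 2)..(α + δ / 2), k t := by
    rw [← intervalIntegral.integral_const_mul, ← intervalIntegral.integral_add]
    · congr 1; ext t; simp only [hk]; ring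
    · apply Continuous.intervalIntegrable; fun_prop
    · exact ck.intervalIntegrable _ _
  rw [h5]
  have h6 := mul_le_mul_of_nonneg_left h4 (by positivity : 0 ≤ 1 / δ)
  rw [mul_add, ← mul_assoc, ← mul_assoc, one_div_mul_cancel hδ.ne', one_mul, one_mul] at h6
  exact h6

/-- Large sieve for well-spaced points. -/
theorem ls_points {ι : Type*} (A : Finset ι) (x : ι → ℝ) (s : Finset ℕ) (a : ℕ → ℂ) (δ N : ℝ)
    (hδ : 0 < δ) (hN : 0 < N) (hs : ∀ n ∈ s, (n : ℝ) ≤ N)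
    (h0 : ∀ i ∈ A, δ / 2 ≤ x i) (h1 : ∀ i ∈ A, x i ≤ 1 - δ / 2)
    (hsep : ∀ i ∈ A, ∀ j ∈ A, i ≠ j → δ ≤ |x i - x j|) :
    ∑ i ∈ A, ‖lsF s a (x i)‖ ^ 2 ≤ (1 / δ + 41 * N) * ∑ n ∈ s, ‖a n‖ ^ 2 := by
  set g := lsF s (fun n => 2 * Real.pi * Complex.I * n * a n) with hg
  have cf := lsF_cont s a
  have cg : Continuous g := lsF_cont s _
  set h : ℝ → ℝ := fun t => (1 / δ + N) * ‖lsF s a t‖ ^ 2 + (1 / N) * ‖g t‖ ^ 2 with hh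
  have ch : Continuous h := by fun_prop
  have hn : ∀ t, 0 ≤ h t := fun t => by positivity
  have step1 : ∑ i ∈ A, ‖lsF s a (x i)‖ ^ 2 ≤
      ∑ i ∈ A, ∫ t in Set.Ioc (x i - δ / 2) (x i + δ / 2), h t :=
    Finset.sum_le_sum fun i _ => ls_gallagher s a (x i) δ N hδ hN
  have step2 : ∑ i ∈ A, ∫ t in Set.Ioc (x i - δ / 2) (x i + δ / 2), h t =
      ∫ t in ⋃ i ∈ A, Set.Ioc (x i - δ / 2) (x i + δ / 2), h t := by
    rw [MeasureTheory.integral_biUnion_finset]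
    · intro i _; exact measurableSet_Ioc
    · intro i hi j hj hij
      rw [Function.onFun, Set.disjoint_left]
      rintro t ⟨ht1, ht2⟩ ⟨ht3, ht4⟩
      have := hsep i hi j hj hij
      have h3 : |x i - x j| < δ := by rw [abs_lt]; constructor <;> linarith
      linarith
    · intro i _
      exact ch.integrableOn_Ioc
  have step3 : ∫ t in ⋃ i ∈ A, Set.Ioc (x i - δ / 2) (x i + δ / 2), h t ≤
      ∫ t in Set.Ioc (0:ℝ) 1, h t := by
    refine MeasureTheory.setIntegral_mono_set ch.integrableOn_Ioc
      (Filter.Eventually.of_forall hn) (LE.le.eventuallyLE ?_)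
    intro t ht
    simp only [Set.mem_iUnion] at ht
    obtain ⟨i, hi, ht1, ht2⟩ := ht
    have := h0 i hi
    have := h1 i hi
    constructor <;> linarith
  have step4 : ∫ t in Set.Ioc (0:ℝ) 1, h t = (1 / δ + N) * (∑ n ∈ s, ‖a n‖ ^ 2) +
      (1 / N) * ∑ n ∈ s, ‖2 * Real.pi * Complex.I * n * a n‖ ^ 2 := by
    rw [← intervalIntegral.integral_of_le zero_le_one, ← ls_parseval s a, ← ls_parseval s,
      ← intervalIntegral.integral_const_mul, ← intervalIntegral.integral_const_mul,
      ← intervalIntegral.integral_add]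
    · apply Continuous.intervalIntegrable; fun_prop
    · apply Continuous.intervalIntegrable; exact continuous_const.mul (cg.norm.pow 2)
  have step5 : ∑ n ∈ s, ‖2 * Real.pi * Complex.I * n * a n‖ ^ 2 ≤
      40 * N ^ 2 * ∑ n ∈ s, ‖a n‖ ^ 2 := by
    rw [Finset.mul_sum]
    refine Finset.sum_le_sum fun n hn => ?_
    have e : ‖2 * Real.pi * Complex.I * n * a n‖ = 2 * Real.pi * n * ‖a n‖ := by
      simp [abs_of_pos Real.pi_pos]
    rw [e, mul_pow]
    have h2 := hs n hn
    have h3 : Real.pi < 3.15 := Real.pi_lt_d2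
    have h4 : Real.pi ^ 2 ≤ 10 := by nlinarith [Real.pi_pos]
    have h5 : (n:ℝ)^2 ≤ N^2 := by gcongr
    have h6 : (2 * Real.pi * n)^2 ≤ 40 * N^2 := by
      calc (2 * Real.pi * n)^2 = 4 * Real.pi^2 * n^2 := by ring
        _ ≤ 4 * 10 * N^2 := by gcongr
        _ = _ := by ring
    gcongr
  calc _ ≤ _ := step1
    _ = _ := step2
    _ ≤ _ := step3
    _ = _ := step4
    _ ≤ (1 / δ + N) * (∑ n ∈ s, ‖a n‖ ^ 2) + (1 / N) * (40 * N ^ 2 * ∑ n ∈ s, ‖a n‖ ^ 2) := by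
      gcongr
    _ = _ := by field_simp; ring


theorem ls_std {p : ℕ} [Fact p.Prime] (b n : ℕ) :
    ZMod.stdAddChar (N := p) ((b : ZMod p) * n) =
      Complex.exp (2 * Real.pi * Complex.I * n * ((b / p : ℝ) : ℂ)) := by
  have h := ZMod.stdAddChar_coe (N := p) ((b : ℤ) * n)
  push_cast at h
  rw [h]
  congr 1
  push_cast
  ring

theorem ls_one {p : ℕ} (hp : p.Prime) (s : Finset ℕ) (a : ℕ → ℂ) :
    ∑ᶠ ψ : {ψ : DirichletCharacter ℂ p // ψ.IsPrimitive},
      ‖∑ n ∈ s, a n * ψ.1 n‖ ^ 2 ≤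
    ∑ b ∈ Finset.Ioo 0 p, ‖lsF s a (b / p : ℝ)‖ ^ 2 := by
  have : Fact p.Prime := ⟨hp⟩
  rw [finsum_eq_sum_of_fintype]
  have h := ls_mult (p := p) s a
  rw [← Finset.sum_subtype_eq_sum_filter, Finset.subtype_univ] at h
  refine h.trans (le_of_eq ?_)
  symm
  refine Finset.sum_bij (fun b _ => (b : ZMod p)) ?_ ?_ ?_ ?_
  · intro b hb
    rw [Finset.mem_Ioo] at hb
    simp only [Finset.mem_filter, Finset.mem_univ, true_and]
    rw [Ne, ZMod.natCast_eq_zero_iff]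
    exact Nat.not_dvd_of_pos_of_lt hb.1 hb.2
  · intro b hb c hc hbc
    rw [Finset.mem_Ioo] at hb hc
    rw [ZMod.natCast_eq_natCast_iff'] at hbc
    rwa [Nat.mod_eq_of_lt hb.2, Nat.mod_eq_of_lt hc.2] at hbc
  · intro b hb
    refine ⟨b.val, ?_, ZMod.natCast_zmod_val b⟩
    rw [Finset.mem_Ioo]
    refine ⟨?_, ZMod.val_lt b⟩
    rw [ZMod.val_pos]
    exact (Finset.mem_filter.mp hb).2
  · intro b hb
    unfold lsF
    congr 2
    refine Finset.sum_congr rfl fun n _ => ?_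
    rw [ls_std]

theorem ls_main (Q : Finset ℕ) (R N : ℝ) (hQ : ∀ p ∈ Q, p.Prime ∧ (p : ℝ) ≤ R) (hN : 0 < N)
    (s : Finset ℕ) (a : ℕ → ℂ) (hs : ∀ n ∈ s, (n : ℝ) ≤ N) :
    ∑ p ∈ Q, ∑ᶠ ψ : {ψ : DirichletCharacter ℂ p // ψ.IsPrimitive},
      ‖∑ n ∈ s, a n * ψ.1 n‖ ^ 2 ≤ (R ^ 2 + 41 * N) * ∑ n ∈ s, ‖a n‖ ^ 2 := by
  refine (Finset.sum_le_sum fun p hp => ls_one (hQ p hp).1 s a).trans ?_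
  rw [Finset.sum_sigma']
  rcases Q.eq_empty_or_nonempty with rfl | ⟨q, hq⟩
  · rw [Finset.sum_sigma, Finset.sum_empty]
    positivity
  have hR : 1 < R := by
    have := (hQ q hq).1.one_lt
    have h2 : (1 : ℝ) < q := by exact_mod_cast this
    linarith [(hQ q hq).2]
  have hR0 : 0 < R := by linarith
  have hinv : 1 / R ^ 2 ≤ 1 / R := by
    apply one_div_le_one_div_of_le hR0; nlinarith
  have hkey := ls_points (Q.sigma fun p => Finset.Ioo 0 p) (fun i => (i.2 / i.1 : ℝ)) s a
    (1 / R ^ 2) N (by positivity) hN hs ?_ ?_ ?_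
  · rw [one_div_one_div] at hkey
    exact hkey
  · rintro ⟨p, b⟩ hi
    simp only [Finset.mem_sigma, Finset.mem_Ioo] at hi
    obtain ⟨hp, hb0, hbp⟩ := hi
    have hpR := (hQ p hp).2
    have hp0 : (0:ℝ) < p := by exact_mod_cast (hQ p hp).1.pos
    have hb1 : (1:ℝ) ≤ b := by exact_mod_cast hb0
    have h1 : 1 / R ≤ b / p := by gcongr
    have h2 : 0 < 1 / R ^ 2 := by positivity
    simp only
    linarith
  · rintro ⟨p, b⟩ hi
    simp only [Finset.mem_sigma, Finset.mem_Ioo] at hi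
    obtain ⟨hp, hb0, hbp⟩ := hi
    have hpR := (hQ p hp).2
    have hp0 : (0:ℝ) < p := by exact_mod_cast (hQ p hp).1.pos
    have hb1 : (b:ℝ) + 1 ≤ p := by exact_mod_cast hbp
    have h1 : 1 / R ≤ 1 / (p:ℝ) := by gcongr
    have h2 : 0 < 1 / R ^ 2 := by positivity
    have h3 : (b:ℝ) / p ≤ 1 - 1 / p := by
      rw [le_sub_iff_add_le, ← add_div, div_le_one hp0]; exact hb1
    simp only
    linarith
  · rintro ⟨p, b⟩ hi ⟨q, c⟩ hj hne
    simp only [Finset.mem_sigma, Finset.mem_Ioo] at hi hj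
    obtain ⟨hp, hb0, hbp⟩ := hi
    obtain ⟨hq, hc0, hcq⟩ := hj
    have hpR := (hQ p hp).2
    have hqR := (hQ q hq).2
    have hp0 : (0:ℝ) < p := by exact_mod_cast (hQ p hp).1.pos
    have hq0 : (0:ℝ) < q := by exact_mod_cast (hQ q hq).1.pos
    simp only
    have hIntg : (b : ℤ) * q - c * p ≠ 0 := by
      intro h0
      have h1 : b * q = c * p := by
        have : (b : ℤ) * q = c * p := by linarith
        exact_mod_cast this
      by_cases hpq : p = q
      · subst hpq
        have := Nat.eq_of_mul_eq_mul_right (hQ p hp).1.pos h1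
        subst this
        exact hne rfl
      · have hd : p ∣ b * q := ⟨c, by rw [h1]; ring⟩
        rcases (Nat.Prime.dvd_mul (hQ p hp).1).mp hd with h | h
        · exact Nat.not_dvd_of_pos_of_lt hb0 hbp h
        · exact hpq ((Nat.prime_dvd_prime_iff_eq (hQ p hp).1 (hQ q hq).1).mp h)
    have habs : (1:ℝ) ≤ |(b:ℝ) * q - c * p| := by
      have := Int.one_le_abs hIntg
      exact_mod_cast this
    have e : (b:ℝ) / p - c / q = (b * q - c * p) / (p * q) := by
      field_simp
    rw [e, abs_div, abs_of_pos (mul_pos hp0 hq0)]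
    have : (p:ℝ) * q ≤ R ^ 2 := by rw [pow_two]; gcongr
    gcongr


theorem fin_floor_int (h : ℕ → ℝ) (a b : ℝ) (ha : 0 < a) (hab : a ≤ b) :
    IntervalIntegrable (fun x : ℝ => h ⌊x⌋₊ / x) MeasureTheory.volume a b := by
  rw [intervalIntegrable_iff_integrableOn_Ioc_of_le hab]
  have hm : Measurable fun x : ℝ => h ⌊x⌋₊ / x :=
    ((measurable_from_nat (f := h)).comp Nat.measurable_floor).div measurable_id
  refine MeasureTheory.Measure.integrableOn_of_bounded
    (M := (∑ k ∈ Finset.range (⌊b⌋₊ + 1), |h k|) / a) (by simp) hm.aestronglyMeasurable ?_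
  rw [MeasureTheory.ae_restrict_iff' measurableSet_Ioc]
  refine Filter.Eventually.of_forall fun x hx => ?_
  have hx0 : 0 < x := ha.trans hx.1
  rw [norm_div, Real.norm_eq_abs, Real.norm_eq_abs, abs_of_pos hx0]
  have h1 : |h ⌊x⌋₊| ≤ ∑ k ∈ Finset.range (⌊b⌋₊ + 1), |h k| := by
    refine Finset.single_le_sum (f := fun k => |h k|) (fun k _ => abs_nonneg _) ?_
    rw [Finset.mem_range, Nat.lt_succ_iff]
    exact Nat.floor_le_floor hx.2
  have := hx.1.le
  gcongr

theorem fin_bad (h : ℕ → ℝ) (g : ℝ) (a b η l : ℝ) (ha : 0 < a) (hab : a ≤ b)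
    (hη : 0 < η) (hl : 0 < l) (hlog : Real.log (b / a) ≤ l)
    (hbad : η ≤ g + ∫ x in a..b, h ⌊x⌋₊ / x) :
    1 ≤ 4 / η ^ 2 * g ^ 2 + 4 * l / η ^ 2 * ∫ x in a..b, h ⌊x⌋₊ ^ 2 / x := by
  have hint1 := fin_floor_int h a b ha hab
  have hint2 := fin_floor_int (fun k => h k ^ 2) a b ha hab
  have hint3 := fin_floor_int (fun _ => 1) a b ha hab
  have hI0 : 0 ≤ ∫ x in a..b, h ⌊x⌋₊ ^ 2 / x := by
    refine intervalIntegral.integral_nonneg hab fun x hx => ?_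
    have : 0 < x := ha.trans_le hx.1
    positivity
  set I := ∫ x in a..b, h ⌊x⌋₊ ^ 2 / x with hI
  have hI1 : ∫ x in a..b, (1:ℝ) / x ≤ l := by
    rw [integral_one_div_of_pos ha (ha.trans_le hab)]; exact hlog
  have key : ∫ x in a..b, h ⌊x⌋₊ / x ≤ l / η * I + η / 4 := by
    have h1 : ∫ x in a..b, h ⌊x⌋₊ / x ≤
        ∫ x in a..b, (l / η * (h ⌊x⌋₊ ^ 2 / x) + η / (4 * l) * (1 / x)) := by
      refine intervalIntegral.integral_mono_on hab hint1
        ((hint2.const_mul _).add (hint3.const_mul _)) fun x hx => ?_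
      have hx0 : 0 < x := ha.trans_le hx.1
      have h2 : h ⌊x⌋₊ ≤ l / η * h ⌊x⌋₊ ^ 2 + η / (4 * l) := by
        have h3 : 0 ≤ l / η * (h ⌊x⌋₊ - η / (2 * l)) ^ 2 := by positivity
        have h4 : l / η * (h ⌊x⌋₊ - η / (2 * l)) ^ 2 =
          l / η * h ⌊x⌋₊ ^ 2 + η / (4 * l) - h ⌊x⌋₊ := by field_simp; ring
        linarith
      have h5 := div_le_div_of_nonneg_right h2 hx0.le
      refine h5.trans (le_of_eq ?_)
      ring
    rw [intervalIntegral.integral_add (hint2.const_mul _) (hint3.const_mul _),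
      intervalIntegral.integral_const_mul, intervalIntegral.integral_const_mul] at h1
    refine h1.trans ?_
    have h2 : η / (4 * l) * ∫ x in a..b, (1:ℝ) / x ≤ η / (4 * l) * l := by gcongr
    have h3 : η / (4 * l) * l = η / 4 := by field_simp
    linarith
  have hη2 : 0 < η ^ 2 := by positivity
  rcases le_or_gt (η / 2) g with hg | hg
  · have h1 : η ^ 2 / 4 ≤ g ^ 2 := by nlinarith
    have h2 : 1 ≤ 4 / η ^ 2 * g ^ 2 := by
      rw [div_mul_eq_mul_div, one_le_div hη2]; linarith
    have h3 : 0 ≤ 4 * l / η ^ 2 * I := by positivity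
    linarith
  · have h1 : η / 4 ≤ l / η * I := by linarith
    have h2 : 1 ≤ 4 * l / η ^ 2 * I := by
      have e : 4 * l / η ^ 2 * I = (l / η * I) / (η / 4) := by field_simp
      rw [e, one_le_div (by positivity)]; exact h1
    have h3 : 0 ≤ 4 / η ^ 2 * g ^ 2 := by positivity
    linarith

def finX (D : ℕ) (χ : DirichletCharacter ℂ D) {p : ℕ} (ψ : DirichletCharacter ℂ p) (k : ℕ) : ℝ :=
  ‖∑ n ∈ Finset.Ioc (D ^ 4) k, (nuF D χ n * (n : ℂ) ^ (-s0 D)) * ψ (n : ZMod p)‖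

theorem finX_eq (D : ℕ) (χ : DirichletCharacter ℂ D) {p : ℕ} (ψ : DirichletCharacter ℂ p) (x : ℝ) :
    ‖X3 D χ ψ x‖ = finX D χ ψ ⌊x⌋₊ := by
  unfold X3 finX
  congr 1
  refine Finset.sum_congr rfl fun n _ => ?_
  ring

def finM (D : ℕ) (χ : DirichletCharacter ℂ D) (p k : ℕ) : ℝ :=
  ∑ᶠ ψ : {ψ : DirichletCharacter ℂ p // ψ.IsPrimitive}, finX D χ ψ.1 k ^ 2

theorem fin_count (D : ℕ) (χ : DirichletCharacter ℂ D) {p : ℕ} (hp : p.Prime) (l : ℝ)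
    (hD : 0 < D) (hab : (D:ℝ) ^ 4 ≤ bigP D ^ 2) (hy : 0 < bigL D) (hl : 0 < l)
    (hlog : Real.log (bigP D ^ 2 / (D:ℝ) ^ 4) ≤ l) :
    (Nat.card {ψ : DirichletCharacter ℂ p // ψ.IsPrimitive ∧ ¬Ineq2 D χ ψ} : ℝ) ≤
      4 / (bigL D ^ (-585 : ℤ)) ^ 2 * finM D χ p ⌊bigP D ^ 2⌋₊ +
      4 * l / (bigL D ^ (-585 : ℤ)) ^ 2 *
        ∫ x in ((D : ℝ) ^ 4)..(bigP D ^ 2), finM D χ p ⌊x⌋₊ / x := by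
  have : Fact p.Prime := ⟨hp⟩
  have ha : (0:ℝ) < (D:ℝ) ^ 4 := by positivity
  have hη : 0 < bigL D ^ (-585 : ℤ) := by positivity
  set η := bigL D ^ (-585 : ℤ) with hηd
  set a := (D:ℝ) ^ 4 with had
  set b := bigP D ^ 2 with hbd
  set J : DirichletCharacter ℂ p → ℝ := fun ψ => 4 / η ^ 2 * finX D χ ψ ⌊b⌋₊ ^ 2 +
    4 * l / η ^ 2 * ∫ x in a..b, finX D χ ψ ⌊x⌋₊ ^ 2 / x with hJ
  have hJ0 : ∀ ψ, 0 ≤ J ψ := by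
    intro ψ
    have hI0 : 0 ≤ ∫ x in a..b, finX D χ ψ ⌊x⌋₊ ^ 2 / x := by
      refine intervalIntegral.integral_nonneg hab fun x hx => ?_
      have : 0 < x := ha.trans_le hx.1
      positivity
    positivity
  have hbad : ∀ ψ : DirichletCharacter ℂ p, ¬ Ineq2 D χ ψ → 1 ≤ J ψ := by
    intro ψ hψ
    unfold Ineq2 at hψ
    rw [not_lt, finX_eq] at hψ
    simp_rw [finX_eq] at hψ
    exact fin_bad (finX D χ ψ) _ a b η l ha hab hη hl hlog hψ
  have hM : ∀ k, finM D χ p k =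
      ∑ ψ ∈ (Finset.univ.filter fun ψ : DirichletCharacter ℂ p => ψ.IsPrimitive),
        finX D χ ψ k ^ 2 := by
    intro k
    unfold finM
    rw [finsum_eq_sum_of_fintype, ← Finset.sum_subtype_eq_sum_filter, Finset.subtype_univ]
  have hcard : (Nat.card {ψ : DirichletCharacter ℂ p // ψ.IsPrimitive ∧ ¬Ineq2 D χ ψ} : ℝ) ≤
      ∑ ψ ∈ (Finset.univ.filter fun ψ : DirichletCharacter ℂ p => ψ.IsPrimitive), J ψ := by
    rw [Nat.card_eq_fintype_card, Fintype.card_subtype]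
    calc _ = ∑ ψ ∈ (Finset.univ.filter fun ψ : DirichletCharacter ℂ p =>
            ψ.IsPrimitive ∧ ¬Ineq2 D χ ψ), (1:ℝ) := by simp
      _ ≤ ∑ ψ ∈ (Finset.univ.filter fun ψ : DirichletCharacter ℂ p =>
            ψ.IsPrimitive ∧ ¬Ineq2 D χ ψ), J ψ :=
          Finset.sum_le_sum fun ψ hψ => hbad ψ (Finset.mem_filter.mp hψ).2.2
      _ ≤ _ := by
          refine Finset.sum_le_sum_of_subset_of_nonneg ?_ fun ψ _ _ => hJ0 ψ
          intro ψ hψ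
          rw [Finset.mem_filter] at hψ ⊢
          exact ⟨hψ.1, hψ.2.1⟩
  refine hcard.trans (le_of_eq ?_)
  simp only [hJ]
  rw [Finset.sum_add_distrib, ← Finset.mul_sum, ← Finset.mul_sum, ← hM,
    ← intervalIntegral.integral_finsetSum]
  · congr 2
    refine intervalIntegral.integral_congr fun x _ => ?_
    rw [hM, Finset.sum_div]
  · intro ψ _
    exact fin_floor_int (fun k => finX D χ ψ k ^ 2) a b ha hab

theorem fin_sieve {D : ℕ} {χ : DirichletCharacter ℂ D} (hr : IsRealChar χ) (hy : 1 ≤ bigL D)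
    (k : ℕ) (hk : k ≤ ⌊bigP D ^ 2⌋₊) :
    ∑ p ∈ primesP D, finM D χ p k ≤
      45 * bigP D ^ 2 * ∑ n ∈ Finset.Ioc (D ^ 4) ⌊bigP D ^ 2⌋₊, rcV (rcOf χ) n ^ 2 / n := by
  have hP : 0 < bigP D := Real.exp_pos _
  have h1 := ls_main (primesP D) (2 * bigP D) (bigP D ^ 2) ?_ (by positivity)
    (Finset.Ioc (D ^ 4) k) (fun n => nuF D χ n * (n : ℂ) ^ (-s0 D)) ?_
  · refine h1.trans ?_
    rw [show (2 * bigP D) ^ 2 + 41 * bigP D ^ 2 = 45 * bigP D ^ 2 by ring]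
    refine mul_le_mul_of_nonneg_left ?_ (by positivity)
    refine le_trans (le_of_eq ?_) (Finset.sum_le_sum_of_subset_of_nonneg
      (Finset.Ioc_subset_Ioc_right hk) fun n _ _ => by positivity)
    refine Finset.sum_congr rfl fun n hn => ?_
    have hn0 : 0 < n := by rw [Finset.mem_Ioc] at hn; omega
    have hn0' : (0:ℝ) < n := by exact_mod_cast hn0
    rw [norm_mul, mul_pow, nuF_eq hr, Complex.norm_real, Real.norm_eq_abs, sq_abs,
      Complex.norm_natCast_cpow_of_pos hn0]
    have hre : (-s0 D).re = -(1/2) := by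
      simp [s0]
    have hsq : ((n:ℝ) ^ (-(1/2) : ℝ)) ^ 2 = (n:ℝ)⁻¹ := by
      rw [← Real.rpow_natCast, ← Real.rpow_mul hn0'.le, ← Real.rpow_neg_one]
      norm_num
    rw [hre, hsq, div_eq_mul_inv]
  · intro p hp
    have h2 := (Finset.mem_filter.mp hp).2
    refine ⟨h2.1, h2.2.2.le.trans ?_⟩
    have : bigL D ^ (-68 : ℤ) ≤ 1 := by
      rw [zpow_neg]
      exact inv_le_one_of_one_le₀ (one_le_zpow₀ hy (by norm_num))
    nlinarith
  · intro n hn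
    have h2 : n ≤ ⌊bigP D ^ 2⌋₊ := (Finset.mem_Ioc.mp hn).2.trans hk
    exact (Nat.le_floor_iff (by positivity)).mp h2

theorem fin_total {D : ℕ} {χ : DirichletCharacter ℂ D} (hr : IsRealChar χ) (hy : 2 ≤ bigL D)
    (hD : 0 < D)
    (hS : ∑ n ∈ Finset.Ioc (D ^ 4) ⌊bigP D ^ 2⌋₊, rcV (rcOf χ) n ^ 2 / n ≤
      324 * bigL D ^ (-2011 : ℤ)) :
    (∑ p ∈ primesP D,
      (Nat.card {ψ : DirichletCharacter ℂ p // ψ.IsPrimitive ∧ ¬Ineq2 D χ ψ} : ℝ)) ≤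
      466560 * bigP D ^ 2 * bigL D ^ (-823 : ℤ) := by
  set y := bigL D with hydef
  have hy0 : 0 < y := by linarith
  have hDR : (0:ℝ) < D := by exact_mod_cast hD
  have hexp : Real.exp y = D := Real.exp_log hDR
  have hP2 : bigP D ^ 2 = Real.exp (2 * y ^ 9) := by
    unfold bigP; rw [← Real.exp_nat_mul]; push_cast; rfl
  have hD4 : (D:ℝ) ^ 4 = Real.exp (4 * y) := by
    rw [← hexp, ← Real.exp_nat_mul]; push_cast; rfl
  have hy9 : 2 * y ≤ y ^ 9 := by
    have h1 : (2:ℝ) ^ 8 ≤ y ^ 8 := pow_le_pow_left₀ (by norm_num) hy 8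
    have : y ^ 9 = y ^ 8 * y := by ring
    rw [this]; nlinarith
  have hab : (D:ℝ) ^ 4 ≤ bigP D ^ 2 := by
    rw [hP2, hD4]; apply Real.exp_le_exp.mpr; linarith
  have ha : (0:ℝ) < (D:ℝ) ^ 4 := by positivity
  have hl : 0 < 2 * y ^ 9 := by positivity
  have hlog : Real.log (bigP D ^ 2 / (D:ℝ) ^ 4) ≤ 2 * y ^ 9 := by
    rw [hP2, hD4, ← Real.exp_sub, Real.log_exp]; linarith
  set l := 2 * y ^ 9 with hldef
  have hl1 : 1 ≤ l := by linarith
  set η := y ^ (-585 : ℤ) with hη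
  have hη0 : 0 < η := by positivity
  set S := ∑ n ∈ Finset.Ioc (D ^ 4) ⌊bigP D ^ 2⌋₊, rcV (rcOf χ) n ^ 2 / n with hSd
  set B := 45 * bigP D ^ 2 * S with hB
  have hS0 : 0 ≤ S := Finset.sum_nonneg fun n _ => by positivity
  have hB0 : 0 ≤ B := by positivity
  have h1 : (∑ p ∈ primesP D,
      (Nat.card {ψ : DirichletCharacter ℂ p // ψ.IsPrimitive ∧ ¬Ineq2 D χ ψ} : ℝ)) ≤
      4 / η ^ 2 * ∑ p ∈ primesP D, finM D χ p ⌊bigP D ^ 2⌋₊ + 4 * l / η ^ 2 *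
        ∑ p ∈ primesP D, ∫ x in ((D : ℝ) ^ 4)..(bigP D ^ 2), finM D χ p ⌊x⌋₊ / x := by
    rw [Finset.mul_sum, Finset.mul_sum, ← Finset.sum_add_distrib]
    exact Finset.sum_le_sum fun p hp =>
      fin_count D χ (Finset.mem_filter.mp hp).2.1 l hD hab hy0 hl hlog
  have h2 : ∑ p ∈ primesP D, finM D χ p ⌊bigP D ^ 2⌋₊ ≤ B :=
    fin_sieve hr (by linarith) _ le_rfl
  have h3 : ∑ p ∈ primesP D, ∫ x in ((D : ℝ) ^ 4)..(bigP D ^ 2), finM D χ p ⌊x⌋₊ / x ≤ B * l := by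
    rw [← intervalIntegral.integral_finsetSum
      fun p _ => fin_floor_int (fun k => finM D χ p k) _ _ ha hab]
    have h4 : ∫ x in ((D : ℝ) ^ 4)..(bigP D ^ 2), ∑ p ∈ primesP D, finM D χ p ⌊x⌋₊ / x ≤
        ∫ x in ((D : ℝ) ^ 4)..(bigP D ^ 2), B * (1 / x) := by
      refine intervalIntegral.integral_mono_on hab ?_ ?_ fun x hx => ?_
      · simp_rw [← Finset.sum_div]
        exact fin_floor_int (fun k => ∑ p ∈ primesP D, finM D χ p k) _ _ ha hab
      · exact (fin_floor_int (fun _ => 1) _ _ ha hab).const_mul B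
      · have hx0 : 0 < x := ha.trans_le hx.1
        rw [← Finset.sum_div, mul_one_div]
        refine div_le_div_of_nonneg_right ?_ hx0.le
        exact fin_sieve hr (by linarith) _ (Nat.floor_le_floor hx.2)
    refine h4.trans ?_
    rw [intervalIntegral.integral_const_mul, integral_one_div_of_pos ha (ha.trans_le hab)]
    exact mul_le_mul_of_nonneg_left hlog hB0
  have h5 : (∑ p ∈ primesP D,
      (Nat.card {ψ : DirichletCharacter ℂ p // ψ.IsPrimitive ∧ ¬Ineq2 D χ ψ} : ℝ)) ≤
      8 * l ^ 2 / η ^ 2 * B := by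
    calc _ ≤ 4 / η ^ 2 * B + 4 * l / η ^ 2 * (B * l) := by
          refine h1.trans ?_
          gcongr
      _ = (4 + 4 * l ^ 2) / η ^ 2 * B := by ring
      _ ≤ _ := by
          gcongr
          nlinarith
  refine h5.trans ?_
  calc 8 * l ^ 2 / η ^ 2 * B ≤ 8 * l ^ 2 / η ^ 2 * (45 * bigP D ^ 2 * (324 * y ^ (-2011 : ℤ))) := by
        rw [hB]; gcongr
    _ = 466560 * bigP D ^ 2 * (y ^ (18 : ℤ) * (y ^ (1170 : ℤ) * y ^ (-2011 : ℤ))) := by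
        have e1 : 1 / η ^ 2 = y ^ (1170 : ℤ) := by
          rw [hη, one_div, ← zpow_natCast, ← zpow_mul, ← zpow_neg]; norm_num
        have e2 : y ^ (18 : ℤ) = y ^ 18 := by norm_cast
        rw [← e1, e2, hldef]
        ring
    _ = _ := by
        rw [← zpow_add₀ hy0.ne', ← zpow_add₀ hy0.ne']; norm_num

/-- Under (A), the number of `ψ ∈ Ψ` for which (3.5) fails is
`≤ C 𝒫 𝓛^{-739}`. -/
theorem statement5 :
    ∃ C : ℝ, 0 < C ∧ ∃ D₀ : ℕ, ∀ D : ℕ, D₀ ≤ D → ∀ χ : DirichletCharacter ℂ D,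
      IsRealChar χ → χ.IsPrimitive → AssumptionA D χ →
        (∑ p ∈ primesP D,
            (Nat.card {ψ : DirichletCharacter ℂ p // ψ.IsPrimitive ∧ ¬Ineq2 D χ ψ} : ℝ)) ≤
          C * calP D * bigL D ^ (-739 : ℤ) := by
  obtain ⟨c, hc, hcal⟩ := calP_lower
  have hall := (hcal.and rc_S).and ((tendsto_bigL.eventually_ge_atTop 2).and
    (Filter.eventually_gt_atTop 0))
  obtain ⟨D₀, hD₀⟩ := Filter.eventually_atTop.mp hall
  refine ⟨466560 / c, by positivity, D₀, fun D hD χ hr hp hA => ?_⟩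
  obtain ⟨⟨h1, h2⟩, hy, hD0⟩ := hD₀ D hD
  refine (fin_total hr hy hD0 (h2 χ hr hp hA)).trans ?_
  have hy0 : 0 < bigL D := by linarith
  have h3 : bigL D ^ (-823 : ℤ) ≤ bigL D ^ (-77 : ℤ) * bigL D ^ (-739 : ℤ) := by
    rw [← zpow_add₀ hy0.ne']
    exact zpow_le_zpow_right₀ (by linarith) (by norm_num)
  calc _ ≤ 466560 * bigP D ^ 2 * (bigL D ^ (-77 : ℤ) * bigL D ^ (-739 : ℤ)) := by gcongr
    _ = 466560 / c * (c * bigP D ^ 2 * bigL D ^ (-77 : ℤ)) * bigL D ^ (-739 : ℤ) := by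
        field_simp
    _ ≤ _ := by gcongr


end
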